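/- Let T be any recursively enumerable extension of PA(K) with T ⊬ □⊥. If T has (B, Σ₁)-DP, then T is Σ₁-sound. -/

import Mathlib

namespace ModalArith

/-- Terms of the language of arithmetic L_A = {0, S, +, ×, ≤, =}. -/
inductive Term : Type
  | var : ℕ → Term
  | zero : Term
  | succ : Term → Term
  | add : Term → Term → Term
  | mul : Term → Term → Term
  deriving DecidableEq

namespace Term

/-- Free variables of a term. -/
def fv : Term → Finset ℕ
  | var x => {x}
  | zero => ∅
  | succ t => fv t
  | add t u => fv t ∪ fv u
  | mul t u => fv t ∪ fv u

/-- Simultaneous substitution of terms for variables. -/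
def substAll : Term → (ℕ → Term) → Term
  | var x, v => v x
  | zero, _ => zero
  | succ t, v => succ (substAll t v)
  | add t u, v => add (substAll t v) (substAll u v)
  | mul t u, v => mul (substAll t v) (substAll u v)

/-- Substitution of the term `s` for the variable `x`. -/
def subst (x : ℕ) (s : Term) (t : Term) : Term :=
  substAll t (Function.update Term.var x s)

/-- The numeral `n̄`. -/
def numeral : ℕ → Term
  | 0 => zero
  | n + 1 => succ (numeral n)

/-- Value of a term in the standard model under a valuation. -/
def val : Term → (ℕ → ℕ) → ℕ
  | var x, v => v x
  | zero, _ => 0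
  | succ t, v => val t v + 1
  | add t u, v => val t v + val u v
  | mul t u, v => val t v * val u v

/-- A Gödel numbering of terms. -/
def code : Term → ℕ
  | var x => Nat.pair 0 x
  | zero => Nat.pair 1 0
  | succ t => Nat.pair 2 (code t)
  | add t u => Nat.pair 3 (Nat.pair (code t) (code u))
  | mul t u => Nat.pair 4 (Nat.pair (code t) (code u))

end Term

/-- Formulas of the language L_□ of modal arithmetic. -/
inductive Formula : Type
  | falsum : Formula
  | eq : Term → Term → Formula
  | le : Term → Term → Formula
  | and : Formula → Formula → Formula
  | or : Formula → Formula → Formula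
  | imp : Formula → Formula → Formula
  | neg : Formula → Formula
  | all : ℕ → Formula → Formula
  | ex : ℕ → Formula → Formula
  | box : Formula → Formula
  deriving DecidableEq

namespace Formula

/-- Free variables of a formula. -/
def fv : Formula → Finset ℕ
  | falsum => ∅
  | eq t u => t.fv ∪ u.fv
  | le t u => t.fv ∪ u.fv
  | and φ ψ => fv φ ∪ fv ψ
  | or φ ψ => fv φ ∪ fv ψ
  | imp φ ψ => fv φ ∪ fv ψ
  | neg φ => fv φ
  | all x φ => (fv φ).erase x
  | ex x φ => (fv φ).erase x
  | box φ => fv φ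

/-- Simultaneous substitution of terms for the free variables of a formula. -/
def substAll : Formula → (ℕ → Term) → Formula
  | falsum, _ => falsum
  | eq t u, v => eq (t.substAll v) (u.substAll v)
  | le t u, v => le (t.substAll v) (u.substAll v)
  | and φ ψ, v => and (substAll φ v) (substAll ψ v)
  | or φ ψ, v => or (substAll φ v) (substAll ψ v)
  | imp φ ψ, v => imp (substAll φ v) (substAll ψ v)
  | neg φ, v => neg (substAll φ v)
  | all x φ, v => all x (substAll φ (Function.update v x (Term.var x)))
  | ex x φ, v => ex x (substAll φ (Function.update v x (Term.var x)))
  | box φ, v => box (substAll φ v)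

/-- Substitution of the term `s` for the free occurrences of the variable `x`. -/
def subst (x : ℕ) (s : Term) (φ : Formula) : Formula :=
  substAll φ (Function.update Term.var x s)

/-- The term `s` is substitutable (free) for the variable `x` in the formula. -/
def freeFor (s : Term) (x : ℕ) : Formula → Prop
  | falsum => True
  | eq _ _ => True
  | le _ _ => True
  | and φ ψ => freeFor s x φ ∧ freeFor s x ψ
  | or φ ψ => freeFor s x φ ∧ freeFor s x ψ
  | imp φ ψ => freeFor s x φ ∧ freeFor s x ψ
  | neg φ => freeFor s x φ
  | all y φ => x = y ∨ x ∉ fv φ ∨ (y ∉ s.fv ∧ freeFor s x φ)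
  | ex y φ => x = y ∨ x ∉ fv φ ∨ (y ∉ s.fv ∧ freeFor s x φ)
  | box φ => freeFor s x φ

/-- The formula is an L_A-formula (contains no □). -/
def noBox : Formula → Prop
  | falsum => True
  | eq _ _ => True
  | le _ _ => True
  | and φ ψ => noBox φ ∧ noBox ψ
  | or φ ψ => noBox φ ∧ noBox ψ
  | imp φ ψ => noBox φ ∧ noBox ψ
  | neg φ => noBox φ
  | all _ φ => noBox φ
  | ex _ φ => noBox φ
  | box _ => False

/-- Truth in the standard model ℕ under a valuation (meaningful for L_A-formulas;
boxed formulas are given the dummy value `False`). -/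
def val : Formula → (ℕ → ℕ) → Prop
  | falsum, _ => False
  | eq t u, v => t.val v = u.val v
  | le t u, v => t.val v ≤ u.val v
  | and φ ψ, v => val φ v ∧ val ψ v
  | or φ ψ, v => val φ v ∨ val ψ v
  | imp φ ψ, v => val φ v → val ψ v
  | neg φ, v => ¬ val φ v
  | all x φ, v => ∀ n : ℕ, val φ (Function.update v x n)
  | ex x φ, v => ∃ n : ℕ, val φ (Function.update v x n)
  | box _, _ => False

/-- Biconditional, as an abbreviation. -/
def iff (φ ψ : Formula) : Formula := (φ.imp ψ).and (ψ.imp φ)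

/-- `t < u` abbreviates `S t ≤ u`. -/
def lt (t u : Term) : Formula := le (Term.succ t) u

/-- Bounded universal quantification `∀ x < t, φ`. -/
def ball (x : ℕ) (t : Term) (φ : Formula) : Formula :=
  all x ((lt (Term.var x) t).imp φ)

/-- Bounded existential quantification `∃ x < t, φ`. -/
def bex (x : ℕ) (t : Term) (φ : Formula) : Formula :=
  ex x ((lt (Term.var x) t).and φ)

/-- A Gödel numbering of formulas. -/
def code : Formula → ℕ
  | falsum => Nat.pair 0 0
  | eq t u => Nat.pair 1 (Nat.pair t.code u.code)
  | le t u => Nat.pair 2 (Nat.pair t.code u.code)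
  | and φ ψ => Nat.pair 3 (Nat.pair (code φ) (code ψ))
  | or φ ψ => Nat.pair 4 (Nat.pair (code φ) (code ψ))
  | imp φ ψ => Nat.pair 5 (Nat.pair (code φ) (code ψ))
  | neg φ => Nat.pair 6 (code φ)
  | all x φ => Nat.pair 7 (Nat.pair x (code φ))
  | ex x φ => Nat.pair 8 (Nat.pair x (code φ))
  | box φ => Nat.pair 9 (code φ)

end Formula

/-- A sentence is a formula with no free variables. -/
def Sentence (φ : Formula) : Prop := φ.fv = ∅

/-- Truth in the standard model ℕ (for sentences; any fixed valuation will do). -/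
def StdTrue (φ : Formula) : Prop := φ.val fun _ => 0

/-- The logical axioms of classical first-order logic with equality for L_□,
with the identity axioms only for atomic formulas. -/
inductive LogicalAxiom : Formula → Prop
  | imp1 (φ ψ : Formula) : LogicalAxiom (φ.imp (ψ.imp φ))
  | imp2 (φ ψ χ : Formula) :
      LogicalAxiom ((φ.imp (ψ.imp χ)).imp ((φ.imp ψ).imp (φ.imp χ)))
  | dne (φ : Formula) : LogicalAxiom (φ.neg.neg.imp φ)
  | negI (φ ψ : Formula) : LogicalAxiom ((φ.imp ψ).imp ((φ.imp ψ.neg).imp φ.neg))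
  | negE (φ ψ : Formula) : LogicalAxiom (φ.neg.imp (φ.imp ψ))
  | falsumE (φ : Formula) : LogicalAxiom (Formula.falsum.imp φ)
  | negIntro (φ : Formula) : LogicalAxiom ((φ.imp Formula.falsum).imp φ.neg)
  | negElimFalsum (φ : Formula) : LogicalAxiom (φ.neg.imp (φ.imp Formula.falsum))
  | andI (φ ψ : Formula) : LogicalAxiom (φ.imp (ψ.imp (φ.and ψ)))
  | andE1 (φ ψ : Formula) : LogicalAxiom ((φ.and ψ).imp φ)
  | andE2 (φ ψ : Formula) : LogicalAxiom ((φ.and ψ).imp ψ)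
  | orI1 (φ ψ : Formula) : LogicalAxiom (φ.imp (φ.or ψ))
  | orI2 (φ ψ : Formula) : LogicalAxiom (ψ.imp (φ.or ψ))
  | orE (φ ψ χ : Formula) :
      LogicalAxiom ((φ.imp χ).imp ((ψ.imp χ).imp ((φ.or ψ).imp χ)))
  | allE (x : ℕ) (t : Term) (φ : Formula) :
      φ.freeFor t x → LogicalAxiom ((Formula.all x φ).imp (φ.subst x t))
  | allImp (x : ℕ) (φ ψ : Formula) :
      x ∉ φ.fv → LogicalAxiom ((Formula.all x (φ.imp ψ)).imp (φ.imp (Formula.all x ψ)))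
  | exI (x : ℕ) (t : Term) (φ : Formula) :
      φ.freeFor t x → LogicalAxiom ((φ.subst x t).imp (Formula.ex x φ))
  | exE (x : ℕ) (φ ψ : Formula) :
      x ∉ ψ.fv → LogicalAxiom ((Formula.all x (φ.imp ψ)).imp ((Formula.ex x φ).imp ψ))
  | eqRefl (t : Term) : LogicalAxiom (Formula.eq t t)
  | eqSymm (t u : Term) : LogicalAxiom ((Formula.eq t u).imp (Formula.eq u t))
  | eqTrans (t u w : Term) :
      LogicalAxiom ((Formula.eq t u).imp ((Formula.eq u w).imp (Formula.eq t w)))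
  | eqSucc (t u : Term) :
      LogicalAxiom ((Formula.eq t u).imp (Formula.eq t.succ u.succ))
  | eqAdd (t₁ t₂ u₁ u₂ : Term) :
      LogicalAxiom ((Formula.eq t₁ t₂).imp ((Formula.eq u₁ u₂).imp
        (Formula.eq (t₁.add u₁) (t₂.add u₂))))
  | eqMul (t₁ t₂ u₁ u₂ : Term) :
      LogicalAxiom ((Formula.eq t₁ t₂).imp ((Formula.eq u₁ u₂).imp
        (Formula.eq (t₁.mul u₁) (t₂.mul u₂))))
  | eqLe (t₁ t₂ u₁ u₂ : Term) :
      LogicalAxiom ((Formula.eq t₁ t₂).imp ((Formula.eq u₁ u₂).imp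
        ((Formula.le t₁ u₁).imp (Formula.le t₂ u₂))))

/-- Provability in an L_□-theory: logical axioms, the axioms of the theory, and the
rules modus ponens, generalization, and necessitation. -/
inductive Provable (T : Set Formula) : Formula → Prop
  | ax {φ : Formula} : φ ∈ T → Provable T φ
  | logic {φ : Formula} : LogicalAxiom φ → Provable T φ
  | mp {φ ψ : Formula} : Provable T (φ.imp ψ) → Provable T φ → Provable T ψ
  | gen {φ : Formula} (x : ℕ) : Provable T φ → Provable T (Formula.all x φ)
  | nec {φ : Formula} : Provable T φ → Provable T (Formula.box φ)

/-- First-order provability (no necessitation rule); used for the non-modal theory PA. -/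
inductive FOProvable (T : Set Formula) : Formula → Prop
  | ax {φ : Formula} : φ ∈ T → FOProvable T φ
  | logic {φ : Formula} : LogicalAxiom φ → FOProvable T φ
  | mp {φ ψ : Formula} : FOProvable T (φ.imp ψ) → FOProvable T φ → FOProvable T ψ
  | gen {φ : Formula} (x : ℕ) : FOProvable T φ → FOProvable T (Formula.all x φ)

/-- Basic (Robinson-style) axioms of arithmetic. -/
def succNeZero : Formula := (Formula.eq (Term.succ (Term.var 0)) Term.zero).neg
def succInj : Formula :=
  (Formula.eq (Term.succ (Term.var 0)) (Term.succ (Term.var 1))).imp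
    (Formula.eq (Term.var 0) (Term.var 1))
def addZero : Formula := Formula.eq (Term.add (Term.var 0) Term.zero) (Term.var 0)
def addSucc : Formula :=
  Formula.eq (Term.add (Term.var 0) (Term.succ (Term.var 1)))
    (Term.succ (Term.add (Term.var 0) (Term.var 1)))
def mulZero : Formula := Formula.eq (Term.mul (Term.var 0) Term.zero) Term.zero
def mulSucc : Formula :=
  Formula.eq (Term.mul (Term.var 0) (Term.succ (Term.var 1)))
    (Term.add (Term.mul (Term.var 0) (Term.var 1)) (Term.var 0))
def leDef : Formula :=
  (Formula.le (Term.var 0) (Term.var 1)).iff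
    (Formula.ex 2 (Formula.eq (Term.add (Term.var 0) (Term.var 2)) (Term.var 1)))

def baseAxioms : Set Formula :=
  {succNeZero, succInj, addZero, addSucc, mulZero, mulSucc, leDef}

/-- The induction axiom for the formula `φ` and the variable `x`. -/
def inductionAx (x : ℕ) (φ : Formula) : Formula :=
  ((φ.subst x Term.zero).and
    (Formula.all x (φ.imp (φ.subst x (Term.succ (Term.var x)))))).imp
      (Formula.all x φ)

/-- Peano arithmetic PA: basic axioms plus induction for L_A-formulas. -/
def PA : Set Formula :=
  baseAxioms ∪ {χ | ∃ (x : ℕ) (φ : Formula), φ.noBox ∧ χ = inductionAx x φ}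

/-- PA_□ : basic axioms plus induction for all L_□-formulas. -/
def PABox : Set Formula :=
  baseAxioms ∪ {χ | ∃ (x : ℕ) (φ : Formula), χ = inductionAx x φ}

/-- The distribution axiom K. -/
def axK (φ ψ : Formula) : Formula :=
  (Formula.box (φ.imp ψ)).imp ((Formula.box φ).imp (Formula.box ψ))

/-- PA(K). -/
def PAK : Set Formula := PABox ∪ {χ | ∃ φ ψ : Formula, χ = axK φ ψ}

/-- The axiom 4. -/
def ax4 (φ : Formula) : Formula := (Formula.box φ).imp (Formula.box (Formula.box φ))

/-- PA(K4). -/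
def PAK4 : Set Formula := PAK ∪ {χ | ∃ φ : Formula, χ = ax4 φ}

/-- The axiom of Triv. -/
def axTriv (φ : Formula) : Formula := (Formula.box φ).iff φ

/-- PA(Triv). -/
def PATriv : Set Formula := PAK ∪ {χ | ∃ φ : Formula, χ = axTriv φ}

/-- PA(Ver). -/
def PAVer : Set Formula := PAK ∪ {Formula.box Formula.falsum}

/-- `T` extends `U`: every axiom of `U` is provable in `T`. -/
def Extends (T U : Set Formula) : Prop := ∀ φ ∈ U, Provable T φ

/-- Consistency. -/
def Consistent (T : Set Formula) : Prop := ¬ Provable T Formula.falsum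

/-- The class Δ₀ of bounded L_A-formulas. -/
inductive IsDelta0 : Formula → Prop
  | falsum : IsDelta0 Formula.falsum
  | eq (t u : Term) : IsDelta0 (Formula.eq t u)
  | le (t u : Term) : IsDelta0 (Formula.le t u)
  | and {φ ψ : Formula} : IsDelta0 φ → IsDelta0 ψ → IsDelta0 (φ.and ψ)
  | or {φ ψ : Formula} : IsDelta0 φ → IsDelta0 ψ → IsDelta0 (φ.or ψ)
  | imp {φ ψ : Formula} : IsDelta0 φ → IsDelta0 ψ → IsDelta0 (φ.imp ψ)
  | neg {φ : Formula} : IsDelta0 φ → IsDelta0 φ.neg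
  | ball {x : ℕ} {t : Term} {φ : Formula} :
      x ∉ t.fv → IsDelta0 φ → IsDelta0 (Formula.ball x t φ)
  | bex {x : ℕ} {t : Term} {φ : Formula} :
      x ∉ t.fv → IsDelta0 φ → IsDelta0 (Formula.bex x t φ)

/-- The class Σ₁ of L_A-formulas. -/
inductive IsSigma1 : Formula → Prop
  | delta0 {φ : Formula} : IsDelta0 φ → IsSigma1 φ
  | and {φ ψ : Formula} : IsSigma1 φ → IsSigma1 ψ → IsSigma1 (φ.and ψ)
  | or {φ ψ : Formula} : IsSigma1 φ → IsSigma1 ψ → IsSigma1 (φ.or ψ)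
  | ex {x : ℕ} {φ : Formula} : IsSigma1 φ → IsSigma1 (Formula.ex x φ)
  | ball {x : ℕ} {t : Term} {φ : Formula} :
      x ∉ t.fv → IsSigma1 φ → IsSigma1 (Formula.ball x t φ)

/-- The class B of boxed formulas. -/
def IsB (φ : Formula) : Prop := ∃ ψ : Formula, φ = Formula.box ψ

/-- The class ΔB. -/
inductive IsDeltaB : Formula → Prop
  | delta0 {φ : Formula} : IsDelta0 φ → IsDeltaB φ
  | b (ψ : Formula) : IsDeltaB (Formula.box ψ)
  | and {φ ψ : Formula} : IsDeltaB φ → IsDeltaB ψ → IsDeltaB (φ.and ψ)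
  | or {φ ψ : Formula} : IsDeltaB φ → IsDeltaB ψ → IsDeltaB (φ.or ψ)
  | ball {x : ℕ} {t : Term} {φ : Formula} :
      x ∉ t.fv → IsDeltaB φ → IsDeltaB (Formula.ball x t φ)
  | bex {x : ℕ} {t : Term} {φ : Formula} :
      x ∉ t.fv → IsDeltaB φ → IsDeltaB (Formula.bex x t φ)

/-- The class ΣB. -/
inductive IsSigmaB : Formula → Prop
  | sigma1 {φ : Formula} : IsSigma1 φ → IsSigmaB φ
  | b (ψ : Formula) : IsSigmaB (Formula.box ψ)
  | and {φ ψ : Formula} : IsSigmaB φ → IsSigmaB ψ → IsSigmaB (φ.and ψ)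
  | or {φ ψ : Formula} : IsSigmaB φ → IsSigmaB ψ → IsSigmaB (φ.or ψ)
  | ex {x : ℕ} {φ : Formula} : IsSigmaB φ → IsSigmaB (Formula.ex x φ)
  | ball {x : ℕ} {t : Term} {φ : Formula} :
      x ∉ t.fv → IsSigmaB φ → IsSigmaB (Formula.ball x t φ)

/-- Iterated disjunction (the empty disjunction is ⊥). -/
def disj : List Formula → Formula
  | [] => Formula.falsum
  | [φ] => φ
  | φ :: ψ :: l => φ.or (disj (ψ :: l))

/-- Iterated conjunction (the empty conjunction is ⊤). -/
def conj : List Formula → Formula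
  | [] => Formula.falsum.neg
  | [φ] => φ
  | φ :: ψ :: l => φ.and (conj (ψ :: l))

/-- Γ-disjunction property. -/
def HasDP (T : Set Formula) (Γ : Formula → Prop) : Prop :=
  ∀ φ ψ : Formula, Γ φ → Γ ψ → Sentence φ → Sentence ψ →
    Provable T (φ.or ψ) → Provable T φ ∨ Provable T ψ

/-- (Γ, Θ)-disjunction property. -/
def HasDP2 (T : Set Formula) (Γ Θ : Formula → Prop) : Prop :=
  ∀ φ ψ : Formula, Γ φ → Θ ψ → Sentence φ → Sentence ψ →
    Provable T (φ.or ψ) → Provable T φ ∨ Provable T ψ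

/-- Γ-existence property. -/
def HasEP (T : Set Formula) (Γ : Formula → Prop) : Prop :=
  ∀ (x : ℕ) (φ : Formula), Γ φ → φ.fv ⊆ {x} →
    Provable T (Formula.ex x φ) → ∃ n : ℕ, Provable T (φ.subst x (Term.numeral n))

/-- Modal disjunction property. -/
def HasMDP (T : Set Formula) : Prop :=
  ∀ φ ψ : Formula, Sentence φ → Sentence ψ →
    Provable T ((Formula.box φ).or (Formula.box ψ)) → Provable T φ ∨ Provable T ψ

/-- Modal existence property. -/
def HasMEP (T : Set Formula) : Prop :=
  ∀ (x : ℕ) (φ : Formula), φ.fv ⊆ {x} →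
    Provable T (Formula.ex x (Formula.box φ)) →
      ∃ n : ℕ, Provable T (φ.subst x (Term.numeral n))

/-- n-fold B-disjunction property. -/
def HasBnDP (T : Set Formula) (n : ℕ) : Prop :=
  ∀ φ : Fin n → Formula, (∀ i, Sentence (φ i)) →
    Provable T (disj (List.ofFn fun i => Formula.box (φ i))) →
    ∃ i, Provable T (Formula.box (φ i))

/-- Σ₁-soundness. -/
def Sigma1Sound (T : Set Formula) : Prop :=
  ∀ φ : Formula, IsSigma1 φ → Sentence φ → Provable T φ → StdTrue φ

/-- L_A-soundness. -/
def LASound (T : Set Formula) : Prop :=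
  ∀ φ : Formula, φ.noBox → Sentence φ → Provable T φ → StdTrue φ

/-- `T` is recursively enumerable (via the Gödel numbering of formulas). -/
def RE (T : Set Formula) : Prop :=
  Nat.Partrec fun n => Part.assert (∃ φ ∈ T, Formula.code φ = n) fun _ => Part.some 0

/-- A fixed natural Σ₁ provability predicate `Pr_T(x)` for the theory `T`:
a Σ₁ L_A-formula with only the free variable `0` which numerates provability in `T`
in the standard model and satisfies the standard derivability conditions
(provably in PA). -/
structure ProvPred (T : Set Formula) where
  pr : Formula
  noBox : pr.noBox
  sigma1 : IsSigma1 pr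
  fvSub : pr.fv ⊆ {0}
  numerates : ∀ φ : Formula,
    StdTrue (pr.subst 0 (Term.numeral φ.code)) ↔ Provable T φ
  d1 : ∀ φ : Formula, Provable T φ → FOProvable PA (pr.subst 0 (Term.numeral φ.code))
  d2 : ∀ φ ψ : Formula,
    FOProvable PA ((pr.subst 0 (Term.numeral (φ.imp ψ).code)).imp
      ((pr.subst 0 (Term.numeral φ.code)).imp (pr.subst 0 (Term.numeral ψ.code))))
  necClosed : ∀ φ : Formula,
    FOProvable PA ((pr.subst 0 (Term.numeral φ.code)).imp
      (pr.subst 0 (Term.numeral (Formula.box φ).code)))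

/-- `Pr_T(⌜φ⌝)`. -/
def ProvPred.app {T : Set Formula} (P : ProvPred T) (φ : Formula) : Formula :=
  P.pr.subst 0 (Term.numeral φ.code)

/-- Γ-disjunctive correctness (Γ-DC). -/
def DC (T : Set Formula) (P : ProvPred T) (Γ : Formula → Prop) : Prop :=
  ∀ φ : Formula, Γ φ → Sentence φ → Provable T (φ.or (P.app φ)) → Provable T φ

/-- The substitution replacing each variable by the numeral of its value. -/
def numeralSubst (v : ℕ → ℕ) : ℕ → Term := fun x => Term.numeral (v x)

/-- Standard-model satisfaction of the ρ_T-translation: `ρ_T` is the identity on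
L_A-formulas, commutes with connectives and quantifiers, and sends `□φ(x⃗)` to
`Pr_T(⌜□φ(ẋ⃗)⌝)`, whose truth in ℕ (for a natural provability predicate) amounts to
provability in `T` of `□φ(n̄⃗)`. -/
def RhoSat (T : Set Formula) : Formula → (ℕ → ℕ) → Prop
  | .falsum, _ => False
  | .eq t u, v => t.val v = u.val v
  | .le t u, v => t.val v ≤ u.val v
  | .and φ ψ, v => RhoSat T φ v ∧ RhoSat T ψ v
  | .or φ ψ, v => RhoSat T φ v ∨ RhoSat T ψ v
  | .imp φ ψ, v => RhoSat T φ v → RhoSat T ψ v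
  | .neg φ, v => ¬ RhoSat T φ v
  | .all x φ, v => ∀ n : ℕ, RhoSat T φ (Function.update v x n)
  | .ex x φ, v => ∃ n : ℕ, RhoSat T φ (Function.update v x n)
  | .box φ, v => Provable T (Formula.box (φ.substAll (numeralSubst v)))

/-- Standard-model satisfaction of the π_T-translation: `π_T` is the identity on
L_A-formulas, commutes with connectives and quantifiers, and sends `□φ(x⃗)` to
`Pr_T(⌜φ(ẋ⃗)⌝)`, whose truth in ℕ (for a natural provability predicate) amounts to
provability in `T` of `φ(n̄⃗)`. -/
def PiSat (T : Set Formula) : Formula → (ℕ → ℕ) → Prop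
  | .falsum, _ => False
  | .eq t u, v => t.val v = u.val v
  | .le t u, v => t.val v ≤ u.val v
  | .and φ ψ, v => PiSat T φ v ∧ PiSat T ψ v
  | .or φ ψ, v => PiSat T φ v ∨ PiSat T ψ v
  | .imp φ ψ, v => PiSat T φ v → PiSat T ψ v
  | .neg φ, v => ¬ PiSat T φ v
  | .all x φ, v => ∀ n : ℕ, PiSat T φ (Function.update v x n)
  | .ex x φ, v => ∃ n : ℕ, PiSat T φ (Function.update v x n)
  | .box φ, v => Provable T (φ.substAll (numeralSubst v))

/-- Weak ΣB-soundness: every provable ΣB sentence is true in ℕ under ρ_T. -/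
def WeaklySigmaBSound (T : Set Formula) : Prop :=
  ∀ φ : Formula, IsSigmaB φ → Sentence φ → Provable T φ → RhoSat T φ fun _ => 0

/-- ΣB-soundness: every provable ΣB sentence is true in ℕ under π_T. -/
def SigmaBSound (T : Set Formula) : Prop :=
  ∀ φ : Formula, IsSigmaB φ → Sentence φ → Provable T φ → PiSat T φ fun _ => 0

end ModalArith

namespace ModalArith
open Function

/-! ### Part 1: substitution lemmas -/

theorem Term.substAll_congr {t : Term} {f g : ℕ → Term} (h : ∀ i ∈ t.fv, f i = g i) :
    t.substAll f = t.substAll g := by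
  induction t <;> simp_all [Term.substAll, Term.fv]

theorem Term.substAll_var (t : Term) : t.substAll Term.var = t := by
  induction t <;> simp_all [Term.substAll]

theorem Formula.substAll_congr {φ : Formula} : ∀ {f g : ℕ → Term},
    (∀ i ∈ φ.fv, f i = g i) → φ.substAll f = φ.substAll g := by
  induction φ with
  | eq t u =>
    intro f g h
    simp only [Formula.substAll, Formula.fv, Finset.mem_union] at *
    rw [Term.substAll_congr fun i hi => h i (Or.inl hi),
      Term.substAll_congr fun i hi => h i (Or.inr hi)]
  | le t u =>
    intro f g h
    simp only [Formula.substAll, Formula.fv, Finset.mem_union] at *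
    rw [Term.substAll_congr fun i hi => h i (Or.inl hi),
      Term.substAll_congr fun i hi => h i (Or.inr hi)]
  | falsum => intros; rfl
  | and a b iha ihb | or a b iha ihb | imp a b iha ihb =>
    intro f g h
    simp only [Formula.substAll, Formula.fv, Finset.mem_union] at *
    rw [iha fun i hi => h i (Or.inl hi), ihb fun i hi => h i (Or.inr hi)]
  | neg a iha | box a iha =>
    intro f g h
    simp only [Formula.substAll, Formula.fv] at *
    rw [iha h]
  | all x a iha | ex x a iha =>
    intro f g h
    simp only [Formula.substAll, Formula.fv, Finset.mem_erase] at *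
    rw [iha fun i hi => ?_]
    by_cases hx : i = x
    · subst hx; simp
    · simp [hx, h i ⟨hx, hi⟩]

theorem Formula.substAll_var (φ : Formula) : φ.substAll Term.var = φ := by
  induction φ <;> simp_all [Formula.substAll, Term.substAll_var, Function.update_eq_self]

theorem Formula.subst_self (φ : Formula) (x : ℕ) : φ.subst x (Term.var x) = φ := by
  simp [Formula.subst, Function.update_eq_self, Formula.substAll_var]

theorem Formula.subst_of_not_fv {φ : Formula} {x : ℕ} {s : Term} (h : x ∉ φ.fv) :
    φ.subst x s = φ := by
  rw [Formula.subst, Formula.substAll_congr (g := Term.var), Formula.substAll_var]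
  intro i hi
  have : i ≠ x := by rintro rfl; exact h hi
  simp [this]

/-- All variables of the term are `< N`. -/
def Term.Low (N : ℕ) (t : Term) : Prop := ∀ x ∈ t.fv, x < N

/-- All variables (free or bound) of the formula are `< N`. -/
def Formula.Low (N : ℕ) : Formula → Prop
  | .falsum => True
  | .eq t u => t.Low N ∧ u.Low N
  | .le t u => t.Low N ∧ u.Low N
  | .and φ ψ => Low N φ ∧ Low N ψ
  | .or φ ψ => Low N φ ∧ Low N ψ
  | .imp φ ψ => Low N φ ∧ Low N ψ
  | .neg φ => Low N φ
  | .all x φ => x < N ∧ Low N φ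
  | .ex x φ => x < N ∧ Low N φ
  | .box φ => Low N φ

/-- All bound variables of the formula are `< N`. -/
def Formula.BLow (N : ℕ) : Formula → Prop
  | .falsum => True
  | .eq _ _ => True
  | .le _ _ => True
  | .and φ ψ => BLow N φ ∧ BLow N ψ
  | .or φ ψ => BLow N φ ∧ BLow N ψ
  | .imp φ ψ => BLow N φ ∧ BLow N ψ
  | .neg φ => BLow N φ
  | .all x φ => x < N ∧ BLow N φ
  | .ex x φ => x < N ∧ BLow N φ
  | .box φ => BLow N φ

theorem Term.Low.mono {N M : ℕ} {t : Term} (h : t.Low N) (hNM : N ≤ M) : t.Low M :=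
  fun x hx => (h x hx).trans_le hNM

theorem Formula.Low.mono {N M : ℕ} (hNM : N ≤ M) : ∀ {φ : Formula}, φ.Low N → φ.Low M := by
  intro φ
  induction φ <;> simp only [Formula.Low] <;> grind [Term.Low.mono]

theorem Formula.Low.blow {N : ℕ} : ∀ {φ : Formula}, φ.Low N → φ.BLow N := by
  intro φ
  induction φ <;> simp only [Formula.Low, Formula.BLow] <;> grind

theorem Formula.Low.fv {N : ℕ} : ∀ {φ : Formula}, φ.Low N → ∀ x ∈ φ.fv, x < N := by
  intro φ
  induction φ <;> simp only [Formula.Low, Formula.fv, Term.Low] <;> grind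

theorem Term.exists_low (t : Term) : ∃ N, t.Low N :=
  ⟨t.fv.sup id + 1, fun _ hx => Nat.lt_succ_of_le (Finset.le_sup (f := id) hx)⟩

theorem Formula.exists_low (φ : Formula) : ∃ N, φ.Low N := by
  induction φ with
  | falsum => exact ⟨0, trivial⟩
  | eq t u | le t u =>
    obtain ⟨a, ha⟩ := t.exists_low
    obtain ⟨b, hb⟩ := u.exists_low
    exact ⟨max a b, ha.mono (le_max_left _ _), hb.mono (le_max_right _ _)⟩
  | and a b iha ihb | or a b iha ihb | imp a b iha ihb =>
    obtain ⟨a, ha⟩ := iha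
    obtain ⟨b, hb⟩ := ihb
    exact ⟨max a b, ha.mono (le_max_left _ _), hb.mono (le_max_right _ _)⟩
  | neg a iha | box a iha => exact iha
  | all x a iha | ex x a iha =>
    obtain ⟨a, ha⟩ := iha
    exact ⟨max (x + 1) a, by omega, ha.mono (le_max_right _ _)⟩

theorem Formula.BLow.substAll {N : ℕ} : ∀ {φ : Formula} {f : ℕ → Term}, φ.BLow N →
    (φ.substAll f).BLow N := by
  intro φ
  induction φ <;> simp only [Formula.BLow, Formula.substAll] <;> grind

/-- The term contains only variables `≥ N` (parameters). -/
def Term.High (N : ℕ) (t : Term) : Prop := ∀ x ∈ t.fv, N ≤ x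

theorem Formula.freeFor_high {N k : ℕ} {t : Term} (ht : t.High N) :
    ∀ {φ : Formula}, φ.BLow N → φ.freeFor t k := by
  intro φ
  induction φ <;> simp only [Formula.BLow, Formula.freeFor, Term.High] at * <;> grind

theorem Formula.freeFor_self (k : ℕ) : ∀ {φ : Formula}, φ.freeFor (Term.var k) k := by
  intro φ
  induction φ <;> simp only [Formula.freeFor, Term.fv] at * <;> grind

theorem Term.subst_substAll {k : ℕ} {s t : Term} {f : ℕ → Term} (hk : f k = Term.var k)
    (hf : ∀ i ≠ k, k ∉ (f i).fv) :
    (t.substAll f).substAll (update Term.var k s) = t.substAll (update f k s) := by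
  induction t with
  | var x =>
    simp only [Term.substAll]
    by_cases hx : x = k
    · subst hx; simp [hk, Term.substAll]
    · rw [Term.substAll_congr (g := Term.var), Term.substAll_var]
      · simp [hx]
      · intro i hi
        have : i ≠ k := by rintro rfl; exact hf x hx hi
        simp [this]
  | _ => simp_all [Term.substAll]

theorem Formula.subst_substAll {k : ℕ} {s : Term} : ∀ {φ : Formula} {f : ℕ → Term},
    f k = Term.var k → (∀ i ≠ k, k ∉ (f i).fv) →
    (φ.substAll f).subst k s = φ.substAll (update f k s) := by
  intro φ
  simp only [Formula.subst]
  induction φ with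
  | all z a ih | ex z a ih =>
    intro f hk hf
    simp only [Formula.substAll]
    congr 1
    by_cases hz : z = k
    · subst hz
      rw [update_idem, update_idem, update_eq_self, Formula.substAll_var]
    · rw [update_comm (Ne.symm hz), update_comm (Ne.symm hz), ← ih]
      · rw [update_eq_self]
      · simp [Ne.symm hz, hk]
      · intro i hi
        by_cases hiz : i = z
        · subst hiz; simp [Term.fv, Ne.symm hz]
        · simp [hiz, hf i hi]
  | _ => intros; simp_all [Formula.substAll, Term.subst_substAll]

theorem Term.substAll_subst {x : ℕ} {s t : Term} {w : ℕ → Term} :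
    (t.substAll (update Term.var x s)).substAll w = t.substAll (update w x (s.substAll w)) := by
  induction t with
  | var y =>
    simp only [Term.substAll]
    by_cases hx : y = x
    · subst hx; simp
    · simp [hx, Term.substAll]
  | _ => simp_all [Term.substAll]

theorem Formula.substAll_subst {x : ℕ} {s : Term} (hs : s.fv ⊆ {x}) :
    ∀ {φ : Formula} {w : ℕ → Term},
    (φ.subst x s).substAll w = φ.substAll (update w x (s.substAll w)) := by
  intro φ
  simp only [Formula.subst]
  induction φ with
  | all z a ih | ex z a ih =>
    intro w
    simp only [Formula.substAll]
    congr 1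
    by_cases hz : z = x
    · subst hz
      rw [update_idem, update_idem, update_eq_self, Formula.substAll_var]
    · rw [update_comm (Ne.symm hz), update_eq_self, ih, update_comm (Ne.symm hz)]
      congr 2
      apply Term.substAll_congr
      intro i hi
      have : i = x := by simpa using hs hi
      subst this
      simp [Ne.symm hz]
  | _ => intros; simp_all [Formula.substAll, Term.substAll_subst]

theorem Term.fresh_back {x y : ℕ} {t : Term} (hy : y ∉ t.fv) :
    (t.substAll (update Term.var x (.var y))).substAll (update Term.var y (.var x)) = t := by
  induction t with
  | var z =>
    have : z ≠ y := by rintro rfl; simp [Term.fv] at hy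
    by_cases hz : z = x
    · subst hz; simp [Term.substAll]
    · simp [Term.substAll, hz, this]
  | _ => simp_all [Term.substAll, Term.fv]

theorem Formula.fresh_back {x y : ℕ} (hxy : x ≠ y) : ∀ {φ : Formula}, φ.Low y →
    (φ.subst x (.var y)).subst y (.var x) = φ := by
  intro φ
  have key : ∀ {φ : Formula}, φ.Low y → y ∉ φ.fv := fun h hy => lt_irrefl _ (h.fv _ hy)
  simp only [Formula.subst]
  induction φ with
  | all z a ih | ex z a ih =>
    intro h
    have hzy : z ≠ y := h.1.ne
    simp only [Formula.substAll]
    congr 1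
    by_cases hz : z = x
    · subst hz
      rw [update_idem, update_eq_self, Formula.substAll_var, update_comm hxy.symm,
        update_eq_self]
      exact Formula.subst_of_not_fv (key h.2)
    · rw [update_comm (Ne.symm hz), update_eq_self, update_comm hzy.symm, update_eq_self, ih h.2]
  | eq t u | le t u =>
    intro h
    simp only [Formula.substAll]
    rw [Term.fresh_back fun hy => lt_irrefl _ (h.1 _ hy),
      Term.fresh_back fun hy => lt_irrefl _ (h.2 _ hy)]
  | _ => intros; simp_all [Formula.substAll, Formula.Low]

theorem Term.fv_subst {x : ℕ} {s t : Term} :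
    ∀ z ∈ (t.substAll (update Term.var x s)).fv, z ∈ s.fv ∨ (z ∈ t.fv ∧ z ≠ x) := by
  induction t with
  | var y =>
    by_cases hy : y = x
    · subst hy; simp [Term.substAll]; tauto
    · simp [Term.substAll, hy, Term.fv]
  | _ => simp only [Term.substAll, Term.fv] at * ; grind

theorem Formula.fv_subst {x : ℕ} {s : Term} : ∀ {φ : Formula},
    ∀ z ∈ (φ.subst x s).fv, z ∈ s.fv ∨ (z ∈ φ.fv ∧ z ≠ x) := by
  intro φ
  simp only [Formula.subst]
  induction φ with
  | all y a ih | ex y a ih =>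
    intro z hz
    simp only [Formula.substAll, Formula.fv, Finset.mem_erase] at hz
    by_cases hy : y = x
    · subst hy
      rw [update_idem, update_eq_self, Formula.substAll_var] at hz
      simp only [Formula.fv]; grind
    · rw [update_comm (Ne.symm hy), update_eq_self] at hz
      have := ih z hz.2
      simp only [Formula.fv]; grind
  | eq t u | le t u =>
    simp only [Formula.substAll, Formula.fv]
    have := @Term.fv_subst x s t
    have := @Term.fv_subst x s u
    grind
  | _ => simp only [Formula.substAll, Formula.fv] at *; grind

theorem Formula.fresh_freeFor {x y : ℕ} (hxy : x ≠ y) : ∀ {φ : Formula}, φ.Low y →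
    (φ.subst x (.var y)).freeFor (.var x) y := by
  intro φ
  have key : ∀ {φ : Formula}, φ.Low y → y ∉ φ.fv := fun h hy => lt_irrefl _ (h.fv _ hy)
  simp only [Formula.subst]
  induction φ with
  | all z a ih | ex z a ih =>
    intro h
    simp only [Formula.substAll, Formula.freeFor]
    by_cases hz : z = x
    · subst hz
      rw [update_idem, update_eq_self, Formula.substAll_var]
      exact Or.inr (Or.inl (key h.2))
    · rw [update_comm (Ne.symm hz), update_eq_self]
      exact Or.inr (Or.inr ⟨by simpa [Term.fv] using hz, ih h.2⟩)
  | _ => intros; simp_all [Formula.substAll, Formula.freeFor, Formula.Low]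

end ModalArith

namespace ModalArith
open Function

/-! ### Part 2: Henkin sets -/

theorem Term.code_inj : ∀ {t u : Term}, t.code = u.code → t = u := by
  intro t
  induction t <;> intro u h <;> cases u <;> simp_all [Term.code, Nat.pair_eq_pair] <;> grind

theorem Formula.code_inj : ∀ {φ ψ : Formula}, φ.code = ψ.code → φ = ψ := by
  intro φ
  induction φ <;> intro ψ h <;> cases ψ <;> simp_all [Formula.code, Nat.pair_eq_pair] <;>
    grind [Term.code_inj]

variable {T : Set Formula}

theorem Provable.thm {γ φ : Formula} (h : Provable T φ) : Provable T (γ.imp φ) :=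
  .mp (.logic (.imp1 _ _)) h

theorem Provable.dmp {γ φ ψ : Formula} (h : Provable T (γ.imp (φ.imp ψ)))
    (h' : Provable T (γ.imp φ)) : Provable T (γ.imp ψ) :=
  .mp (.mp (.logic (.imp2 _ _ _)) h) h'

theorem Provable.id (φ : Formula) : Provable T (φ.imp φ) :=
  Provable.dmp (φ := φ.imp φ) (.logic (.imp1 _ _)) (.logic (.imp1 _ _))

theorem Provable.syl {φ ψ χ : Formula} (h : Provable T (φ.imp ψ)) (h' : Provable T (ψ.imp χ)) :
    Provable T (φ.imp χ) := Provable.dmp (Provable.thm h') h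

theorem Provable.curry {φ ψ χ : Formula} (h : Provable T ((φ.and ψ).imp χ)) :
    Provable T (φ.imp (ψ.imp χ)) :=
  Provable.syl (.logic (.andI φ ψ)) (.mp (.logic (.imp2 _ _ _)) (Provable.thm h))

theorem Provable.uncurry {φ ψ χ : Formula} (h : Provable T (φ.imp (ψ.imp χ))) :
    Provable T ((φ.and ψ).imp χ) :=
  Provable.dmp (Provable.syl (.logic (.andE1 _ _)) h) (.logic (.andE2 _ _))

theorem Provable.swap {φ ψ χ : Formula} (h : Provable T (φ.imp (ψ.imp χ))) :
    Provable T (ψ.imp (φ.imp χ)) :=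
  Provable.curry (Provable.dmp (Provable.syl (.logic (.andE2 _ _)) h) (.logic (.andE1 _ _)))

theorem Provable.contr {φ χ : Formula} (h : Provable T (φ.imp (φ.imp χ))) :
    Provable T (φ.imp χ) := Provable.dmp h (Provable.id _)

theorem Provable.pair {γ φ ψ : Formula} (h : Provable T (γ.imp φ)) (h' : Provable T (γ.imp ψ)) :
    Provable T (γ.imp (φ.and ψ)) :=
  Provable.dmp (Provable.syl h (.logic (.andI _ _))) h'

theorem Provable.inst {x : ℕ} {φ : Formula} (h : Provable T (.all x φ)) : Provable T φ := by
  have := Provable.mp (.logic (.allE x (.var x) φ (Formula.freeFor_self x))) h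
  rwa [Formula.subst_self] at this

/-- A formula with a fresh variable witnessing an existential can be added consistently. -/
theorem Provable.fresh {γ ψ : Formula} {x y : ℕ} (hxy : x < y) (hγ : γ.Low y) (hψ : ψ.Low y)
    (h1 : Provable T (γ.imp (.ex x ψ)))
    (h : Provable T ((γ.and (ψ.subst x (.var y))).imp .falsum)) :
    Provable T (γ.imp .falsum) := by
  have h2 := Provable.swap (Provable.curry h)
  have hy : y ∉ (γ.imp .falsum).fv := by
    simp only [Formula.fv, Finset.union_empty]
    exact fun hy => lt_irrefl _ (hγ.fv _ hy)
  have h3 := Provable.mp (.logic (.exE y _ _ hy)) (Provable.gen y h2)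
  have h4 : Provable T ((Formula.ex x ψ).imp (.ex y (ψ.subst x (.var y)))) := by
    have h5 := Provable.logic (T := T) (.exI y (.var x) (ψ.subst x (.var y))
      (Formula.fresh_freeFor hxy.ne hψ))
    rw [Formula.fresh_back hxy.ne hψ] at h5
    refine .mp (.logic (.exE x _ _ ?_)) (Provable.gen x h5)
    simp only [Formula.fv, Finset.mem_erase, not_and]
    intro _ hx
    have := Formula.fv_subst _ hx
    simp [Term.fv] at this
    omega
  exact Provable.contr (Provable.syl h1 (Provable.syl h4 h3))

/-- Henkin sets of formulas over `T`, with witnessing variables `≥ N`. -/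
structure Hen (T : Set Formula) (N : ℕ) (Δ : Set Formula) : Prop where
  thm : ∀ φ, Provable T φ → φ ∈ Δ
  mp : ∀ φ ψ, φ.imp ψ ∈ Δ → φ ∈ Δ → ψ ∈ Δ
  cons : Formula.falsum ∉ Δ
  max : ∀ φ, φ ∈ Δ ∨ φ.neg ∈ Δ
  wit : ∀ x ψ, Formula.ex x ψ ∈ Δ → ∃ y, N ≤ y ∧ ψ.subst x (.var y) ∈ Δ

theorem exists_step (N : ℕ) (γ φ : Formula) (hγ : ¬ Provable T (γ.imp .falsum)) :
    ∃ γ' : Formula, ¬ Provable T (γ'.imp .falsum) ∧ Provable T (γ'.imp γ) ∧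
      (Provable T (γ'.imp φ.neg) ∨ (Provable T (γ'.imp φ) ∧
        ∀ x ψ, φ = .ex x ψ → ∃ y, N ≤ y ∧ Provable T (γ'.imp (ψ.subst x (.var y))))) := by
  by_cases h : Provable T ((γ.and φ).imp .falsum)
  · exact ⟨γ, hγ, .id _, Or.inl ((Provable.curry h).syl (.logic (.negIntro _)))⟩
  · by_cases hφ : ∃ x ψ, φ = .ex x ψ
    · obtain ⟨x, ψ, rfl⟩ := hφ
      obtain ⟨M, hM⟩ := (γ.and (.ex x ψ)).exists_low
      have hM' := hM.mono (le_max_left M N)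
      refine ⟨(γ.and (.ex x ψ)).and (ψ.subst x (.var (Max.max M N))), fun h' => h ?_, ?_, Or.inr ⟨?_, ?_⟩⟩
      · exact Provable.fresh hM'.2.1 hM' hM'.2.2 (.logic (.andE2 _ _)) h'
      · exact Provable.syl (.logic (.andE1 _ _)) (.logic (.andE1 _ _))
      · exact Provable.syl (.logic (.andE1 _ _)) (.logic (.andE2 _ _))
      · intro x' ψ' he
        cases he
        exact ⟨_, le_max_right _ _, .logic (.andE2 _ _)⟩
    · refine ⟨γ.and φ, h, .logic (.andE1 _ _), Or.inr ⟨.logic (.andE2 _ _), ?_⟩⟩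
      intro x ψ he
      exact absurd ⟨x, ψ, he⟩ hφ

theorem exists_hen (N : ℕ) {χ : Formula} (hχ : ¬ Provable T χ) :
    ∃ Δ, Hen T N Δ ∧ χ ∉ Δ := by
  have hc : Countable Formula := ⟨Formula.code, fun _ _ h => Formula.code_inj h⟩
  have : Nonempty Formula := ⟨.falsum⟩
  obtain ⟨e, he⟩ := exists_surjective_nat Formula
  have h0 : ¬ Provable T (χ.neg.imp .falsum) := fun h =>
    hχ (.mp (.logic (.dne _)) (.mp (.logic (.negIntro _)) h))
  let C := {γ : Formula // ¬ Provable T (γ.imp .falsum)}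
  choose f hf1 hf2 hf3 using fun (γ : C) φ => exists_step N γ.1 φ γ.2
  let g : ℕ → C := fun n => Nat.rec ⟨χ.neg, h0⟩ (fun n γ => ⟨f γ (e n), hf1 _ _⟩) n
  have hstep : ∀ n, Provable T ((g (n + 1)).1.imp (g n).1) := fun n => hf2 (g n) (e n)
  have hmono : ∀ m n, m ≤ n → Provable T ((g n).1.imp (g m).1) := by
    intro m n h
    induction n, h using Nat.le_induction with
    | base => exact .id _
    | succ n _ ih => exact (hstep n).syl ih
  have h3 : ∀ φ, ∃ n, Provable T ((g n).1.imp φ.neg) ∨ (Provable T ((g n).1.imp φ) ∧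
        ∀ x ψ, φ = .ex x ψ → ∃ y, N ≤ y ∧ Provable T ((g n).1.imp (ψ.subst x (.var y)))) := by
    intro φ
    obtain ⟨n, rfl⟩ := he φ
    exact ⟨n + 1, hf3 (g n) (e n)⟩
  have mp' : ∀ φ ψ, (∃ n, Provable T ((g n).1.imp (φ.imp ψ))) →
      (∃ n, Provable T ((g n).1.imp φ)) → ∃ n, Provable T ((g n).1.imp ψ) := by
    rintro φ ψ ⟨m, hm⟩ ⟨n, hn⟩
    exact ⟨max m n, Provable.dmp ((hmono _ _ (le_max_left m n)).syl hm)
      ((hmono _ _ (le_max_right m n)).syl hn)⟩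
  have cons' : ¬ ∃ n, Provable T ((g n).1.imp .falsum) := fun ⟨n, h⟩ => (g n).2 h
  have hneg : ∀ φ, (∃ n, Provable T ((g n).1.imp φ)) → (∃ n, Provable T ((g n).1.imp φ.neg)) →
      False := fun φ h h' =>
    cons' (mp' _ _ (mp' _ _ ⟨0, Provable.thm (.logic (.negElimFalsum φ))⟩ h') h)
  refine ⟨{φ | ∃ n, Provable T ((g n).1.imp φ)}, ⟨fun φ h => ⟨0, h.thm⟩, mp', cons', ?_, ?_⟩, ?_⟩
  · intro φ
    obtain ⟨n, h | h⟩ := h3 φ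
    · exact Or.inr ⟨n, h⟩
    · exact Or.inl ⟨n, h.1⟩
  · intro x ψ h
    obtain ⟨n, h' | h'⟩ := h3 (.ex x ψ)
    · exact absurd ⟨n, h'⟩ (hneg _ h)
    · obtain ⟨y, hy, h''⟩ := h'.2 x ψ rfl
      exact ⟨y, hy, n, h''⟩
  · intro h
    exact hneg _ h ⟨0, .id _⟩

theorem provable_of_hen (N : ℕ) {χ : Formula} (h : ∀ Δ, Hen T N Δ → χ ∈ Δ) : Provable T χ := by
  by_contra hχ
  obtain ⟨Δ, h1, h2⟩ := exists_hen N hχ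
  exact h2 (h Δ h1)

namespace Hen

variable {N : ℕ} {Δ : Set Formula}

theorem lmp (H : Hen T N Δ) {φ ψ : Formula} (h : LogicalAxiom (φ.imp ψ)) (h' : φ ∈ Δ) : ψ ∈ Δ :=
  H.mp _ _ (H.thm _ (.logic h)) h'

theorem mem_neg (H : Hen T N Δ) {φ : Formula} : φ.neg ∈ Δ ↔ φ ∉ Δ := by
  constructor
  · intro h h'
    exact H.cons (H.mp _ _ (H.lmp (.negElimFalsum φ) h) h')
  · intro h
    exact (H.max φ).resolve_left h

theorem mem_imp (H : Hen T N Δ) {φ ψ : Formula} : φ.imp ψ ∈ Δ ↔ (φ ∈ Δ → ψ ∈ Δ) := by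
  constructor
  · exact H.mp _ _
  · intro h
    by_cases hφ : φ ∈ Δ
    · exact H.lmp (.imp1 _ _) (h hφ)
    · exact H.lmp (.negE _ _) (H.mem_neg.2 hφ)

theorem mem_and (H : Hen T N Δ) {φ ψ : Formula} : φ.and ψ ∈ Δ ↔ (φ ∈ Δ ∧ ψ ∈ Δ) :=
  ⟨fun h => ⟨H.lmp (.andE1 _ _) h, H.lmp (.andE2 _ _) h⟩,
    fun h => H.mp _ _ (H.lmp (.andI _ _) h.1) h.2⟩

theorem mem_or (H : Hen T N Δ) {φ ψ : Formula} : φ.or ψ ∈ Δ ↔ (φ ∈ Δ ∨ ψ ∈ Δ) := by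
  constructor
  · intro h
    by_contra hc
    push Not at hc
    have h1 := H.lmp (.orE φ ψ .falsum) (H.mem_imp.2 fun h => absurd h hc.1)
    exact H.cons (H.mp _ _ (H.mp _ _ h1 (H.mem_imp.2 fun h => absurd h hc.2)) h)
  · rintro (h | h)
    · exact H.lmp (.orI1 _ _) h
    · exact H.lmp (.orI2 _ _) h

theorem mem_ex (H : Hen T N Δ) {x : ℕ} {φ : Formula} (hφ : φ.BLow N) :
    Formula.ex x φ ∈ Δ ↔ ∃ t : Term, t.High N ∧ φ.subst x t ∈ Δ := by
  constructor
  · intro h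
    obtain ⟨y, hy, h⟩ := H.wit _ _ h
    exact ⟨.var y, by simpa [Term.High, Term.fv] using hy, h⟩
  · rintro ⟨t, ht, h⟩
    exact H.lmp (.exI x t φ (Formula.freeFor_high ht hφ)) h

theorem mem_all (H : Hen T N Δ) {x : ℕ} {φ : Formula} (hφ : φ.BLow N) :
    Formula.all x φ ∈ Δ ↔ ∀ t : Term, t.High N → φ.subst x t ∈ Δ := by
  constructor
  · intro h t ht
    exact H.lmp (.allE x t φ (Formula.freeFor_high ht hφ)) h
  · intro h
    by_contra hc
    have h1 : Provable T ((Formula.ex x φ.neg).neg.imp (.all x φ)) := by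
      refine .mp (.logic (.allImp x _ _ (by simp [Formula.fv]))) (.gen x ?_)
      have h2 : Provable T (φ.neg.imp (.ex x φ.neg)) := by
        have := Provable.logic (T := T) (.exI x (.var x) φ.neg (Formula.freeFor_self x))
        rwa [Formula.subst_self] at this
      refine provable_of_hen N fun Δ' H' => ?_
      have := H'.thm _ h2
      simp only [H'.mem_imp, H'.mem_neg] at this ⊢
      tauto
    have h2 : Formula.ex x φ.neg ∈ Δ := by
      by_contra h3
      exact hc (H.mp _ _ (H.thm _ h1) (H.mem_neg.2 h3))
    obtain ⟨t, ht, h3⟩ := (H.mem_ex (by simpa [Formula.BLow] using hφ)).1 h2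
    exact H.mem_neg.1 h3 (h t ht)

end Hen

/-- Simultaneous instantiation of a theorem by parameter terms. -/
theorem Provable.instAll {N : ℕ} {φ : Formula} (hφ : φ.Low N) (h : Provable T φ)
    {w : ℕ → Term} (hw : ∀ i, (w i).High N) : Provable T (φ.substAll w) := by
  have key : ∀ k ≤ N, Provable T (φ.substAll fun i => if i < k then w i else .var i) := by
    intro k
    induction k with
    | zero => intro _; simpa [Formula.substAll_var] using h
    | succ k ih =>
      intro hk
      have h1 := Provable.mp (.logic (.allE k (w k) _
        (Formula.freeFor_high (hw k) hφ.blow.substAll))) (Provable.gen k (ih (by omega)))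
      rw [Formula.subst_substAll] at h1
      · convert h1 using 2
        funext i
        by_cases hi : i = k
        · subst hi; simp
        · have : i < k + 1 ↔ i < k := by omega
          simp [hi, this]
      · simp
      · intro i hi
        split
        · intro hk'
          have := hw i _ hk'
          omega
        · simpa [Term.fv] using Ne.symm hi
  have := key N le_rfl
  rwa [Formula.substAll_congr (g := w)] at this
  intro i hi
  simp [hφ.fv i hi]

end ModalArith

namespace ModalArith
open Function

/-! ### Part 3: the Henkin model -/

theorem Term.Low.substAll {N : ℕ} {t : Term} {f : ℕ → Term} (hf : ∀ i < N, (f i).Low N)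
    (ht : t.Low N) : (t.substAll f).Low N := by
  induction t with
  | var x => exact hf x (ht x (by simp [Term.fv]))
  | zero => simp [Term.Low, Term.substAll, Term.fv]
  | succ t ih => exact ih ht
  | add t u ih1 ih2 | mul t u ih1 ih2 =>
    intro x hx
    simp only [Term.substAll, Term.fv, Finset.mem_union] at hx
    exact hx.elim (ih1 (fun y hy => ht y (by simp [Term.fv, hy])) x)
      (ih2 (fun y hy => ht y (by simp [Term.fv, hy])) x)

theorem Formula.Low.substAll {N : ℕ} : ∀ {φ : Formula} {f : ℕ → Term},
    (∀ i < N, (f i).Low N) → φ.Low N → (φ.substAll f).Low N := by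
  intro φ
  induction φ with
  | falsum => intros; trivial
  | eq t u | le t u => intro f hf h; exact ⟨h.1.substAll hf, h.2.substAll hf⟩
  | and φ ψ ih1 ih2 | or φ ψ ih1 ih2 | imp φ ψ ih1 ih2 =>
    intro f hf h; exact ⟨ih1 hf h.1, ih2 hf h.2⟩
  | neg φ ih | box φ ih => intro f hf h; exact ih hf h
  | all x φ ih | ex x φ ih =>
    intro f hf h
    refine ⟨h.1, ih ?_ h.2⟩
    intro i hi
    by_cases hix : i = x
    · subst hix; simpa [Term.Low, Term.fv] using hi
    · simpa [hix] using hf i hi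

theorem Formula.Low.subst {N x : ℕ} {s : Term} {φ : Formula} (hs : s.Low N) (h : φ.Low N) :
    (φ.subst x s).Low N := by
  refine Formula.Low.substAll ?_ h
  intro i hi
  by_cases hix : i = x
  · subst hix; simpa using hs
  · simpa [hix, Term.Low, Term.fv] using hi

theorem Term.High.substAll {N : ℕ} {t : Term} {f : ℕ → Term} (hf : ∀ i, (f i).High N) :
    (t.substAll f).High N := by
  induction t with
  | var x => exact hf x
  | zero => simp [Term.High, Term.substAll, Term.fv]
  | succ t ih => exact ih
  | add t u ih1 ih2 | mul t u ih1 ih2 =>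
    intro x hx
    simp only [Term.substAll, Term.fv, Finset.mem_union] at hx
    exact hx.elim (ih1 x) (ih2 x)

variable {T : Set Formula}

theorem Provable.ind (hT : Extends T PAK) {x : ℕ} {φ : Formula}
    (h0 : Provable T (φ.subst x .zero))
    (h1 : Provable T (φ.imp (φ.subst x (.succ (.var x))))) : Provable T φ := by
  have h : Provable T (inductionAx x φ) := hT _ (Or.inl (Or.inr ⟨x, φ, rfl⟩))
  exact (h.mp (.mp (.mp (.logic (.andI _ _)) h0) (.gen x h1))).inst

theorem Provable.base (hT : Extends T PAK) {φ : Formula} (h : φ ∈ baseAxioms) : Provable T φ :=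
  hT _ (Or.inl (Or.inl h))

theorem Provable.boxK (hT : Extends T PAK) {φ ψ : Formula} :
    Provable T ((Formula.box (φ.imp ψ)).imp ((Formula.box φ).imp (Formula.box ψ))) :=
  hT _ (Or.inr ⟨φ, ψ, rfl⟩)

theorem Provable.boxMono (hT : Extends T PAK) {φ ψ : Formula} (h : Provable T (φ.imp ψ)) :
    Provable T ((Formula.box φ).imp (Formula.box ψ)) := (Provable.boxK hT).mp h.nec

/-- Identity is rigid. -/
theorem rigid0 (hT : Extends T PAK) :
    Provable T ((Formula.eq (.var 0) (.var 1)).imp (.box (.eq (.var 0) (.var 1)))) := by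
  have hs0 : Provable T ((Formula.eq (.succ (.var 0)) .zero).neg) :=
    Provable.base hT (by simp [baseAxioms, succNeZero])
  have hinj : Provable T ((Formula.eq (.succ (.var 0)) (.succ (.var 1))).imp
    (.eq (.var 0) (.var 1))) := Provable.base hT (by simp [baseAxioms, succInj])
  have hs1 : Provable T ((Formula.eq (.succ (.var 1)) .zero).neg) := by
    have := Provable.mp (.logic (.allE 0 (.var 1) _ (by simp [Formula.freeFor]))) (hs0.gen 0)
    simpa [Formula.subst, Formula.substAll, Term.substAll] using this
  let χ : Formula := .all 1 ((Formula.eq (.var 0) (.var 1)).imp (.box (.eq (.var 0) (.var 1))))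
  have key : Provable T χ := by
    refine Provable.ind hT (x := 0) ?_ ?_
    · have : Provable T ((Formula.eq .zero (.var 1)).imp (.box (.eq .zero (.var 1)))) := by
        refine Provable.ind hT (x := 1) ?_ ?_
        · simp only [Formula.subst, Formula.substAll, Term.substAll, update_self]
          exact Provable.thm (.nec (.logic (.eqRefl _)))
        · simp only [Formula.subst, Formula.substAll, Term.substAll, update_self]
          refine Provable.thm ?_
          exact Provable.syl (.logic (.eqSymm _ _)) (.mp (.logic (.negE _ _)) hs1)
      simpa [χ, Formula.subst, Formula.substAll, Term.substAll] using this.gen 1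
    · have h2 : Provable T (χ.imp ((Formula.eq (.succ (.var 0)) (.var 1)).imp
          (.box (.eq (.succ (.var 0)) (.var 1))))) := by
        refine Provable.ind hT (x := 1) ?_ ?_
        · simp only [Formula.subst, Formula.substAll, Term.substAll, update_self, ne_eq,
            zero_ne_one, not_false_eq_true, update_of_ne]
          exact Provable.thm (.mp (.logic (.negE _ _)) hs0)
        · refine Provable.thm ?_
          have h3 : Provable T (χ.imp _) :=
            .logic (.allE 1 (.var 1) _ (Formula.freeFor_self 1))
          rw [Formula.subst_self] at h3
          have h4 : Provable T ((Formula.box (.eq (.var 0) (.var 1))).imp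
            (.box (.eq (.succ (.var 0)) (.succ (.var 1))))) :=
            Provable.boxMono hT (.logic (.eqSucc _ _))
          have h5 := (h3.swap.syl (.mp (.logic (.imp2 _ _ _)) h4.thm))
          have h6 := (hinj.syl h5).swap
          simpa [χ, Formula.subst, Formula.substAll, Term.substAll] using h6
      have h7 := Provable.mp (.logic (.allImp 1 χ _ (by simp [χ, Formula.fv, Term.fv])))
        (h2.gen 1)
      simpa [χ, Formula.subst, Formula.substAll, Term.substAll] using h7
  exact key.inst

theorem rigid (hT : Extends T PAK) {N : ℕ} (hN : 2 ≤ N) {t u : Term} (ht : t.High N)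
    (hu : u.High N) : Provable T ((Formula.eq t u).imp (.box (.eq t u))) := by
  have h := Provable.instAll (N := N) (φ := (Formula.eq (.var 0) (.var 1)).imp
    (.box (.eq (.var 0) (.var 1))))
    (by simp [Formula.Low, Term.Low, Term.fv]; omega) (rigid0 hT)
    (w := fun i => if i = 0 then t else u) (by intro i; split <;> assumption)
  simpa [Formula.substAll, Term.substAll] using h

/-- `w 0 = w' 0 → ... → w (k-1) = w' (k-1) → χ`. -/
def eqChain (w w' : ℕ → Term) (χ : Formula) : ℕ → Formula
  | 0 => χ
  | k + 1 => (Formula.eq (w k) (w' k)).imp (eqChain w w' χ k)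

theorem Hen.mem_eqChain {N : ℕ} {Δ : Set Formula} (H : Hen T N Δ) {w w' : ℕ → Term} {χ : Formula}
    {k : ℕ} : eqChain w w' χ k ∈ Δ ↔ ((∀ i < k, Formula.eq (w i) (w' i) ∈ Δ) → χ ∈ Δ) := by
  induction k with
  | zero => simp [eqChain]
  | succ k ih => simp only [eqChain, H.mem_imp, ih, Nat.forall_lt_succ_right]; tauto

theorem Hen.box_mp (hT : Extends T PAK) {N : ℕ} {Δ : Set Formula} (H : Hen T N Δ) {φ ψ : Formula}
    (h : Formula.box (φ.imp ψ) ∈ Δ) (h' : Formula.box φ ∈ Δ) : Formula.box ψ ∈ Δ :=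
  H.mp _ _ (H.mp _ _ (H.thm _ (Provable.boxK hT)) h) h'

theorem Hen.box_eqChain (hT : Extends T PAK) {N : ℕ} {Δ : Set Formula} (H : Hen T N Δ)
    {w w' : ℕ → Term} {χ : Formula} {k : ℕ} (h : .box (eqChain w w' χ k) ∈ Δ)
    (h' : ∀ i < k, Formula.box (.eq (w i) (w' i)) ∈ Δ) : .box χ ∈ Δ := by
  induction k with
  | zero => exact h
  | succ k ih =>
    exact ih (H.box_mp hT h (h' k (by omega))) fun i hi => h' i (by omega)

theorem Hen.eq_symm {N : ℕ} {Δ : Set Formula} (H : Hen T N Δ) {t u : Term}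
    (h : Formula.eq t u ∈ Δ) : Formula.eq u t ∈ Δ := H.lmp (.eqSymm _ _) h

theorem Hen.eq_trans {N : ℕ} {Δ : Set Formula} (H : Hen T N Δ) {t u s : Term}
    (h : Formula.eq t u ∈ Δ) (h' : Formula.eq u s ∈ Δ) : Formula.eq t s ∈ Δ :=
  H.mp _ _ (H.lmp (.eqTrans _ _ _) h) h'

theorem Hen.eq_refl {N : ℕ} {Δ : Set Formula} (H : Hen T N Δ) (t : Term) : Formula.eq t t ∈ Δ :=
  H.thm _ (.logic (.eqRefl t))

theorem Hen.term_inv {N : ℕ} {Δ : Set Formula} (H : Hen T N Δ) {w w' : ℕ → Term}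
    (h : ∀ i, Formula.eq (w i) (w' i) ∈ Δ) (t : Term) :
    Formula.eq (t.substAll w) (t.substAll w') ∈ Δ := by
  induction t with
  | var x => exact h x
  | zero => exact H.eq_refl _
  | succ t ih => exact H.lmp (.eqSucc _ _) ih
  | add t u ih1 ih2 => exact H.mp _ _ (H.lmp (.eqAdd _ _ _ _) ih1) ih2
  | mul t u ih1 ih2 => exact H.mp _ _ (H.lmp (.eqMul _ _ _ _) ih1) ih2

theorem substAll_update_high {N x : ℕ} (hx : x < N) {φ : Formula} {w : ℕ → Term}
    (hw : ∀ i, (w i).High N) (t : Term) :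
    (φ.substAll (update w x (.var x))).subst x t = φ.substAll (update w x t) := by
  rw [Formula.subst_substAll (by simp), update_idem]
  intro i hi h
  rw [update_of_ne hi] at h
  have := hw i x h
  omega

theorem high_update {N : ℕ} {w : ℕ → Term} (hw : ∀ i, (w i).High N) (x : ℕ) {t : Term}
    (ht : t.High N) : ∀ i, (update w x t i).High N := by
  intro i
  by_cases hi : i = x
  · subst hi; simpa using ht
  · simpa [hi] using hw i

/-- Membership in Henkin sets is invariant under provably equal parameters. -/
theorem Hen.inv (hT : Extends T PAK) {N : ℕ} (hN : 2 ≤ N) : ∀ {φ : Formula}, φ.Low N →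
    ∀ {Δ : Set Formula}, Hen T N Δ → ∀ {w w' : ℕ → Term}, (∀ i, (w i).High N) →
    (∀ i, (w' i).High N) → (∀ i, Formula.eq (w i) (w' i) ∈ Δ) →
    φ.substAll w ∈ Δ → φ.substAll w' ∈ Δ := by
  intro φ
  induction φ with
  | falsum => intro _ _ _ _ _ _ _ _ h; exact h
  | eq t u =>
    intro _ Δ H w w' _ _ h hm
    exact H.eq_trans (H.eq_trans (H.eq_symm (H.term_inv h t)) hm) (H.term_inv h u)
  | le t u =>
    intro _ Δ H w w' _ _ h hm
    exact H.mp _ _ (H.mp _ _ (H.lmp (.eqLe _ _ _ _) (H.term_inv h t)) (H.term_inv h u)) hm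
  | and φ ψ ih1 ih2 =>
    intro hl Δ H w w' hw hw' h
    simp only [Formula.substAll, H.mem_and]
    exact And.imp (ih1 hl.1 H hw hw' h) (ih2 hl.2 H hw hw' h)
  | or φ ψ ih1 ih2 =>
    intro hl Δ H w w' hw hw' h
    simp only [Formula.substAll, H.mem_or]
    exact Or.imp (ih1 hl.1 H hw hw' h) (ih2 hl.2 H hw hw' h)
  | imp φ ψ ih1 ih2 =>
    intro hl Δ H w w' hw hw' h
    simp only [Formula.substAll, H.mem_imp]
    exact fun h1 h2 => ih2 hl.2 H hw hw' h
      (h1 (ih1 hl.1 H hw' hw (fun i => H.eq_symm (h i)) h2))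
  | neg φ ih =>
    intro hl Δ H w w' hw hw' h
    simp only [Formula.substAll, H.mem_neg]
    exact fun h1 h2 => h1 (ih hl H hw' hw (fun i => H.eq_symm (h i)) h2)
  | all x φ ih =>
    intro hl Δ H w w' hw hw' h
    simp only [Formula.substAll, H.mem_all hl.2.blow.substAll, substAll_update_high hl.1 hw,
      substAll_update_high hl.1 hw']
    intro h1 t ht
    refine ih hl.2 H (high_update hw x ht) (high_update hw' x ht) ?_ (h1 t ht)
    intro i
    by_cases hi : i = x
    · subst hi; simpa using H.eq_refl t
    · simpa [hi] using h i
  | ex x φ ih =>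
    intro hl Δ H w w' hw hw' h
    simp only [Formula.substAll, H.mem_ex hl.2.blow.substAll, substAll_update_high hl.1 hw,
      substAll_update_high hl.1 hw']
    rintro ⟨t, ht, h1⟩
    refine ⟨t, ht, ih hl.2 H (high_update hw x ht) (high_update hw' x ht) ?_ h1⟩
    intro i
    by_cases hi : i = x
    · subst hi; simpa using H.eq_refl t
    · simpa [hi] using h i
  | box φ ih =>
    intro hl Δ H w w' hw hw' h hm
    have hw2 : φ.substAll w' = φ.substAll (fun i => if i < N then w' i else w i) :=
      Formula.substAll_congr fun i hi => by simp [Formula.Low.fv hl i hi]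
    simp only [Formula.substAll] at hm ⊢
    rw [hw2]
    have hP : Provable T (eqChain w w' ((φ.substAll w).imp
        (φ.substAll (fun i => if i < N then w' i else w i))) N) := by
      refine provable_of_hen N fun Δ' H' => ?_
      rw [H'.mem_eqChain, H'.mem_imp]
      intro h1
      refine ih hl H' hw ?_ ?_
      · intro i; split
        · exact hw' i
        · exact hw i
      · intro i; split
        · exact h1 i ‹_›
        · exact H'.eq_refl _
    exact H.box_mp hT (H.box_eqChain hT (H.thm _ hP.nec) fun i _ =>
      H.mp _ _ (H.thm _ (rigid hT hN (hw i) (hw' i))) (h i)) hm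

/-- Structures for modal arithmetic, with an abstract interpretation of boxed formulas. -/
structure Str where
  M : Type
  zero : M
  succ : M → M
  add : M → M → M
  mul : M → M → M
  le : M → M → Prop
  box : Formula → (ℕ → M) → Prop

/-- Value of a term. -/
def Str.tval (S : Str) : Term → (ℕ → S.M) → S.M
  | .var x, v => v x
  | .zero, _ => S.zero
  | .succ t, v => S.succ (S.tval t v)
  | .add t u, v => S.add (S.tval t v) (S.tval u v)
  | .mul t u, v => S.mul (S.tval t v) (S.tval u v)

/-- Satisfaction. -/
def Str.Sat (S : Str) : Formula → (ℕ → S.M) → Prop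
  | .falsum, _ => False
  | .eq t u, v => S.tval t v = S.tval u v
  | .le t u, v => S.le (S.tval t v) (S.tval u v)
  | .and φ ψ, v => S.Sat φ v ∧ S.Sat ψ v
  | .or φ ψ, v => S.Sat φ v ∨ S.Sat ψ v
  | .imp φ ψ, v => S.Sat φ v → S.Sat ψ v
  | .neg φ, v => ¬ S.Sat φ v
  | .all x φ, v => ∀ m : S.M, S.Sat φ (update v x m)
  | .ex x φ, v => ∃ m : S.M, S.Sat φ (update v x m)
  | .box φ, v => S.box φ v

/-- Models of arithmetic with induction for formulas with variables below `N`. -/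
structure IsPA (N : ℕ) (S : Str) : Prop where
  succ_ne : ∀ a, S.succ a ≠ S.zero
  succ_inj : ∀ a b, S.succ a = S.succ b → a = b
  add_zero : ∀ a, S.add a S.zero = a
  add_succ : ∀ a b, S.add a (S.succ b) = S.succ (S.add a b)
  mul_zero : ∀ a, S.mul a S.zero = S.zero
  mul_succ : ∀ a b, S.mul a (S.succ b) = S.add (S.mul a b) a
  le_iff : ∀ a b, S.le a b ↔ ∃ c, S.add a c = b
  ind : ∀ φ : Formula, φ.Low N → ∀ x < N, ∀ v : ℕ → S.M, S.Sat φ (update v x S.zero) →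
    (∀ m, S.Sat φ (update v x m) → S.Sat φ (update v x (S.succ m))) →
    ∀ m, S.Sat φ (update v x m)
  box_congr : ∀ φ v v', (∀ i ∈ φ.fv, v i = v' i) → S.box φ v → S.box φ v'

/-- The models obtained from Henkin sets. -/
structure IsModel (T : Set Formula) (N : ℕ) (S : Str) : Prop extends IsPA N S where
  sat_thm : ∀ φ : Formula, φ.Low N → Provable T φ → ∀ v, S.Sat φ v
  box_thm : ∀ φ : Formula, φ.Low N → Provable T φ → ∀ v, S.box φ v
  box_mp : ∀ φ ψ v, S.box (.imp φ ψ) v → S.box φ v → S.box ψ v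
  box_eq : ∀ t u v, S.tval t v = S.tval u v → S.box (.eq t u) v

section model

variable {N : ℕ} {Δ : Set Formula}

/-- Equality of parameter terms in a Henkin set. -/
def Hen.setoid (H : Hen T N Δ) : Setoid {t : Term // t.High N} where
  r t u := Formula.eq t.1 u.1 ∈ Δ
  iseqv := ⟨fun t => H.eq_refl t.1, fun h => H.eq_symm h, fun h h' => H.eq_trans h h'⟩

/-- The term model. -/
noncomputable def Hen.str (H : Hen T N Δ) : Str where
  M := Quotient H.setoid
  zero := Quotient.mk H.setoid ⟨.zero, by simp [Term.High, Term.fv]⟩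
  succ := Quotient.map (fun t => ⟨.succ t.1, t.2⟩) fun _ _ h => H.lmp (.eqSucc _ _) h
  add := Quotient.map₂ (fun t u => ⟨.add t.1 u.1, by
      intro x hx
      simp only [Term.fv, Finset.mem_union] at hx
      exact hx.elim (t.2 x) (u.2 x)⟩)
    fun _ _ h _ _ h' => H.mp _ _ (H.lmp (.eqAdd _ _ _ _) h) h'
  mul := Quotient.map₂ (fun t u => ⟨.mul t.1 u.1, by
      intro x hx
      simp only [Term.fv, Finset.mem_union] at hx
      exact hx.elim (t.2 x) (u.2 x)⟩)
    fun _ _ h _ _ h' => H.mp _ _ (H.lmp (.eqMul _ _ _ _) h) h'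
  le a b := Formula.le a.out.1 b.out.1 ∈ Δ
  box φ v := .box (φ.substAll fun i => (v i).out.1) ∈ Δ

/-- The class of a parameter. -/
def Hen.cls (H : Hen T N Δ) (t : {t : Term // t.High N}) : H.str.M := Quotient.mk H.setoid t

theorem Hen.mk_eq (H : Hen T N Δ) {t u : {t : Term // t.High N}} :
    H.cls t = H.cls u ↔ Formula.eq t.1 u.1 ∈ Δ := by
  constructor
  · intro h; exact Quotient.exact h
  · intro h; exact Quotient.sound h

/-- A representative. -/
noncomputable def Hen.out (H : Hen T N Δ) (a : H.str.M) : {t : Term // t.High N} :=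
  Quotient.out (s := H.setoid) a

theorem Hen.mk_out (H : Hen T N Δ) (a : H.str.M) : H.cls (H.out a) = a :=
  Quotient.out_eq (s := H.setoid) a

theorem Hen.out_mk (H : Hen T N Δ) (t : {t : Term // t.High N}) :
    Formula.eq (H.out (H.cls t)).1 t.1 ∈ Δ := H.mk_eq.1 (H.mk_out _)

theorem Hen.tval_mk (H : Hen T N Δ) (w : ℕ → {t : Term // t.High N}) (t : Term) :
    H.str.tval t (fun i => H.cls (w i)) =
      H.cls ⟨t.substAll fun i => (w i).1, Term.High.substAll fun i => (w i).2⟩ := by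
  induction t with
  | var x => rfl
  | zero => rfl
  | succ t ih => simp only [Str.tval, ih]; rfl
  | add t u ih1 ih2 | mul t u ih1 ih2 => simp only [Str.tval, ih1, ih2]; rfl

theorem Hen.update_mk (H : Hen T N Δ) (w : ℕ → {t : Term // t.High N}) (x : ℕ)
    (t : {t : Term // t.High N}) :
    update (fun i => H.cls (w i)) x (H.cls t) = fun i => H.cls (update w x t i) := by
  funext i
  by_cases hi : i = x
  · subst hi; simp
  · simp [hi]

theorem coe_update (w : ℕ → {t : Term // t.High N}) (x : ℕ) (t : {t : Term // t.High N}) :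
    (fun i => (update w x t i).1) = update (fun i => (w i).1) x t.1 := by
  funext i
  by_cases hi : i = x
  · subst hi; simp
  · simp [hi]

theorem Hen.truth (hT : Extends T PAK) (hN : 2 ≤ N) (H : Hen T N Δ) : ∀ {φ : Formula}, φ.Low N →
    ∀ w : ℕ → {t : Term // t.High N},
    (H.str.Sat φ (fun i => H.cls (w i)) ↔ φ.substAll (fun i => (w i).1) ∈ Δ) := by
  intro φ
  induction φ with
  | falsum => intro _ w; simp only [Str.Sat, false_iff]; exact H.cons
  | eq t u => intro _ w; simp only [Str.Sat, H.tval_mk, H.mk_eq]; rfl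
  | le t u =>
    intro _ w
    simp only [Str.Sat, H.tval_mk, Formula.substAll]
    constructor
    · intro h
      exact H.mp _ _ (H.mp _ _ (H.lmp (.eqLe _ _ _ _) (H.out_mk _)) (H.out_mk _)) h
    · intro h
      exact H.mp _ _ (H.mp _ _ (H.lmp (.eqLe _ _ _ _) (H.eq_symm (H.out_mk _)))
        (H.eq_symm (H.out_mk _))) h
  | and φ ψ ih1 ih2 =>
    intro hl w; simp only [Str.Sat, Formula.substAll, H.mem_and, ih1 hl.1, ih2 hl.2]
  | or φ ψ ih1 ih2 =>
    intro hl w; simp only [Str.Sat, Formula.substAll, H.mem_or, ih1 hl.1, ih2 hl.2]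
  | imp φ ψ ih1 ih2 =>
    intro hl w; simp only [Str.Sat, Formula.substAll, H.mem_imp, ih1 hl.1, ih2 hl.2]
  | neg φ ih => intro hl w; simp only [Str.Sat, Formula.substAll, H.mem_neg, ih hl]
  | all x φ ih =>
    intro hl w
    simp only [Str.Sat, Formula.substAll, H.mem_all hl.2.blow.substAll,
      substAll_update_high hl.1 fun i => (w i).2]
    constructor
    · intro h t ht
      have := h (H.cls ⟨t, ht⟩)
      rwa [H.update_mk, ih hl.2, coe_update] at this
    · intro h m
      rw [← H.mk_out m, H.update_mk, ih hl.2, coe_update]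
      exact h _ (H.out m).2
  | ex x φ ih =>
    intro hl w
    simp only [Str.Sat, Formula.substAll, H.mem_ex hl.2.blow.substAll,
      substAll_update_high hl.1 fun i => (w i).2]
    constructor
    · rintro ⟨m, h⟩
      rw [← H.mk_out m, H.update_mk, ih hl.2, coe_update] at h
      exact ⟨_, (H.out m).2, h⟩
    · rintro ⟨t, ht, h⟩
      refine ⟨H.cls ⟨t, ht⟩, ?_⟩
      rwa [H.update_mk, ih hl.2, coe_update]
  | box φ _ =>
    intro hl w
    constructor
    · intro h
      exact H.inv hT hN (φ := .box φ) hl (fun i => (H.out (H.cls (w i))).2) (fun i => (w i).2)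
        (fun i => H.out_mk (w i)) h
    · intro h
      exact H.inv hT hN (φ := .box φ) hl (fun i => (w i).2) (fun i => (H.out (H.cls (w i))).2)
        (fun i => H.eq_symm (H.out_mk (w i))) h

theorem Hen.truth' (hT : Extends T PAK) (hN : 2 ≤ N) (H : Hen T N Δ) {φ : Formula} (hl : φ.Low N)
    (v : ℕ → H.str.M) : H.str.Sat φ v ↔ φ.substAll (fun i => (H.out (v i)).1) ∈ Δ := by
  rw [← H.truth hT hN hl]; simp only [H.mk_out]

theorem Hen.sat_subst (hT : Extends T PAK) (hN : 2 ≤ N) (H : Hen T N Δ) {φ : Formula}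
    (hl : φ.Low N) {x : ℕ} {s : Term} (hsl : s.Low N) (hs : s.fv ⊆ {x}) (v : ℕ → H.str.M) :
    H.str.Sat (φ.subst x s) v ↔ H.str.Sat φ (update v x (H.str.tval s v)) := by
  rw [H.truth' hT hN (hl.subst hsl), Formula.substAll_subst hs]
  have h := H.truth hT hN hl (update (fun i => H.out (v i)) x
    ⟨s.substAll fun i => (H.out (v i)).1, Term.High.substAll fun i => (H.out (v i)).2⟩)
  rw [coe_update, ← H.update_mk, ← H.tval_mk] at h
  simp only [H.mk_out] at h
  exact h.symm

theorem Hen.sat_thm (hT : Extends T PAK) (hN : 2 ≤ N) (H : Hen T N Δ) {φ : Formula}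
    (hl : φ.Low N) (h : Provable T φ) (v : ℕ → H.str.M) : H.str.Sat φ v :=
  (H.truth' hT hN hl v).2 (H.thm _ (h.instAll hl fun i => (H.out (v i)).2))

theorem Hen.isModel (hT : Extends T PAK) (hN : 3 ≤ N) (H : Hen T N Δ) : IsModel T N H.str := by
  have hN2 : 2 ≤ N := by omega
  have hax : ∀ φ ∈ baseAxioms, ∀ v : ℕ → H.str.M, H.str.Sat φ v := by
    intro φ hφ v
    refine H.sat_thm hT hN2 ?_ (Provable.base hT hφ) v
    simp only [baseAxioms, Set.mem_insert_iff, Set.mem_singleton_iff] at hφ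
    rcases hφ with h | h | h | h | h | h | h <;> subst h <;>
      simp [succNeZero, succInj, addZero, addSucc, mulZero, mulSucc, leDef, Formula.Low,
        Term.Low, Term.fv, Formula.iff] <;> omega
  let v2 : H.str.M → H.str.M → ℕ → H.str.M := fun a b i => if i = 0 then a else b
  refine ⟨⟨?_, ?_, ?_, ?_, ?_, ?_, ?_, ?_, ?_⟩, ?_, ?_, ?_, ?_⟩
  · intro a; exact hax succNeZero (by simp [baseAxioms]) fun _ => a
  · intro a b; exact hax succInj (by simp [baseAxioms]) (v2 a b)
  · intro a; exact hax addZero (by simp [baseAxioms]) fun _ => a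
  · intro a b; exact hax addSucc (by simp [baseAxioms]) (v2 a b)
  · intro a; exact hax mulZero (by simp [baseAxioms]) fun _ => a
  · intro a b; exact hax mulSucc (by simp [baseAxioms]) (v2 a b)
  · intro a b
    have h := hax leDef (by simp [baseAxioms]) (v2 a b)
    exact ⟨h.1, h.2⟩
  · intro φ hl x hx v h0 h1
    have hvl : (Term.var x).Low N := by simpa [Term.Low, Term.fv] using hx
    have hi : Provable T (inductionAx x φ) := hT _ (Or.inl (Or.inr ⟨x, φ, rfl⟩))
    have h := H.sat_thm hT hN2 (φ := inductionAx x φ)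
      ⟨⟨hl.subst (by simp [Term.Low, Term.fv]), hx, hl, hl.subst hvl⟩, hx, hl⟩ hi v
    refine h ⟨?_, ?_⟩
    · rw [H.sat_subst hT hN2 hl (by simp [Term.Low, Term.fv]) (by simp [Term.fv])]
      exact h0
    · intro m hm
      rw [H.sat_subst hT hN2 hl (by simpa [Term.Low, Term.fv] using hx) (by simp [Term.fv])]
      simpa [Str.tval] using h1 m hm
  · intro φ v v' hv h
    have : (φ.substAll fun i => (H.out (v i)).1) = φ.substAll fun i => (H.out (v' i)).1 :=
      Formula.substAll_congr fun i hi => by rw [hv i hi]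
    change Formula.box (φ.substAll fun i => (H.out (v' i)).1) ∈ Δ
    rw [← this]; exact h
  · intro φ hl h v; exact H.sat_thm hT hN2 hl h v
  · intro φ hl h v
    exact H.thm _ (Provable.instAll hl h fun i => (H.out (v i)).2).nec
  · intro φ ψ v h h'
    exact H.box_mp hT h h'
  · intro t u v h
    have h1 := H.tval_mk (fun i => H.out (v i))
    simp only [H.mk_out] at h1
    rw [h1, h1, H.mk_eq] at h
    exact H.mp _ _ (H.thm _ (rigid hT hN2 (Term.High.substAll fun i => (H.out (v i)).2)
      (Term.High.substAll fun i => (H.out (v i)).2))) h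

end model

/-- `∀ x_{k-1} ... ∀ x_0 φ`. -/
def allN (φ : Formula) : ℕ → Formula
  | 0 => φ
  | k + 1 => .all k (allN φ k)

theorem fv_allN (φ : Formula) (k : ℕ) : ∀ x ∈ (allN φ k).fv, x ∈ φ.fv ∧ k ≤ x := by
  induction k with
  | zero => simp [allN]
  | succ k ih =>
    intro x hx
    simp only [allN, Formula.fv, Finset.mem_erase] at hx
    have := ih x hx.2
    exact ⟨this.1, by omega⟩

theorem low_allN {φ : Formula} {N : ℕ} (h : φ.Low N) : ∀ k ≤ N, (allN φ k).Low N := by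
  intro k
  induction k with
  | zero => intro _; exact h
  | succ k ih => intro hk; exact ⟨hk, ih (by omega)⟩

theorem Str.sat_allN {S : Str} {φ : Formula} (h : ∀ v, S.Sat φ v) (k : ℕ) :
    ∀ v, S.Sat (allN φ k) v := by
  induction k with
  | zero => exact h
  | succ k ih => intro v m; exact ih _

/-- Completeness. -/
theorem completeness (hT : Extends T PAK) {N : ℕ} (hN : 3 ≤ N) {φ : Formula} (hl : φ.Low N)
    (h : ∀ S, IsModel T N S → ∀ v, S.Sat φ v) : Provable T φ := by
  have h1 : Provable T (allN φ N) := by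
    refine provable_of_hen N fun Δ H => ?_
    have h2 := Str.sat_allN (h _ (H.isModel hT hN)) N fun _ => H.cls ⟨.zero, by
      simp [Term.High, Term.fv]⟩
    rw [H.truth' hT (by omega) (low_allN hl N le_rfl), Formula.substAll_congr (g := Term.var),
      Formula.substAll_var] at h2
    · exact h2
    · intro i hi
      have h3 := fv_allN φ N i hi
      have := hl.fv i h3.1
      omega
  have h2 : ∀ k, Provable T (allN φ k) → Provable T φ := by
    intro k
    induction k with
    | zero => exact id
    | succ k ih => exact fun h => ih h.inst
  exact h2 N h1

end ModalArith

namespace ModalArith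
open Function

/-! ### Part 4: arithmetic in models -/

theorem Str.tval_congr {S : Str} {t : Term} {v v' : ℕ → S.M} (h : ∀ i ∈ t.fv, v i = v' i) :
    S.tval t v = S.tval t v' := by
  induction t <;> simp_all [Str.tval, Term.fv]

theorem Str.tval_update {S : Str} {t : Term} {v : ℕ → S.M} {x : ℕ} {m : S.M} (h : x ∉ t.fv) :
    S.tval t (update v x m) = S.tval t v :=
  Str.tval_congr fun i hi => by
    have : i ≠ x := by rintro rfl; exact h hi
    simp [this]

theorem Formula.fv_ball {x : ℕ} {t : Term} {φ : Formula} (hx : x ∉ t.fv) :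
    (Formula.ball x t φ).fv = t.fv ∪ φ.fv.erase x := by
  ext i
  simp only [Formula.ball, Formula.lt, Formula.fv, Term.fv, Finset.mem_erase, Finset.mem_union,
    Finset.mem_singleton]
  have : i = x → i ∉ t.fv := by rintro rfl; exact hx
  tauto

theorem Formula.fv_bex {x : ℕ} {t : Term} {φ : Formula} (hx : x ∉ t.fv) :
    (Formula.bex x t φ).fv = t.fv ∪ φ.fv.erase x := by
  ext i
  simp only [Formula.bex, Formula.lt, Formula.fv, Term.fv, Finset.mem_erase, Finset.mem_union,
    Finset.mem_singleton]
  have : i = x → i ∉ t.fv := by rintro rfl; exact hx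
  tauto

theorem Formula.low_ball {x N : ℕ} {t : Term} {φ : Formula} (hx : x < N) (ht : t.Low N)
    (h : φ.Low N) : (Formula.ball x t φ).Low N :=
  ⟨hx, ⟨by simpa [Term.Low, Term.fv] using hx, ht⟩, h⟩

theorem Formula.low_bex {x N : ℕ} {t : Term} {φ : Formula} (hx : x < N) (ht : t.Low N)
    (h : φ.Low N) : (Formula.bex x t φ).Low N :=
  ⟨hx, ⟨by simpa [Term.Low, Term.fv] using hx, ht⟩, h⟩

/-- Strict order. -/
def Str.lt (S : Str) (a b : S.M) : Prop := S.le (S.succ a) b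

theorem Str.sat_ball {S : Str} {x : ℕ} {t : Term} {φ : Formula} {v : ℕ → S.M} (hx : x ∉ t.fv) :
    S.Sat (.ball x t φ) v ↔ ∀ m, S.lt m (S.tval t v) → S.Sat φ (update v x m) := by
  simp [Formula.ball, Formula.lt, Str.Sat, Str.tval, Str.tval_update hx, Str.lt]

theorem Str.sat_bex {S : Str} {x : ℕ} {t : Term} {φ : Formula} {v : ℕ → S.M} (hx : x ∉ t.fv) :
    S.Sat (.bex x t φ) v ↔ ∃ m, S.lt m (S.tval t v) ∧ S.Sat φ (update v x m) := by
  simp [Formula.bex, Formula.lt, Str.Sat, Str.tval, Str.tval_update hx, Str.lt]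

theorem var_low {x N : ℕ} (h : x < N) : (Term.var x).Low N := by simpa [Term.Low, Term.fv] using h

namespace IsPA

variable {S : Str} {N : ℕ}

theorem sat_congr (hS : IsPA N S) : ∀ {φ : Formula} {v v' : ℕ → S.M},
    (∀ i ∈ φ.fv, v i = v' i) → (S.Sat φ v ↔ S.Sat φ v') := by
  intro φ
  have upd : ∀ {φ : Formula} {x : ℕ} {v v' : ℕ → S.M} (m : S.M),
      (∀ i ∈ φ.fv.erase x, v i = v' i) → ∀ i ∈ φ.fv, update v x m i = update v' x m i := by
    intro φ x v v' m h i hi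
    by_cases hix : i = x
    · subst hix; simp
    · simp [hix, h i (by simp [hix, hi])]
  induction φ with
  | falsum => intros; rfl
  | eq t u | le t u =>
    intro v v' h
    simp only [Formula.fv, Finset.mem_union] at h
    simp only [Str.Sat, Str.tval_congr fun i hi => h i (Or.inl hi),
      Str.tval_congr fun i hi => h i (Or.inr hi)]
  | and φ ψ ih1 ih2 | or φ ψ ih1 ih2 | imp φ ψ ih1 ih2 =>
    intro v v' h
    simp only [Formula.fv, Finset.mem_union] at h
    simp only [Str.Sat, ih1 fun i hi => h i (Or.inl hi), ih2 fun i hi => h i (Or.inr hi)]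
  | neg φ ih => intro v v' h; simp only [Str.Sat, ih h]
  | all x φ ih => intro v v' h; exact forall_congr' fun m => ih (upd m h)
  | ex x φ ih => intro v v' h; exact exists_congr fun m => ih (upd m h)
  | box φ ih =>
    intro v v' h
    exact ⟨hS.box_congr _ _ _ h, hS.box_congr _ _ _ fun i hi => (h i hi).symm⟩

theorem sat_update (hS : IsPA N S) {φ : Formula} {v : ℕ → S.M} {x : ℕ} {m : S.M}
    (h : x ∉ φ.fv) : S.Sat φ (update v x m) ↔ S.Sat φ v :=
  hS.sat_congr fun i hi => by
    have : i ≠ x := by rintro rfl; exact h hi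
    simp [this]

theorem ind' (hS : IsPA N S) (P : S.M → Prop) (φ : Formula) (hl : φ.Low N) (x : ℕ) (hx : x < N)
    (v : ℕ → S.M) (hP : ∀ m, S.Sat φ (update v x m) ↔ P m) (h0 : P S.zero)
    (h1 : ∀ m, P m → P (S.succ m)) (m : S.M) : P m := by
  rw [← hP]
  refine hS.ind φ hl x hx v ((hP _).2 h0) (fun m hm => (hP _).2 (h1 m ((hP _).1 hm))) m

theorem zero_add (hS : IsPA N S) (hN : 3 ≤ N) (a : S.M) : S.add S.zero a = a := by
  refine hS.ind' (fun a => S.add S.zero a = a) (.eq (.add .zero (.var 0)) (.var 0))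
    (by simp [Formula.Low, Term.Low, Term.fv]; omega) 0 (by omega) (fun _ => S.zero) ?_ ?_ ?_ a
  · intro m; simp [Str.Sat, Str.tval]
  · exact hS.add_zero _
  · intro m hm; rw [hS.add_succ, hm]

theorem succ_add (hS : IsPA N S) (hN : 3 ≤ N) (b a : S.M) :
    S.add (S.succ b) a = S.succ (S.add b a) := by
  refine hS.ind' (fun a => S.add (S.succ b) a = S.succ (S.add b a))
    (.eq (.add (.succ (.var 1)) (.var 0)) (.succ (.add (.var 1) (.var 0))))
    (by simp [Formula.Low, Term.Low, Term.fv]; omega) 0 (by omega) (fun _ => b) ?_ ?_ ?_ a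
  · intro m; simp [Str.Sat, Str.tval]
  · simp [hS.add_zero]
  · intro m hm; simp only [hS.add_succ, hm]

theorem add_assoc (hS : IsPA N S) (hN : 3 ≤ N) (b c a : S.M) :
    S.add (S.add b c) a = S.add b (S.add c a) := by
  refine hS.ind' (fun a => S.add (S.add b c) a = S.add b (S.add c a))
    (.eq (.add (.add (.var 1) (.var 2)) (.var 0)) (.add (.var 1) (.add (.var 2) (.var 0))))
    (by simp [Formula.Low, Term.Low, Term.fv]; omega) 0 (by omega)
    (fun i => if i = 1 then b else c) ?_ ?_ ?_ a
  · intro m; simp [Str.Sat, Str.tval]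
  · simp [hS.add_zero]
  · intro m hm; simp only [hS.add_succ, hm]

theorem zero_or_succ (hS : IsPA N S) (hN : 3 ≤ N) (a : S.M) : a = S.zero ∨ ∃ b, a = S.succ b := by
  refine hS.ind' (fun a => a = S.zero ∨ ∃ b, a = S.succ b)
    (.or (.eq (.var 0) .zero) (.ex 1 (.eq (.var 0) (.succ (.var 1)))))
    (by simp [Formula.Low, Term.Low, Term.fv]; omega) 0 (by omega)
    (fun i => S.zero) ?_ ?_ ?_ a
  · intro m; simp [Str.Sat, Str.tval]
  · simp
  · intro m hm; simp

theorem le_refl (hS : IsPA N S) (a : S.M) : S.le a a := (hS.le_iff a a).2 ⟨_, hS.add_zero a⟩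

theorem le_trans (hS : IsPA N S) (hN : 3 ≤ N) {a b c : S.M} (h : S.le a b) (h' : S.le b c) :
    S.le a c := by
  rw [hS.le_iff] at *
  obtain ⟨d, rfl⟩ := h
  obtain ⟨e, rfl⟩ := h'
  exact ⟨_, (hS.add_assoc hN a d e).symm⟩

theorem not_lt_zero (hS : IsPA N S) (hN : 3 ≤ N) (a : S.M) : ¬ S.lt a S.zero := by
  rw [Str.lt, hS.le_iff]
  rintro ⟨c, h⟩
  rw [hS.succ_add hN] at h
  exact hS.succ_ne _ h

theorem zero_le (hS : IsPA N S) (hN : 3 ≤ N) (a : S.M) : S.le S.zero a :=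
  (hS.le_iff _ _).2 ⟨a, hS.zero_add hN a⟩

theorem succ_le_succ (hS : IsPA N S) (hN : 3 ≤ N) {a b : S.M} :
    S.le (S.succ a) (S.succ b) ↔ S.le a b := by
  simp only [hS.le_iff, hS.succ_add hN]
  exact exists_congr fun c => ⟨hS.succ_inj _ _, fun h => by rw [h]⟩

theorem le_iff_lt_or_eq (hS : IsPA N S) (hN : 3 ≤ N) {a b : S.M} :
    S.le a b ↔ S.lt a b ∨ a = b := by
  simp only [Str.lt, hS.le_iff, hS.succ_add hN]
  constructor
  · rintro ⟨c, rfl⟩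
    rcases hS.zero_or_succ hN c with rfl | ⟨d, rfl⟩
    · right; rw [hS.add_zero]
    · left; exact ⟨d, (hS.add_succ _ _).symm⟩
  · rintro (⟨c, rfl⟩ | rfl)
    · exact ⟨S.succ c, hS.add_succ _ _⟩
    · exact ⟨_, hS.add_zero _⟩

theorem lt_succ (hS : IsPA N S) (hN : 3 ≤ N) {a b : S.M} :
    S.lt a (S.succ b) ↔ S.lt a b ∨ a = b := by
  rw [← hS.le_iff_lt_or_eq hN, ← hS.succ_le_succ hN]; rfl

theorem lt_self_succ (hS : IsPA N S) (a : S.M) : S.lt a (S.succ a) := hS.le_refl _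

theorem le_of_lt (hS : IsPA N S) (hN : 3 ≤ N) {a b : S.M} (h : S.lt a b) : S.le a b :=
  (hS.le_iff_lt_or_eq hN).2 (Or.inl h)

theorem lt_irrefl (hS : IsPA N S) (hN : 3 ≤ N) (a : S.M) : ¬ S.lt a a := by
  refine hS.ind' (fun a => ¬ S.lt a a) (.neg (.le (.succ (.var 0)) (.var 0)))
    (by simp [Formula.Low, Term.Low, Term.fv]; omega) 0 (by omega)
    (fun i => S.zero) ?_ ?_ ?_ a
  · intro m; simp [Str.Sat, Str.tval, Str.lt]
  · exact hS.not_lt_zero hN _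
  · intro m hm h; exact hm ((hS.succ_le_succ hN).1 h)

theorem lt_or_le (hS : IsPA N S) (hN : 3 ≤ N) (a b : S.M) : S.lt a b ∨ S.le b a := by
  refine hS.ind' (fun b => S.lt a b ∨ S.le b a)
    (.or (.le (.succ (.var 1)) (.var 0)) (.le (.var 0) (.var 1)))
    (by simp [Formula.Low, Term.Low, Term.fv]; omega) 0 (by omega)
    (fun i => a) ?_ ?_ ?_ b
  · intro m; simp [Str.Sat, Str.tval, Str.lt]
  · exact Or.inr (hS.zero_le hN a)
  · rintro m (h | h)
    · exact Or.inl ((hS.lt_succ hN).2 (Or.inl h))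
    · rcases (hS.le_iff_lt_or_eq hN).1 h with h | rfl
      · exact Or.inr h
      · exact Or.inl (hS.lt_self_succ _)

theorem lt_of_lt_of_le (hS : IsPA N S) (hN : 3 ≤ N) {a b c : S.M} (h : S.lt a b) (h' : S.le b c) :
    S.lt a c := hS.le_trans hN h h'

theorem lt_of_le_of_lt (hS : IsPA N S) (hN : 3 ≤ N) {a b c : S.M} (h : S.le a b) (h' : S.lt b c) :
    S.lt a c := hS.le_trans hN ((hS.succ_le_succ hN).2 h) h'

theorem exists_max (hS : IsPA N S) (hN : 3 ≤ N) (a b : S.M) : ∃ c, S.le a c ∧ S.le b c := by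
  rcases hS.lt_or_le hN a b with h | h
  · exact ⟨b, hS.le_of_lt hN h, hS.le_refl b⟩
  · exact ⟨a, hS.le_refl a, h⟩

/-- The least number principle. -/
theorem least (hS : IsPA N S) (hN : 3 ≤ N) {K x : ℕ} {φ : Formula} (hφ : φ.Low K) (hx : x < K)
    (hK : K + 1 ≤ N) {v : ℕ → S.M} {a : S.M} (h : S.Sat φ (update v x a)) :
    ∃ a, S.Sat φ (update v x a) ∧ ∀ b, S.lt b a → ¬ S.Sat φ (update v x b) := by
  by_contra hc
  push Not at hc
  have key : ∀ m, ∀ b, S.lt b m → ¬ S.Sat φ (update v x b) := by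
    refine hS.ind' _ (.ball x (.var K) (.neg φ)) (Formula.low_ball (by omega)
      (var_low (by omega)) (Formula.Low.mono (by omega) hφ)) K (by omega) v ?_ ?_ ?_
    · intro m
      rw [Str.sat_ball (by simp [Term.fv]; omega)]
      refine forall_congr' fun b => ?_
      simp only [Str.tval, update_self, Str.Sat]
      rw [update_comm (by omega), hS.sat_update fun h => (hφ.fv K h).false]
    · intro b hb; exact absurd hb (hS.not_lt_zero hN b)
    · intro m hm b hb
      rcases (hS.lt_succ hN).1 hb with h1 | rfl
      · exact hm b h1
      · intro h2
        obtain ⟨c, hc1, hc2⟩ := hc b h2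
        exact hm c hc1 hc2
  exact key _ a (hS.lt_self_succ a) h

end IsPA

/-! Numerals -/

/-- Interpretation of the standard numbers. -/
def Str.nu (S : Str) : ℕ → S.M
  | 0 => S.zero
  | n + 1 => S.succ (S.nu n)

theorem Str.tval_numeral (S : Str) (n : ℕ) (v : ℕ → S.M) : S.tval (Term.numeral n) v = S.nu n := by
  induction n with
  | zero => rfl
  | succ n ih => simp only [Term.numeral, Str.tval, ih]; rfl

namespace IsPA

variable {S : Str} {N : ℕ}

theorem nu_add (hS : IsPA N S) (a b : ℕ) : S.nu (a + b) = S.add (S.nu a) (S.nu b) := by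
  induction b with
  | zero => exact (hS.add_zero _).symm
  | succ b ih => rw [← Nat.add_assoc]; simp only [Str.nu, hS.add_succ, ih]

theorem nu_mul (hS : IsPA N S) (a b : ℕ) : S.nu (a * b) = S.mul (S.nu a) (S.nu b) := by
  induction b with
  | zero => exact (hS.mul_zero _).symm
  | succ b ih => rw [Nat.mul_succ, hS.nu_add, ih]; simp only [Str.nu, hS.mul_succ]

theorem nu_lt (hS : IsPA N S) {a b : ℕ} (h : a < b) : S.lt (S.nu a) (S.nu b) := by
  obtain ⟨c, rfl⟩ := Nat.exists_eq_add_of_lt h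
  rw [Str.lt, hS.le_iff]
  refine ⟨S.nu c, ?_⟩
  have := hS.nu_add (a + 1) c
  rw [show S.succ (S.nu a) = S.nu (a + 1) from rfl, ← this]
  congr 1; omega

theorem lt_nu (hS : IsPA N S) (hN : 3 ≤ N) {b : ℕ} {m : S.M} (h : S.lt m (S.nu b)) :
    ∃ a < b, m = S.nu a := by
  induction b with
  | zero => exact absurd h (hS.not_lt_zero hN m)
  | succ b ih =>
    rcases (hS.lt_succ hN).1 h with h | h
    · obtain ⟨a, ha, h⟩ := ih h
      exact ⟨a, by omega, h⟩
    · exact ⟨b, by omega, h⟩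

theorem nu_inj (hS : IsPA N S) (hN : 3 ≤ N) {a b : ℕ} : S.nu a = S.nu b ↔ a = b := by
  constructor
  · intro h
    by_contra hab
    rcases Nat.lt_or_gt_of_ne hab with h1 | h1
    · have := hS.nu_lt h1; rw [h] at this; exact hS.lt_irrefl hN _ this
    · have := hS.nu_lt h1; rw [h] at this; exact hS.lt_irrefl hN _ this
  · rintro rfl; rfl

theorem nu_le (hS : IsPA N S) (hN : 3 ≤ N) {a b : ℕ} : S.le (S.nu a) (S.nu b) ↔ a ≤ b := by
  rw [hS.le_iff_lt_or_eq hN, hS.nu_inj hN, Nat.le_iff_lt_or_eq]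
  refine or_congr_left ⟨fun h => ?_, hS.nu_lt⟩
  obtain ⟨c, hc, h⟩ := hS.lt_nu hN h
  rw [hS.nu_inj hN] at h; omega

theorem nu_lt_iff (hS : IsPA N S) (hN : 3 ≤ N) {a b : ℕ} : S.lt (S.nu a) (S.nu b) ↔ a < b :=
  hS.nu_le hN (a := a + 1)

theorem tval_nu (hS : IsPA N S) (t : Term) (v : ℕ → ℕ) :
    S.tval t (fun i => S.nu (v i)) = S.nu (t.val v) := by
  induction t with
  | var x => rfl
  | zero => rfl
  | succ t ih => simp only [Str.tval, ih]; rfl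
  | add t u ih1 ih2 => simp only [Str.tval, ih1, ih2, Term.val, hS.nu_add]
  | mul t u ih1 ih2 => simp only [Str.tval, ih1, ih2, Term.val, hS.nu_mul]

end IsPA

theorem Str.update_nu (S : Str) (v : ℕ → ℕ) (x n : ℕ) :
    update (fun i => S.nu (v i)) x (S.nu n) = fun i => S.nu (update v x n i) := by
  funext i
  by_cases hi : i = x
  · subst hi; simp
  · simp [hi]

theorem Term.val_congr {t : Term} {v v' : ℕ → ℕ} (h : ∀ i ∈ t.fv, v i = v' i) :
    t.val v = t.val v' := by
  induction t <;> simp_all [Term.val, Term.fv]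

theorem Term.val_update {t : Term} {v : ℕ → ℕ} {x n : ℕ} (h : x ∉ t.fv) :
    t.val (update v x n) = t.val v :=
  Term.val_congr fun i hi => by
    have : i ≠ x := by rintro rfl; exact h hi
    simp [this]

theorem Formula.val_ball {x : ℕ} {t : Term} {φ : Formula} {v : ℕ → ℕ} (hx : x ∉ t.fv) :
    (Formula.ball x t φ).val v ↔ ∀ n < t.val v, φ.val (update v x n) := by
  simp [Formula.ball, Formula.lt, Formula.val, Term.val, Term.val_update hx, Nat.succ_le_iff]

theorem Formula.val_bex {x : ℕ} {t : Term} {φ : Formula} {v : ℕ → ℕ} (hx : x ∉ t.fv) :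
    (Formula.bex x t φ).val v ↔ ∃ n < t.val v, φ.val (update v x n) := by
  simp [Formula.bex, Formula.lt, Formula.val, Term.val, Term.val_update hx, Nat.succ_le_iff]

/-- Bounded formulas are absolute. -/
theorem IsPA.delta0_nu {S : Str} {N : ℕ} (hS : IsPA N S) (hN : 3 ≤ N) {φ : Formula}
    (h : IsDelta0 φ) : ∀ v : ℕ → ℕ, S.Sat φ (fun i => S.nu (v i)) ↔ φ.val v := by
  induction h with
  | falsum => intro v; rfl
  | eq t u => intro v; simp only [Str.Sat, hS.tval_nu, hS.nu_inj hN, Formula.val]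
  | le t u => intro v; simp only [Str.Sat, hS.tval_nu, hS.nu_le hN, Formula.val]
  | and _ _ ih1 ih2 | or _ _ ih1 ih2 | imp _ _ ih1 ih2 =>
    intro v; simp only [Str.Sat, Formula.val, ih1, ih2]
  | neg _ ih => intro v; simp only [Str.Sat, Formula.val, ih]
  | ball hx _ ih =>
    intro v
    rw [Str.sat_ball hx, Formula.val_ball hx, hS.tval_nu]
    constructor
    · intro h n hn
      have := h _ (hS.nu_lt hn)
      rwa [Str.update_nu, ih] at this
    · intro h m hm
      obtain ⟨n, hn, rfl⟩ := hS.lt_nu hN hm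
      rw [Str.update_nu, ih]
      exact h n hn
  | bex hx _ ih =>
    intro v
    rw [Str.sat_bex hx, Formula.val_bex hx, hS.tval_nu]
    constructor
    · rintro ⟨m, hm, h⟩
      obtain ⟨n, hn, rfl⟩ := hS.lt_nu hN hm
      rw [Str.update_nu, ih] at h
      exact ⟨n, hn, h⟩
    · rintro ⟨n, hn, h⟩
      refine ⟨_, hS.nu_lt hn, ?_⟩
      rwa [Str.update_nu, ih]

/-- The standard structure. -/
def natStr : Str where
  M := ℕ
  zero := 0
  succ := fun n => n + 1
  add := fun a b => a + b
  mul := fun a b => a * b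
  le := fun a b => a ≤ b
  box := fun _ _ => False

theorem natStr_tval (t : Term) (v : ℕ → ℕ) : natStr.tval t v = t.val v := by
  induction t with
  | var x => rfl
  | zero => rfl
  | succ t ih => simp only [Str.tval, ih]; rfl
  | add t u ih1 ih2 | mul t u ih1 ih2 => simp only [Str.tval, ih1, ih2]; rfl

theorem natStr_sat : ∀ (φ : Formula) (v : ℕ → ℕ), natStr.Sat φ v ↔ φ.val v := by
  intro φ
  induction φ with
  | falsum => intro v; rfl
  | eq t u => intro v; simp only [Str.Sat, natStr_tval]; rfl
  | le t u => intro v; simp only [Str.Sat, natStr_tval]; rfl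
  | and φ ψ ih1 ih2 | or φ ψ ih1 ih2 | imp φ ψ ih1 ih2 =>
    intro v; simp only [Str.Sat, Formula.val, ih1, ih2]
  | neg φ ih => intro v; simp only [Str.Sat, Formula.val, ih]
  | all x φ ih => intro v; exact forall_congr' fun m => ih _
  | ex x φ ih => intro v; exact exists_congr fun m => ih _
  | box φ ih => intro v; rfl

theorem natStr_isPA (N : ℕ) : IsPA N natStr where
  succ_ne := fun a => Nat.succ_ne_zero a
  succ_inj := fun a b h => Nat.succ.inj h
  add_zero := fun a => rfl
  add_succ := fun a b => rfl
  mul_zero := fun a => rfl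
  mul_succ := fun a b => rfl
  le_iff := fun a b => (le_iff_exists_add (α := ℕ)).trans
    (exists_congr fun c => eq_comm)
  ind := fun φ _ x _ v h0 h1 m => Nat.rec h0 (fun m hm => h1 m hm) m
  box_congr := fun _ _ _ _ h => h

end ModalArith

namespace ModalArith
open Function

/-! ### Part 5: normal forms and completeness for boxed bounded formulas -/

theorem not_fv_of_low {K u : ℕ} {φ : Formula} (h : φ.Low K) (hu : K ≤ u) : u ∉ φ.fv :=
  fun hx => absurd (h.fv u hx) (by omega)

theorem not_fv_of_low' {K u : ℕ} {t : Term} (h : t.Low K) (hu : K ≤ u) : u ∉ t.fv :=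
  fun hx => absurd (h u hx) (by omega)

theorem IsPA.collect {S : Str} {N : ℕ} (hS : IsPA N S) (hN : 3 ≤ N) {u x : ℕ} (huN : u + 2 ≤ N)
    {t : Term} {δ : Formula} (hδ : δ.Low (u + 1)) (hx : x < u) (ht : t.Low u) (hxt : x ∉ t.fv)
    (hmono : ∀ v a b, S.le a b → S.Sat δ (update v u a) → S.Sat δ (update v u b))
    {v : ℕ → S.M}
    (h : ∀ m, S.lt m (S.tval t v) → ∃ a, S.Sat δ (update (update v x m) u a)) :
    ∃ a, ∀ m, S.lt m (S.tval t v) → S.Sat δ (update (update v x m) u a) := by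
  have key : ∀ y, ∃ a, ∀ m, S.lt m y → S.lt m (S.tval t v) →
      S.Sat δ (update (update v x m) u a) := by
    refine hS.ind' _ (.ex u (.ball x (.var (u + 1)) (.imp (.lt (.var x) t) δ))) ?_ (u + 1)
      (by omega) v ?_ ?_ ?_
    · refine ⟨by omega, Formula.low_ball (by omega) (var_low (by omega))
        ⟨⟨?_, ht.mono (by omega)⟩, Formula.Low.mono (by omega) hδ⟩⟩
      simp [Term.Low, Term.fv]; omega
    · intro y
      have hxu : x ≠ u + 1 := by omega
      have hxu' : x ≠ u := by omega
      refine exists_congr fun a => ?_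
      rw [Str.sat_ball (by simpa [Term.fv] using hxu)]
      refine forall_congr' fun m => ?_
      simp only [Str.tval, Str.Sat, Formula.lt, update_self, Str.lt, ne_eq, Nat.succ_ne_self,
        not_false_eq_true, update_of_ne, Str.tval_update hxt,
        Str.tval_update (not_fv_of_low' ht le_rfl),
        Str.tval_update (not_fv_of_low' ht (Nat.le_succ u))]
      refine imp_congr_right fun _ => imp_congr_right fun _ => ?_
      refine hS.sat_congr fun z hz => ?_
      have hz' : z ≠ u + 1 := fun h => not_fv_of_low hδ le_rfl (h ▸ hz)
      simp only [update_apply]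
      split_ifs <;> first | rfl | omega
    · exact ⟨S.zero, fun m hm => absurd hm (hS.not_lt_zero hN m)⟩
    · rintro y ⟨a, ha⟩
      by_cases hy : S.lt y (S.tval t v)
      · obtain ⟨b, hb⟩ := h y hy
        obtain ⟨c, hac, hbc⟩ := hS.exists_max hN a b
        refine ⟨c, fun m hm hmt => ?_⟩
        rcases (hS.lt_succ hN).1 hm with h1 | rfl
        · exact hmono _ _ _ hac (ha m h1 hmt)
        · exact hmono _ _ _ hbc hb
      · refine ⟨a, fun m hm hmt => ?_⟩
        rcases (hS.lt_succ hN).1 hm with h1 | rfl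
        · exact ha m h1 hmt
        · exact absurd hmt hy
  obtain ⟨a, ha⟩ := key (S.tval t v)
  exact ⟨a, fun m hm => ha m hm hm⟩

/-- Normal form of a Σ₁ formula. -/
structure NF (u : ℕ) (φ δ : Formula) : Prop where
  d0 : IsDelta0 δ
  low : δ.Low (u + 1)
  fv : ∀ x ∈ δ.fv, x = u ∨ x ∈ φ.fv
  sat : ∀ S N, IsPA N S → 3 ≤ N → u + 2 ≤ N → ∀ v, (S.Sat φ v ↔ ∃ a, S.Sat δ (update v u a))
  mono : ∀ S N, IsPA N S → 3 ≤ N → u + 2 ≤ N → ∀ v a b, S.le a b →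
    S.Sat δ (update v u a) → S.Sat δ (update v u b)

theorem exists_nf {φ : Formula} (h : IsSigma1 φ) {u : ℕ} (hl : φ.Low u) : ∃ δ, NF u φ δ := by
  induction h with
  | @delta0 φ h =>
    refine ⟨φ, h, Formula.Low.mono (by omega) hl, fun x hx => Or.inr hx, ?_, ?_⟩
    · intro S N hS _ _ v
      simp only [hS.sat_update (not_fv_of_low hl le_rfl)]
      exact ⟨fun h => ⟨S.zero, h⟩, fun ⟨_, h⟩ => h⟩
    · intro S N hS _ _ v a b _
      simp only [hS.sat_update (not_fv_of_low hl le_rfl)]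
      exact id
  | and _ _ ih1 ih2 =>
    obtain ⟨δ1, h1⟩ := ih1 hl.1
    obtain ⟨δ2, h2⟩ := ih2 hl.2
    refine ⟨.and δ1 δ2, h1.d0.and h2.d0, ⟨h1.low, h2.low⟩, ?_, ?_, ?_⟩
    · intro x
      have := h1.fv x; have := h2.fv x
      simp only [Formula.fv, Finset.mem_union]; tauto
    · intro S N hS hN hu v
      simp only [Str.Sat]
      rw [h1.sat S N hS hN hu, h2.sat S N hS hN hu]
      constructor
      · rintro ⟨⟨a, ha⟩, ⟨b, hb⟩⟩
        obtain ⟨c, hac, hbc⟩ := hS.exists_max hN a b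
        exact ⟨c, h1.mono S N hS hN hu _ _ _ hac ha, h2.mono S N hS hN hu _ _ _ hbc hb⟩
      · rintro ⟨a, ha, hb⟩; exact ⟨⟨a, ha⟩, ⟨a, hb⟩⟩
    · intro S N hS hN hu v a b hab
      exact And.imp (h1.mono S N hS hN hu _ _ _ hab) (h2.mono S N hS hN hu _ _ _ hab)
  | or _ _ ih1 ih2 =>
    obtain ⟨δ1, h1⟩ := ih1 hl.1
    obtain ⟨δ2, h2⟩ := ih2 hl.2
    refine ⟨.or δ1 δ2, h1.d0.or h2.d0, ⟨h1.low, h2.low⟩, ?_, ?_, ?_⟩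
    · intro x
      have := h1.fv x; have := h2.fv x
      simp only [Formula.fv, Finset.mem_union]; tauto
    · intro S N hS hN hu v
      simp only [Str.Sat]
      rw [h1.sat S N hS hN hu, h2.sat S N hS hN hu, exists_or]
    · intro S N hS hN hu v a b hab
      exact Or.imp (h1.mono S N hS hN hu _ _ _ hab) (h2.mono S N hS hN hu _ _ _ hab)
  | @ex x φ _ ih =>
    obtain ⟨δ, h⟩ := ih hl.2
    have hx : x < u := hl.1
    have hxu : x ∉ (Term.var u).fv := by simp [Term.fv]; omega
    refine ⟨.bex x (.var u) δ, .bex hxu h.d0,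
      Formula.low_bex (by omega) (var_low (by omega)) h.low, ?_, ?_, ?_⟩
    · intro y
      have := h.fv y
      simp only [Formula.fv_bex hxu, Formula.fv, Finset.mem_union, Finset.mem_erase, Term.fv,
        Finset.mem_singleton]; tauto
    · intro S N hS hN hu v
      simp only [Str.sat_bex hxu, Str.tval, update_self]
      simp only [Str.Sat, h.sat S N hS hN hu]
      constructor
      · rintro ⟨m, a, ha⟩
        obtain ⟨c, hac, hbc⟩ := hS.exists_max hN a (S.succ m)
        refine ⟨c, m, hbc, ?_⟩
        rw [update_comm (by omega)]
        exact h.mono S N hS hN hu _ _ _ hac ha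
      · rintro ⟨a, m, _, ha⟩
        rw [update_comm (by omega)] at ha
        exact ⟨m, a, ha⟩
    · intro S N hS hN hu v a b hab
      simp only [Str.sat_bex hxu, Str.tval, update_self]
      rintro ⟨m, hm, ha⟩
      refine ⟨m, hS.lt_of_lt_of_le hN hm hab, ?_⟩
      rw [update_comm (by omega)] at ha ⊢
      exact h.mono S N hS hN hu _ _ _ hab ha
  | @ball x t φ hxt _ ih =>
    obtain ⟨δ, h⟩ := ih hl.2.2
    have hx : x < u := hl.1
    have ht : t.Low u := hl.2.1.2
    have hut : u ∉ t.fv := not_fv_of_low' ht le_rfl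
    refine ⟨.ball x t δ, .ball hxt h.d0,
      Formula.low_ball (by omega) (ht.mono (by omega)) h.low, ?_, ?_, ?_⟩
    · intro y
      have := h.fv y
      simp only [Formula.fv_ball hxt, Finset.mem_union, Finset.mem_erase]; tauto
    · intro S N hS hN hu v
      simp only [Str.sat_ball hxt, Str.tval_update hut, h.sat S N hS hN hu]
      constructor
      · intro h1
        obtain ⟨a, ha⟩ := hS.collect hN hu h.low hx ht hxt
          (fun v a b => h.mono S N hS hN hu v a b) h1
        refine ⟨a, fun m hm => ?_⟩
        rw [update_comm (by omega)]
        exact ha m hm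
      · rintro ⟨a, ha⟩ m hm
        have := ha m hm
        rw [update_comm (by omega)] at this
        exact ⟨a, this⟩
    · intro S N hS hN hu v a b hab
      simp only [Str.sat_ball hxt, Str.tval_update hut]
      intro h1 m hm
      have := h1 m hm
      rw [update_comm (by omega)] at this ⊢
      exact h.mono S N hS hN hu _ _ _ hab this

/-! Boxed completeness -/

namespace IsModel

variable {T : Set Formula} {N : ℕ} {S : Str}

/-- Validity in all models. -/
def _root_.ModalArith.Valid (T : Set Formula) (N : ℕ) (χ : Formula) : Prop :=
  ∀ S, IsModel T N S → ∀ v, S.Sat χ v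

theorem box_valid (hS : IsModel T N S) (hT : Extends T PAK) (hN : 3 ≤ N) {χ : Formula}
    (hl : χ.Low N) (h : Valid T N χ) (v : ℕ → S.M) : S.box χ v :=
  hS.box_thm χ hl (completeness hT hN hl h) v

theorem box1 (hS : IsModel T N S) (hT : Extends T PAK) (hN : 3 ≤ N) {φ ψ : Formula}
    {v : ℕ → S.M} (h1 : S.box φ v) (hφ : φ.Low N) (hψ : ψ.Low N)
    (h : ∀ S, IsModel T N S → ∀ v, S.Sat φ v → S.Sat ψ v) : S.box ψ v :=
  hS.box_mp _ _ _ (hS.box_valid hT hN (χ := φ.imp ψ) ⟨hφ, hψ⟩ h v) h1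

theorem box2 (hS : IsModel T N S) (hT : Extends T PAK) (hN : 3 ≤ N) {φ ψ χ : Formula}
    {v : ℕ → S.M} (h1 : S.box φ v) (h2 : S.box ψ v) (hφ : φ.Low N) (hψ : ψ.Low N) (hχ : χ.Low N)
    (h : ∀ S, IsModel T N S → ∀ v, S.Sat φ v → S.Sat ψ v → S.Sat χ v) : S.box χ v :=
  hS.box_mp _ _ _ (hS.box1 hT hN (ψ := ψ.imp χ) h1 hφ ⟨hψ, hχ⟩ h) h2

theorem box_update (hS : IsModel T N S) {φ : Formula} {v : ℕ → S.M} {x : ℕ} {m : S.M}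
    (h : x ∉ φ.fv) : S.box φ (update v x m) ↔ S.box φ v := hS.sat_update (φ := .box φ) h

theorem box_ex (hS : IsModel T N S) (hT : Extends T PAK) (hN : 3 ≤ N) {x : ℕ} {φ : Formula}
    (hx : x < N) (hφ : φ.Low N) (h : ∀ v, S.Sat φ v → S.box φ v) (v : ℕ → S.M)
    (h1 : S.Sat (.ex x φ) v) : S.box (.ex x φ) v := by
  obtain ⟨m, hm⟩ := h1
  rw [← hS.box_update (x := x) (m := m) (by simp [Formula.fv])]
  refine hS.box1 hT hN (h _ hm) hφ ⟨hx, hφ⟩ ?_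
  intro S' _ v' h'
  exact ⟨v' x, by simpa using h'⟩

theorem box_and (hS : IsModel T N S) (hT : Extends T PAK) (hN : 3 ≤ N) {φ ψ : Formula}
    (hφ : φ.Low N) (hψ : ψ.Low N) (h : ∀ v, S.Sat φ v → S.box φ v)
    (h' : ∀ v, S.Sat ψ v → S.box ψ v) (v : ℕ → S.M) (h1 : S.Sat (.and φ ψ) v) :
    S.box (.and φ ψ) v :=
  hS.box2 hT hN (h v h1.1) (h' v h1.2) hφ hψ ⟨hφ, hψ⟩ (fun _ _ _ h h' => ⟨h, h'⟩)

theorem box_le (hS : IsModel T N S) (hT : Extends T PAK) (hN : 3 ≤ N) {K : ℕ} (hK : K + 2 ≤ N)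
    {t u : Term} (ht : t.Low K) (hu : u.Low K) (v : ℕ → S.M) (h : S.Sat (.le t u) v) :
    S.box (.le t u) v := by
  obtain ⟨c, hc⟩ := (hS.le_iff _ _).1 h
  have h1 : S.box (.eq (.add t (.var K)) u) (update v K c) := by
    refine hS.box_eq _ _ _ ?_
    simpa [Str.tval, Str.tval_update (not_fv_of_low' ht le_rfl),
      Str.tval_update (not_fv_of_low' hu le_rfl)] using hc
  have hK' : K ∉ (Formula.le t u).fv := by
    simp [Formula.fv, not_fv_of_low' ht le_rfl, not_fv_of_low' hu le_rfl]
  rw [← hS.box_update (m := c) hK']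
  have ht' : t.Low N := ht.mono (by omega)
  have hu' : u.Low N := hu.mono (by omega)
  refine hS.box1 hT hN h1 ⟨?_, hu'⟩ ⟨ht', hu'⟩ ?_
  · intro x hx
    simp only [Term.fv, Finset.mem_union, Finset.mem_singleton] at hx
    rcases hx with hx | hx
    · exact ht' x hx
    · omega
  · intro S' hS' v' h'
    exact (hS'.le_iff _ _).2 ⟨_, h'⟩

theorem box_ball (hS : IsModel T N S) (hT : Extends T PAK) (hN : 3 ≤ N) {K : ℕ} (hK : K + 2 ≤ N)
    {x : ℕ} {t : Term} {φ : Formula} (ht : t.Low K) (hx : x < K) (hxt : x ∉ t.fv) (hφ : φ.Low K)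
    (ih : ∀ v, S.Sat φ v → S.box φ v) (v : ℕ → S.M) (h : S.Sat (.ball x t φ) v) :
    S.box (.ball x t φ) v := by
  have hφN : φ.Low N := Formula.Low.mono (by omega) hφ
  have hxK : x ∉ (Term.var K).fv := by simp [Term.fv]; omega
  have hxK1 : x ∉ (Term.var (K + 1)).fv := by simp [Term.fv]; omega
  have hlK : (Formula.ball x (.var K) φ).Low N :=
    Formula.low_ball (by omega) (var_low (by omega)) hφN
  have hlK1 : (Formula.ball x (.var (K + 1)) φ).Low N :=
    Formula.low_ball (by omega) (var_low (by omega)) hφN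
  have hvK : (Term.var K).Low N := var_low (by omega)
  have hvK1 : (Term.var (K + 1)).Low N := var_low (by omega)
  have hvx : (Term.var x).Low N := var_low (by omega)
  have key : ∀ m, S.Sat (.ball x (.var K) φ) (update v K m) →
      S.box (.ball x (.var K) φ) (update v K m) := by
    refine hS.ind' _ (.imp (.ball x (.var K) φ) (.box (.ball x (.var K) φ))) ⟨hlK, hlK⟩ K
      (by omega) v (fun m => Iff.rfl) ?_ ?_
    · intro _
      have h1 : S.box (.eq (.var K) .zero) (update v K S.zero) :=
        hS.box_eq _ _ _ (by simp [Str.tval])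
      refine hS.box1 hT hN h1 ⟨hvK, by simp [Term.Low, Term.fv]⟩ hlK ?_
      intro S' hS' v' h'
      rw [Str.sat_ball hxK]
      intro m hm
      simp only [Str.Sat, Str.tval] at h' hm
      rw [h'] at hm
      exact absurd hm (hS'.not_lt_zero hN m)
    · intro m hm h1
      simp only [Str.sat_ball hxK, Str.tval, update_self] at h1 hm
      have h2 := hm fun b hb => by
        have := h1 b ((hS.lt_succ hN).2 (Or.inl hb))
        rw [update_comm (by omega), hS.sat_update (not_fv_of_low hφ le_rfl)] at this ⊢
        exact this
      have h3 := h1 m (hS.lt_self_succ m)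
      rw [update_comm (by omega), hS.sat_update (not_fv_of_low hφ le_rfl)] at h3
      have h4 := ih _ h3
      -- move the bound to the variable `K + 1`
      have h5 : S.box (.ball x (.var (K + 1)) φ) (update (update v K m) (K + 1) m) := by
        refine hS.box2 hT hN (φ := .eq (.var K) (.var (K + 1))) (ψ := .ball x (.var K) φ) (hS.box_eq _ _ _ (by simp [Str.tval])) ?_ ⟨hvK, hvK1⟩ hlK hlK1 ?_
        rotate_right
        · intro S' hS' v' h' h''
          rw [Str.sat_ball hxK] at h''
          rw [Str.sat_ball hxK1]
          simp only [Str.Sat, Str.tval] at h' h'' ⊢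
          rwa [h'] at h''
        · rw [hS.box_update]
          · exact h2
          · rw [Formula.fv_ball hxK]
            have := not_fv_of_low hφ (Nat.le_succ K)
            simp [Term.fv]; tauto
      have hfK : K ∉ (Formula.ball x (.var (K + 1)) φ).fv := by
        rw [Formula.fv_ball hxK1]
        have := not_fv_of_low hφ le_rfl
        simp [Term.fv]; tauto
      rw [update_comm (by omega), hS.box_update hfK, ← hS.box_update (m := S.succ m) hfK] at h5
      -- the new instance
      have h6 : S.box (.all x (.imp (.eq (.var x) (.var (K + 1))) φ))
          (update (update v x m) (K + 1) m) := by
        refine hS.box2 hT hN (φ := .eq (.var x) (.var (K + 1))) (ψ := φ) (hS.box_eq _ _ _ ?_) ?_ ⟨hvx, hvK1⟩ hφN ⟨by omega, ⟨hvx, hvK1⟩, hφN⟩ ?_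
        rotate_right
        · intro S' hS' v' h' h'' b hb
          simp only [Str.Sat, Str.tval, update_self] at h' hb
          rw [update_of_ne (by omega)] at hb
          rw [hb, ← h', update_eq_self]
          exact h''
        · simp only [Str.tval]
          rw [update_of_ne (by omega)]; simp
        · rw [hS.box_update (not_fv_of_low hφ (Nat.le_succ K))]
          exact h4
      have hfx : x ∉ (Formula.all x (.imp (.eq (.var x) (.var (K + 1))) φ)).fv := by
        simp [Formula.fv]
      have hfK' : K ∉ (Formula.all x (.imp (.eq (.var x) (.var (K + 1))) φ)).fv := by
        have := not_fv_of_low hφ le_rfl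
        simp [Formula.fv, Term.fv]; tauto
      rw [update_comm (by omega), hS.box_update hfx, ← hS.box_update (m := S.succ m) hfK'] at h6
      -- combine
      have h7 : S.box (.imp (.all x (.imp (.eq (.var x) (.var (K + 1))) φ))
          (.ball x (.var K) φ)) (update (update v (K + 1) m) K (S.succ m)) := by
        refine hS.box2 hT hN (φ := .eq (.var K) (.succ (.var (K + 1)))) (ψ := .ball x (.var (K + 1)) φ) (hS.box_eq _ _ _ ?_) h5 ⟨hvK, hvK1⟩ hlK1 ⟨⟨by omega, ⟨hvx, hvK1⟩, hφN⟩, hlK⟩ ?_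
        rotate_right
        · intro S' hS' v' h' h'' h''' 
          rw [Str.sat_ball hxK1] at h''
          rw [Str.sat_ball hxK]
          simp only [Str.Sat, Str.tval, update_self] at h' h'' h''' ⊢
          rw [h']
          intro b hb
          rcases (hS'.lt_succ hN).1 hb with hb | hb
          · exact h'' b hb
          · refine h''' b ?_
            rw [update_of_ne (by omega)]
            exact hb
        · simp only [Str.tval, update_self]
          rw [update_of_ne (by omega)]; simp
      have h8 := hS.box_mp _ _ _ h7 h6
      rw [update_comm (by omega), hS.box_update] at h8
      · exact h8
      · rw [Formula.fv_ball hxK]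
        have := not_fv_of_low hφ (Nat.le_succ K)
        simp [Term.fv]; tauto
  have h1 := key (S.tval t v) (by
    rw [Str.sat_ball hxt] at h
    rw [Str.sat_ball hxK]
    intro m hm
    rw [update_comm (by omega), hS.sat_update (not_fv_of_low hφ le_rfl)]
    exact h m (by simpa [Str.tval] using hm))
  have hfK : K ∉ (Formula.ball x t φ).fv := by
    rw [Formula.fv_ball hxt]
    have := not_fv_of_low hφ le_rfl
    have := not_fv_of_low' ht le_rfl
    simp; tauto
  rw [← hS.box_update (m := S.tval t v) hfK]
  have htN : t.Low N := ht.mono (by omega)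
  refine hS.box2 hT hN (φ := .eq (.var K) t) (ψ := .ball x (.var K) φ) (hS.box_eq _ _ _ ?_) h1 ⟨hvK, htN⟩ hlK (Formula.low_ball (by omega) htN hφN) ?_
  rotate_right
  · intro S' hS' v' h' h''
    rw [Str.sat_ball hxK] at h''
    rw [Str.sat_ball hxt]
    simp only [Str.Sat, Str.tval] at h' h'' ⊢
    rwa [h'] at h''
  · simp [Str.tval, Str.tval_update (not_fv_of_low' ht le_rfl)]

theorem box_delta0 (hS : IsModel T N S) (hT : Extends T PAK) (hN : 3 ≤ N) {K : ℕ} (hK : K + 2 ≤ N)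
    {φ : Formula} (h : IsDelta0 φ) (hl : φ.Low K) :
    ∀ v, (S.Sat φ v → S.box φ v) ∧ (¬ S.Sat φ v → S.box φ.neg v) := by
  have hlN : ∀ {φ : Formula}, φ.Low K → φ.Low N := fun h => Formula.Low.mono (by omega) h
  have htN : ∀ {t : Term}, t.Low K → t.Low N := fun h => h.mono (by omega)
  induction h with
  | falsum =>
    intro v
    refine ⟨False.elim, fun _ => hS.box_valid hT hN (χ := .neg .falsum) trivial ?_ v⟩
    intro S' _ v' h; exact h
  | eq t u =>
    intro v
    refine ⟨hS.box_eq _ _ _, fun h => ?_⟩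
    have h1 : S.lt (S.tval t v) (S.tval u v) ∨ S.lt (S.tval u v) (S.tval t v) := by
      rcases hS.lt_or_le hN (S.tval t v) (S.tval u v) with h1 | h1
      · exact Or.inl h1
      · rcases (hS.le_iff_lt_or_eq hN).1 h1 with h2 | h2
        · exact Or.inr h2
        · exact absurd h2.symm h
    rcases h1 with h1 | h1
    · refine hS.box1 hT hN (φ := .le (.succ t) u) (hS.box_le hT hN hK (t := .succ t) hl.1 hl.2 v h1) (hlN hl) (hlN hl) ?_
      intro S' hS' v' h' h''
      simp only [Str.Sat, Str.tval] at h' h''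
      rw [h''] at h'
      exact hS'.lt_irrefl hN _ h'
    · refine hS.box1 hT hN (φ := .le (.succ u) t) (hS.box_le hT hN hK (t := .succ u) hl.2 hl.1 v h1) (hlN ⟨hl.2, hl.1⟩) (hlN hl) ?_
      intro S' hS' v' h' h''
      simp only [Str.Sat, Str.tval] at h' h''
      rw [h''] at h'
      exact hS'.lt_irrefl hN _ h'
  | le t u =>
    intro v
    refine ⟨hS.box_le hT hN hK hl.1 hl.2 v, fun h => ?_⟩
    have h1 := (hS.lt_or_le hN (S.tval u v) (S.tval t v)).resolve_right h
    refine hS.box1 hT hN (φ := .le (.succ u) t) (hS.box_le hT hN hK (t := .succ u) hl.2 hl.1 v h1) (hlN ⟨hl.2, hl.1⟩) (hlN hl) ?_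
    intro S' hS' v' h' h''
    exact hS'.lt_irrefl hN _ (hS'.lt_of_lt_of_le hN h' h'')
  | and _ _ ih1 ih2 =>
    intro v
    refine ⟨fun h => hS.box2 hT hN ((ih1 hl.1 v).1 h.1) ((ih2 hl.2 v).1 h.2) (hlN hl.1) (hlN hl.2) (hlN hl) (fun _ _ _ h h' => ⟨h, h'⟩), fun h => ?_⟩
    rcases not_and_or.1 h with h | h
    · exact hS.box1 hT hN ((ih1 hl.1 v).2 h) (hlN hl.1) (hlN hl) (fun _ _ _ h h' => h h'.1)
    · exact hS.box1 hT hN ((ih2 hl.2 v).2 h) (hlN hl.2) (hlN hl) (fun _ _ _ h h' => h h'.2)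
  | or _ _ ih1 ih2 =>
    intro v
    refine ⟨fun h => ?_, fun h => ?_⟩
    · rcases h with h | h
      · exact hS.box1 hT hN ((ih1 hl.1 v).1 h) (hlN hl.1) (hlN hl) (fun _ _ _ h => Or.inl h)
      · exact hS.box1 hT hN ((ih2 hl.2 v).1 h) (hlN hl.2) (hlN hl) (fun _ _ _ h => Or.inr h)
    · obtain ⟨h1, h2⟩ := not_or.1 h
      exact hS.box2 hT hN (φ := .neg _) (ψ := .neg _) ((ih1 hl.1 v).2 h1) ((ih2 hl.2 v).2 h2) (hlN hl.1) (hlN hl.2) (hlN hl) (fun _ _ _ h h' => not_or.2 ⟨h, h'⟩)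
  | @imp φ₁ _ _ _ ih1 ih2 =>
    intro v
    refine ⟨fun h => ?_, fun h => ?_⟩
    · by_cases h1 : S.Sat φ₁ v
      · exact hS.box1 hT hN ((ih2 hl.2 v).1 (h h1)) (hlN hl.2) (hlN hl) (fun _ _ _ h _ => h)
      · exact hS.box1 hT hN ((ih1 hl.1 v).2 h1) (hlN hl.1) (hlN hl) (fun _ _ _ h h' => absurd h' h)
    · obtain ⟨h1, h2⟩ := Classical.not_imp.1 h
      exact hS.box2 hT hN (ψ := .neg _) ((ih1 hl.1 v).1 h1) ((ih2 hl.2 v).2 h2) (hlN hl.1) (hlN hl.2) (hlN hl) (fun _ _ _ h h' => fun h'' => h' (h'' h))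
  | neg _ ih =>
    intro v
    refine ⟨(ih hl v).2, fun h => ?_⟩
    exact hS.box1 hT hN ((ih hl v).1 (not_not.1 h)) (hlN hl) (hlN hl) (fun _ _ _ h h' => h' h)
  | @ball x t φ hxt _ ih =>
    intro v
    have hφ : φ.Low K := hl.2.2
    have ht : t.Low K := hl.2.1.2
    have hx : x < K := hl.1
    refine ⟨hS.box_ball hT hN hK ht hx hxt hφ (fun v => (ih hφ v).1) v, fun h => ?_⟩
    rw [Str.sat_ball hxt] at h
    push Not at h
    obtain ⟨m, hm, h⟩ := h
    have h1 := hS.box_le hT hN hK (t := .succ (.var x)) (u := t) (var_low hx) ht (update v x m)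
      (by simpa [Str.Sat, Str.tval, Str.tval_update hxt, Str.lt] using hm)
    rw [← hS.box_update (x := x) (m := m) (by simp [Formula.ball, Formula.fv])]
    refine hS.box2 hT hN (φ := .le (.succ (.var x)) t) (ψ := .neg φ) h1 ((ih hφ _).2 h) ⟨htN (t := .var x) (var_low hx), htN ht⟩ (hlN hφ) (hlN hl) ?_
    intro S' hS' v' h' h'' h'''
    have := h''' (v' x)
    rw [update_eq_self] at this
    exact h'' (this h')
  | @bex x t φ hxt _ ih =>
    intro v
    have hφ : φ.Low K := hl.2.2
    have ht : t.Low K := hl.2.1.2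
    have hx : x < K := hl.1
    refine ⟨fun h => ?_, fun h => ?_⟩
    · rw [Str.sat_bex hxt] at h
      obtain ⟨m, hm, h⟩ := h
      have h1 := hS.box_le hT hN hK (t := .succ (.var x)) (u := t) (var_low hx) ht (update v x m)
        (by simpa [Str.Sat, Str.tval, Str.tval_update hxt, Str.lt] using hm)
      rw [← hS.box_update (x := x) (m := m) (by simp [Formula.bex, Formula.fv])]
      refine hS.box2 hT hN (φ := .le (.succ (.var x)) t) (ψ := φ) h1 ((ih hφ _).1 h) ⟨htN (t := .var x) (var_low hx), htN ht⟩ (hlN hφ) (hlN hl) ?_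
      intro S' hS' v' h' h''
      refine ⟨v' x, ?_⟩
      rw [update_eq_self]
      exact ⟨h', h''⟩
    · have h1 := hS.box_ball hT hN hK (φ := .neg φ) ht hx hxt hφ (fun v h => (ih hφ v).2 h) v (by
        rw [Str.sat_ball hxt]
        rw [Str.sat_bex hxt] at h
        exact fun m hm h' => h ⟨m, hm, h'⟩)
      refine hS.box1 hT hN h1 (hlN (φ := .ball x t φ.neg) ⟨hx, ⟨var_low hx, ht⟩, hφ⟩) (hlN hl) ?_
      intro S' hS' v' h'
      simp only [Str.Sat]
      rw [Str.sat_ball hxt] at h'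
      rw [Str.sat_bex hxt]
      exact fun ⟨m, hm, h''⟩ => h' m hm h''

end IsModel

end ModalArith

namespace ModalArith
open Function

/-! ### Part 6: partial recursive graphs are Σ₁-definable -/

/-- The relation `R` on valuations is Σ₁-definable. -/
def S1 (R : (ℕ → ℕ) → Prop) : Prop := ∃ φ, IsSigma1 φ ∧ ∀ v, φ.val v ↔ R v

namespace S1

theorem congr {R R' : (ℕ → ℕ) → Prop} (h : S1 R) (h' : ∀ v, R v ↔ R' v) : S1 R' := by
  obtain ⟨φ, h1, h2⟩ := h
  exact ⟨φ, h1, fun v => (h2 v).trans (h' v)⟩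

theorem and {R R' : (ℕ → ℕ) → Prop} (h : S1 R) (h' : S1 R') : S1 fun v => R v ∧ R' v := by
  obtain ⟨φ, h1, h2⟩ := h
  obtain ⟨ψ, h3, h4⟩ := h'
  exact ⟨φ.and ψ, h1.and h3, fun v => and_congr (h2 v) (h4 v)⟩

theorem or {R R' : (ℕ → ℕ) → Prop} (h : S1 R) (h' : S1 R') : S1 fun v => R v ∨ R' v := by
  obtain ⟨φ, h1, h2⟩ := h
  obtain ⟨ψ, h3, h4⟩ := h'
  exact ⟨φ.or ψ, h1.or h3, fun v => or_congr (h2 v) (h4 v)⟩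

theorem ex {R : (ℕ → ℕ) → Prop} (k : ℕ) (h : S1 R) : S1 fun v => ∃ m, R (update v k m) := by
  obtain ⟨φ, h1, h2⟩ := h
  exact ⟨φ.ex k, h1.ex, fun v => exists_congr fun m => h2 _⟩

theorem ball {R : (ℕ → ℕ) → Prop} (x y : ℕ) (hxy : x ≠ y) (h : S1 R) :
    S1 fun v => ∀ m < v y, R (update v x m) := by
  obtain ⟨φ, h1, h2⟩ := h
  have hx : x ∉ (Term.var y).fv := by simpa [Term.fv] using hxy
  refine ⟨φ.ball x (.var y), .ball hx h1, fun v => ?_⟩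
  rw [Formula.val_ball hx]
  simp only [h2, Term.val]

theorem eq (t u : Term) : S1 fun v => t.val v = u.val v :=
  ⟨.eq t u, .delta0 (.eq t u), fun _ => Iff.rfl⟩

theorem le (t u : Term) : S1 fun v => t.val v ≤ u.val v :=
  ⟨.le t u, .delta0 (.le t u), fun _ => Iff.rfl⟩

theorem lt (t u : Term) : S1 fun v => t.val v < u.val v := le (.succ t) u

theorem pair (i j k : ℕ) : S1 fun v => v k = Nat.pair (v i) (v j) := by
  refine (((lt (.var i) (.var j)).and
    (eq (.var k) (.add (.mul (.var j) (.var j)) (.var i)))).or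
    ((le (.var j) (.var i)).and
    (eq (.var k) (.add (.add (.mul (.var i) (.var i)) (.var i)) (.var j))))).congr fun v => ?_
  simp only [Term.val, Nat.pair]
  split_ifs with h
  · simp [h, Nat.not_le.2 h]
  · simp [h, Nat.not_lt.1 h]

theorem beta (b y k : ℕ) : S1 fun v => v k = Nat.beta (v b) (v y) := by
  let p := b + y + k + 1
  have h1 := pair p (p + 1) b
  have h2 := eq (.var p) (.add (.mul (.var (p + 2))
    (.succ (.mul (.succ (.var y)) (.var (p + 1))))) (.var k))
  have h3 := lt (.var k) (.succ (.mul (.succ (.var y)) (.var (p + 1))))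
  refine ((h1.and (h2.and h3)).ex (p + 2) |>.ex (p + 1) |>.ex p).congr fun v => ?_
  have e1 : p ≠ b := by omega
  have e2 : p ≠ y := by omega
  have e3 : p ≠ k := by omega
  have e4 : p + 1 ≠ b := by omega
  have e5 : p + 1 ≠ y := by omega
  have e6 : p + 1 ≠ k := by omega
  have e7 : p + 2 ≠ b := by omega
  have e8 : p + 2 ≠ y := by omega
  have e9 : p + 2 ≠ k := by omega
  simp only [Term.val, update_self, update_of_ne, ne_eq, e1.symm, e2.symm, e3.symm, e4.symm,
    e5.symm, e6.symm, e7.symm, e8.symm, e9.symm, not_false_eq_true, Nat.succ_ne_self,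
    Nat.add_left_cancel_iff, show ¬ p + 1 = p by omega, show ¬ p = p + 1 by omega,
    show ¬ p = p + 2 by omega, show ¬ 1 = 2 by omega]
  constructor
  · rintro ⟨P, Q, R, h, h', h''⟩
    rw [h, Nat.beta, Nat.unpair_pair]
    simp only [h']
    rw [Nat.mul_add_mod', Nat.mod_eq_of_lt h'']
  · intro h
    refine ⟨(v b).unpair.1, (v b).unpair.2, (v b).unpair.1 / ((v y + 1) * (v b).unpair.2 + 1),
      (Nat.pair_unpair _).symm, ?_, ?_⟩
    · rw [h, Nat.beta, Nat.div_add_mod']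
    · rw [h, Nat.beta]
      exact Nat.mod_lt _ (Nat.succ_pos _)

/-- The graph of `f`, read off any two variables, is Σ₁-definable. -/
def Graph (f : ℕ →. ℕ) : Prop := ∀ i j, S1 fun v => v j ∈ f (v i)

theorem graph_left : Graph (fun n : ℕ => (n.unpair.1 : Part ℕ)) := by
  intro i j
  obtain ⟨k, hi, hj⟩ : ∃ k, i < k ∧ j < k := ⟨i + j + 1, by omega, by omega⟩
  refine ((pair j k i).ex k).congr fun v => ?_
  simp (disch := omega) only [update_of_ne, update_self]
  constructor
  · rintro ⟨m, h⟩; rw [h]; simp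
  · intro h; exact ⟨(v i).unpair.2, by rw [Part.mem_some_iff.1 h]; simp⟩

theorem graph_right : Graph (fun n : ℕ => (n.unpair.2 : Part ℕ)) := by
  intro i j
  obtain ⟨k, hi, hj⟩ : ∃ k, i < k ∧ j < k := ⟨i + j + 1, by omega, by omega⟩
  refine ((pair k j i).ex k).congr fun v => ?_
  simp (disch := omega) only [update_of_ne, update_self]
  constructor
  · rintro ⟨m, h⟩; rw [h]; simp
  · intro h; exact ⟨(v i).unpair.1, by rw [Part.mem_some_iff.1 h]; simp⟩

theorem mem_prec {f g : ℕ →. ℕ} {a n x : ℕ} :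
    x ∈ (n.rec (f a) fun y IH => IH.bind fun i => g (Nat.pair a (Nat.pair y i)) : Part ℕ) ↔
    ∃ b, Nat.beta b 0 ∈ f a ∧
      (∀ y < n, Nat.beta b (y + 1) ∈ g (Nat.pair a (Nat.pair y (Nat.beta b y)))) ∧
      x = Nat.beta b n := by
  constructor
  · intro h
    have key : ∀ n x, x ∈ (n.rec (f a)
        fun y IH => IH.bind fun i => g (Nat.pair a (Nat.pair y i)) : Part ℕ) →
        ∃ s : ℕ → ℕ, s 0 ∈ f a ∧ (∀ y < n, s (y + 1) ∈ g (Nat.pair a (Nat.pair y (s y)))) ∧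
          x = s n := by
      intro n
      induction n with
      | zero => intro x h; exact ⟨fun _ => x, h, by simp, rfl⟩
      | succ n ih =>
        intro x h
        obtain ⟨i, hi, h⟩ := Part.mem_bind_iff.1 h
        obtain ⟨s, h0, h1, rfl⟩ := ih i hi
        refine ⟨update s (n + 1) x, ?_, ?_, by simp⟩
        · rwa [update_of_ne (by omega)]
        · intro y hy
          rw [update_of_ne (a := y) (by omega)]
          rcases Nat.lt_succ_iff_lt_or_eq.1 hy with hy | rfl
          · rw [update_of_ne (by omega)]; exact h1 y hy
          · rw [update_self]; exact h
    obtain ⟨s, h0, h1, h2⟩ := key n x h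
    have hb : ∀ y ≤ n, Nat.beta (Nat.unbeta (List.ofFn fun i : Fin (n + 1) => s i)) y = s y := by
      intro y hy
      have := Nat.beta_unbeta_coe (List.ofFn fun i : Fin (n + 1) => s i) ⟨y, by simp; omega⟩
      simpa only [Fin.getElem_fin, List.getElem_ofFn] using this
    refine ⟨_, (hb 0 (by omega)).symm ▸ h0, ?_, (hb n le_rfl).symm ▸ h2⟩
    intro y hy
    rw [hb _ hy, hb y hy.le]
    exact h1 y hy
  · rintro ⟨b, h0, h1, rfl⟩
    induction n with
    | zero => exact h0
    | succ n ih =>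
      exact Part.mem_bind_iff.2 ⟨_, ih fun y hy => h1 y (by omega), h1 n (by omega)⟩

theorem graph {f : ℕ →. ℕ} (hf : Nat.Partrec f) : Graph f := by
  induction hf with
  | zero =>
    intro i j
    refine (eq (.var j) .zero).congr fun v => ?_
    exact Part.mem_some_iff.symm
  | succ =>
    intro i j
    refine (eq (.var j) (.succ (.var i))).congr fun v => ?_
    exact Part.mem_some_iff.symm
  | left => exact graph_left
  | right => exact graph_right
  | @pair f g _ _ hf hg =>
    intro i j
    obtain ⟨k, hi, hj⟩ : ∃ k, i < k ∧ j < k := ⟨i + j + 1, by omega, by omega⟩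
    refine ((((hf i k).and (hg i (k + 1))).and (pair k (k + 1) j)).ex (k + 1) |>.ex k).congr
      fun v => ?_
    simp (disch := omega) only [update_of_ne, update_self]
    simp only [Seq.seq, Part.mem_bind_iff, Part.map_eq_map, Part.mem_map_iff]
    constructor
    · rintro ⟨a, b, ⟨h1, h2⟩, h3⟩
      exact ⟨_, ⟨a, h1, rfl⟩, b, h2, h3.symm⟩
    · rintro ⟨_, ⟨a, h1, rfl⟩, b, h2, h3⟩
      exact ⟨a, b, ⟨h1, h2⟩, h3.symm⟩
  | @comp f g _ _ hf hg =>
    intro i j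
    obtain ⟨k, hi, hj⟩ : ∃ k, i < k ∧ j < k := ⟨i + j + 1, by omega, by omega⟩
    refine (((hg i k).and (hf k j)).ex k).congr fun v => ?_
    simp (disch := omega) only [update_of_ne, update_self]
    exact Part.mem_bind_iff.symm
  | @prec f g _ _ hf hg =>
    intro i j
    obtain ⟨k, hi, hj⟩ : ∃ k, i < k ∧ j < k := ⟨i + j + 1, by omega, by omega⟩
    -- k = a, k+1 = n, k+2 = b, k+3 = zero, k+4 = beta b 0, k+5 = y, k+6 = y+1,
    -- k+7 = beta b y, k+8 = beta b (y+1), k+9, k+10 pairs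
    have step := ((eq (.var (k + 6)) (.succ (.var (k + 5)))).and
      ((beta (k + 2) (k + 5) (k + 7)).and ((beta (k + 2) (k + 6) (k + 8)).and
      ((pair (k + 5) (k + 7) (k + 9)).and ((pair k (k + 9) (k + 10)).and
      (hg (k + 10) (k + 8))))))).ex (k + 10) |>.ex (k + 9) |>.ex (k + 8) |>.ex (k + 7)
      |>.ex (k + 6) |>.ball (k + 5) (k + 1) (by omega)
    have base := ((eq (.var (k + 3)) .zero).and ((beta (k + 2) (k + 3) (k + 4)).and
      (hf k (k + 4)))).ex (k + 4) |>.ex (k + 3)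
    refine (((pair k (k + 1) i).and (base.and (step.and (beta (k + 2) (k + 1) j)))).ex (k + 2)
      |>.ex (k + 1) |>.ex k).congr fun v => ?_
    simp (disch := omega) only [update_of_ne, update_self, Term.val, exists_and_left, exists_eq_left]
    show _ ↔ v j ∈ (Nat.rec (f (v i).unpair.1) _ (v i).unpair.2 : Part ℕ)
    refine Iff.trans ?_ mem_prec.symm
    constructor
    · rintro ⟨a, n, h, b, h1, h2, h3⟩
      rw [h, Nat.unpair_pair]
      exact ⟨b, h1, h2, h3⟩
    · rintro ⟨b, h1, h2, h3⟩
      exact ⟨_, _, (Nat.pair_unpair _).symm, b, h1, h2, h3⟩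
  | @rfind f _ hf =>
    intro i j
    obtain ⟨k, hi, hj⟩ : ∃ k, i < k ∧ j < k := ⟨i + j + 1, by omega, by omega⟩
    have step := ((pair i (k + 2) (k + 3)).and ((hf (k + 3) (k + 4)).and
      (lt .zero (.var (k + 4))))).ex (k + 4) |>.ex (k + 3) |>.ball (k + 2) j (by omega)
    have base := ((pair i j k).and ((eq (.var (k + 1)) .zero).and (hf k (k + 1)))).ex (k + 1)
      |>.ex k
    refine (base.and step).congr fun v => ?_
    simp (disch := omega) only [update_of_ne, update_self, Term.val, exists_and_left, exists_eq_left]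
    refine Iff.trans ?_ Nat.mem_rfind.symm
    simp only [Part.map_eq_map, Part.mem_map_iff, eq_comm (a := true), eq_comm (a := false),
      decide_eq_true_eq, decide_eq_false_iff_not, exists_eq_right, Nat.pos_iff_ne_zero]

theorem exists_formula {R : ℕ → Prop} (h : S1 fun v => R (v 0)) :
    ∃ φ, IsSigma1 φ ∧ φ.fv ⊆ {0} ∧ ∀ v, φ.val v ↔ R (v 0) := by
  obtain ⟨φ, h1, h2⟩ := h
  suffices H : ∀ (n : ℕ) (φ : Formula), IsSigma1 φ → (∀ v, φ.val v ↔ R (v 0)) →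
      (φ.fv.erase 0).card = n → ∃ φ, IsSigma1 φ ∧ φ.fv ⊆ {0} ∧ ∀ v, φ.val v ↔ R (v 0) from
    H _ φ h1 h2 rfl
  intro n
  induction n with
  | zero =>
    intro φ h1 h2 h3
    refine ⟨φ, h1, ?_, h2⟩
    intro x hx
    by_contra hx0
    rw [Finset.card_eq_zero] at h3
    have : x ∈ φ.fv.erase 0 := Finset.mem_erase.2 ⟨by simpa using hx0, hx⟩
    simp [h3] at this
  | succ n ih =>
    intro φ h1 h2 h3
    obtain ⟨x, hx⟩ : (φ.fv.erase 0).Nonempty := by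
      rw [← Finset.card_pos, h3]; omega
    have hx0 := (Finset.mem_erase.1 hx).1
    refine ih (.ex x φ) h1.ex (fun v => ?_) ?_
    · simp [Formula.val, h2, update_of_ne hx0.symm]
    · rw [Formula.fv, Finset.erase_right_comm, Finset.card_erase_of_mem hx, h3]; rfl

end S1

/-- Halting with a fixed output on the diagonal is Σ₁-definable. -/
theorem exists_diag_formula (f : ℕ →. ℕ) (hf : Nat.Partrec f) (c : ℕ) :
    ∃ φ, IsSigma1 φ ∧ φ.fv ⊆ {0} ∧ ∀ v, φ.val v ↔ c ∈ f (v 0) := by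
  refine S1.exists_formula (R := fun n => c ∈ f n) ?_
  refine (((S1.eq (.var 1) (Term.numeral c)).and (S1.graph hf 0 1)).ex 1).congr fun v => ?_
  have : ∀ n v, (Term.numeral n).val v = n := by
    intro n v; induction n <;> simp_all [Term.numeral, Term.val]
  simp [Term.val, this]

end ModalArith

namespace ModalArith
open Function

/-! ### Part 7: inductive definitions by finitely many rules are Σ₁-definable -/

/-- Patterns for coded objects. -/
inductive Pt : Type
  | v : ℕ → Pt
  | c : ℕ → Pt
  | s : Pt → Pt
  | p : Pt → Pt → Pt

namespace Pt

/-- Value of a pattern. -/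
def eval : Pt → (ℕ → ℕ) → ℕ
  | v i, w => w i
  | c n, _ => n
  | s a, w => eval a w + 1
  | p a b, w => Nat.pair (eval a w) (eval b w)

/-- A bound for the variables of a pattern. -/
def bd : Pt → ℕ
  | v i => i + 1
  | c _ => 0
  | s a => bd a
  | p a b => bd a + bd b

theorem eval_congr {e : Pt} {w w' : ℕ → ℕ} (h : ∀ i < e.bd, w i = w' i) :
    e.eval w = e.eval w' := by
  induction e with
  | v i => exact h i (by simp [bd])
  | c n => rfl
  | s a ih => simp only [eval, ih h]
  | p a b iha ihb =>
    simp only [eval, iha fun i hi => h i (by simp only [bd]; omega),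
      ihb fun i hi => h i (by simp only [bd]; omega)]

theorem eval_update {e : Pt} {w : ℕ → ℕ} {k m : ℕ} (h : e.bd ≤ k) :
    e.eval (update w k m) = e.eval w :=
  eval_congr fun i hi => update_of_ne (by omega) _ _

theorem s1 (e : Pt) : ∀ k, S1 fun w => w k = e.eval w := by
  induction e with
  | v i => exact fun k => S1.eq (.var k) (.var i)
  | c n =>
    intro k
    refine (S1.eq (.var k) (Term.numeral n)).congr fun v => ?_
    have : ∀ n, (Term.numeral n).val v = n := by
      intro n; induction n <;> simp_all [Term.numeral, Term.val]
    simp [Term.val, this, eval]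
  | s a ih =>
    intro k
    obtain ⟨m, h1, h2⟩ : ∃ m, a.bd ≤ m ∧ k < m := ⟨a.bd + k + 1, by omega, by omega⟩
    refine (((ih m).and (S1.eq (.var k) (.succ (.var m)))).ex m).congr fun v => ?_
    simp (disch := omega) only [update_self, update_of_ne, Term.val, eval_update h1, eval,
      exists_eq_left]
  | p a b iha ihb =>
    intro k
    obtain ⟨m, h1, h2, h3⟩ : ∃ m, a.bd ≤ m ∧ b.bd ≤ m ∧ k < m :=
      ⟨a.bd + b.bd + k + 1, by omega, by omega, by omega⟩
    refine (((iha m).and ((ihb (m + 1)).and (S1.pair m (m + 1) k))).ex (m + 1)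
      |>.ex m).congr fun v => ?_
    simp (disch := omega) only [update_self, update_of_ne, eval_update, eval, exists_and_left,
      exists_eq_left]

end Pt

/-- A Σ₁-definable set of numbers. -/
def S1P (P : ℕ → Prop) : Prop := ∀ k, S1 fun w => P (w k)

theorem S1P.pt {P : ℕ → Prop} (h : S1P P) (e : Pt) : S1 fun w => P (e.eval w) := by
  obtain ⟨m, h1⟩ : ∃ m, e.bd ≤ m := ⟨_, le_rfl⟩
  refine (((e.s1 m).and (h m)).ex m).congr fun v => ?_
  simp only [update_self, Pt.eval_update h1, exists_eq_left]

theorem S1P.congr {P Q : ℕ → Prop} (h : S1P P) (h' : ∀ n, P n ↔ Q n) : S1P Q :=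
  fun k => (h k).congr fun _ => h' _

namespace S1

theorem tt : S1 fun _ => True := (eq .zero .zero).congr fun _ => by simp

theorem ff : S1 fun _ => False := (lt .zero .zero).congr fun _ => by simp

theorem list_all {α : Type _} (l : List α) (F : α → (ℕ → ℕ) → Prop)
    (h : ∀ a ∈ l, S1 (F a)) : S1 fun w => ∀ a ∈ l, F a w := by
  induction l with
  | nil => exact tt.congr fun w => by simp
  | cons a l ih =>
    refine ((h a (by simp)).and (ih fun b hb => h b (by simp [hb]))).congr fun w => by simp

theorem list_ex {α : Type _} (l : List α) (F : α → (ℕ → ℕ) → Prop)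
    (h : ∀ a ∈ l, S1 (F a)) : S1 fun w => ∃ a ∈ l, F a w := by
  induction l with
  | nil => exact ff.congr fun w => by simp
  | cons a l ih =>
    refine ((h a (by simp)).or (ih fun b hb => h b (by simp [hb]))).congr fun w => by simp

theorem exN {R : (ℕ → ℕ) → Prop} (h : S1 R) (m : ℕ) :
    S1 fun v => ∃ w : ℕ → ℕ, R fun k => if k < m then w k else v k := by
  induction m with
  | zero => exact h.congr fun v => by simp
  | succ m ih =>
    refine (ih.ex m).congr fun v => ?_
    constructor
    · rintro ⟨a, w, h⟩
      refine ⟨update w m a, ?_⟩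
      convert h using 2 with k
      simp only [update_apply]
      split_ifs <;> first | rfl | omega
    · rintro ⟨w, h⟩
      refine ⟨w m, w, ?_⟩
      convert h using 2 with k
      simp only [update_apply]
      split_ifs <;> first | rfl | omega | (subst k; rfl)

end S1

/-- An inference rule: side conditions, premises and conclusion. -/
structure Rule where
  side : List ((ℕ → Prop) × Pt)
  prems : List Pt
  concl : Pt

/-- One step from the set `D`. -/
def Step (rules : List Rule) (D : ℕ → Prop) (n : ℕ) : Prop :=
  ∃ r ∈ rules, ∃ w, n = r.concl.eval w ∧ (∀ q ∈ r.side, q.1 (q.2.eval w)) ∧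
    ∀ e ∈ r.prems, D (e.eval w)

/-- The set inductively defined by the rules. -/
inductive Der (rules : List Rule) : ℕ → Prop
  | mk (r : Rule) (hr : r ∈ rules) (w : ℕ → ℕ) (hs : ∀ q ∈ r.side, q.1 (q.2.eval w))
      (hp : ∀ e ∈ r.prems, Der rules (e.eval w)) : Der rules (r.concl.eval w)

theorem Step.mono {rules : List Rule} {D D' : ℕ → Prop} (h : ∀ n, D n → D' n) {n : ℕ} :
    Step rules D n → Step rules D' n := by
  rintro ⟨r, hr, w, h1, h2, h3⟩
  exact ⟨r, hr, w, h1, h2, fun e he => h _ (h3 e he)⟩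

/-- `s 0, …, s (n-1)` is a derivation. -/
def Dv (rules : List Rule) (s : ℕ → ℕ) (n : ℕ) : Prop :=
  ∀ i < n, Step rules (fun x => ∃ j < i, s j = x) (s i)

theorem Dv.sound {rules : List Rule} {s : ℕ → ℕ} {n : ℕ} (h : Dv rules s n) :
    ∀ i < n, Der rules (s i) := by
  intro i
  induction i using Nat.strong_induction_on with
  | _ i ih =>
    intro hi
    obtain ⟨r, hr, w, h1, h2, h3⟩ := h i hi
    rw [h1]
    refine .mk r hr w h2 fun e he => ?_
    obtain ⟨j, hj, h4⟩ := h3 e he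
    rw [← h4]
    exact ih j hj (by omega)

theorem Dv.append {rules : List Rule} {s s' : ℕ → ℕ} {n n' : ℕ} (h : Dv rules s n)
    (h' : Dv rules s' n') : Dv rules (fun i => if i < n then s i else s' (i - n)) (n + n') := by
  intro i hi
  by_cases h1 : i < n
  · simp only [h1, if_true]
    refine (h i h1).mono ?_
    rintro x ⟨j, hj, rfl⟩
    exact ⟨j, hj, by rw [if_pos (by omega)]⟩
  · simp only [h1, if_false]
    refine (h' (i - n) (by omega)).mono ?_
    rintro x ⟨j, hj, rfl⟩
    exact ⟨n + j, by omega, by rw [if_neg (by omega)]; congr; omega⟩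

theorem Dv.list {rules : List Rule} (l : List ℕ)
    (h : ∀ x ∈ l, ∃ s n, Dv rules s n ∧ ∃ i < n, s i = x) :
    ∃ s n, Dv rules s n ∧ ∀ x ∈ l, ∃ i < n, s i = x := by
  induction l with
  | nil => exact ⟨id, 0, fun i hi => by omega, by simp⟩
  | cons a l ih =>
    obtain ⟨s, n, h1, i, hi, h2⟩ := h a (by simp)
    obtain ⟨s', n', h3, h4⟩ := ih fun x hx => h x (by simp [hx])
    refine ⟨_, _, h1.append h3, ?_⟩
    intro x hx
    rcases List.mem_cons.1 hx with rfl | hx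
    · exact ⟨i, by omega, by simp [hi, h2]⟩
    · obtain ⟨j, hj, h5⟩ := h4 x hx
      exact ⟨n + j, by omega, by simp [h5]⟩

theorem Der.complete {rules : List Rule} {n : ℕ} (h : Der rules n) :
    ∃ s m, Dv rules s m ∧ ∃ i < m, s i = n := by
  induction h with
  | mk r hr w hs hp ih =>
    obtain ⟨s, m, h1, h2⟩ := Dv.list (r.prems.map fun e => e.eval w) (by
      intro x hx
      obtain ⟨e, he, rfl⟩ := List.mem_map.1 hx
      exact ih e he)
    refine ⟨update s m (r.concl.eval w), m + 1, ?_, m, by omega, by simp⟩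
    intro i hi
    by_cases him : i = m
    · subst him
      rw [update_self]
      refine ⟨r, hr, w, rfl, hs, fun e he => ?_⟩
      obtain ⟨j, hj, h3⟩ := h2 _ (List.mem_map.2 ⟨e, he, rfl⟩)
      exact ⟨j, hj, by rw [update_of_ne (by omega), h3]⟩
    · rw [update_of_ne him]
      refine (h1 i (by omega)).mono ?_
      rintro x ⟨j, hj, rfl⟩
      exact ⟨j, hj, by rw [update_of_ne (by omega)]⟩

theorem der_iff {rules : List Rule} {n : ℕ} : Der rules n ↔
    ∃ b m, Dv rules (Nat.beta b) m ∧ ∃ i < m, n = Nat.beta b i := by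
  constructor
  · intro h
    obtain ⟨s, m, h1, i, hi, rfl⟩ := h.complete
    have hb : ∀ y < m, Nat.beta (Nat.unbeta (List.ofFn fun i : Fin m => s i)) y = s y := by
      intro y hy
      have := Nat.beta_unbeta_coe (List.ofFn fun i : Fin m => s i) ⟨y, by simpa using hy⟩
      simpa only [Fin.getElem_fin, List.getElem_ofFn] using this
    refine ⟨_, m, ?_, i, hi, (hb i hi).symm⟩
    intro j hj
    rw [hb j hj]
    refine (h1 j hj).mono ?_
    rintro x ⟨k, hk, rfl⟩
    exact ⟨k, hk, hb k (by omega)⟩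
  · rintro ⟨b, m, h, i, hi, rfl⟩
    exact h.sound i hi

theorem exists_bound (rules : List Rule) : ∃ M, ∀ r ∈ rules, r.concl.bd ≤ M ∧
    (∀ q ∈ r.side, q.2.bd ≤ M) ∧ ∀ e ∈ r.prems, e.bd ≤ M := by
  refine ⟨(rules.map fun r => r.concl.bd + (r.side.map fun q => q.2.bd).sum +
    (r.prems.map Pt.bd).sum).sum, fun r hr => ?_⟩
  have h1 := List.le_sum_of_mem (List.mem_map_of_mem (f := fun r : Rule => r.concl.bd +
    (r.side.map fun q => q.2.bd).sum + (r.prems.map Pt.bd).sum) hr)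
  refine ⟨by omega, fun q hq => ?_, fun e he => ?_⟩
  · have := List.le_sum_of_mem (List.mem_map_of_mem (f := fun q : (ℕ → Prop) × Pt => q.2.bd) hq)
    omega
  · have := List.le_sum_of_mem (List.mem_map_of_mem (f := Pt.bd) he)
    omega

theorem Der.s1p (rules : List Rule) (h : ∀ r ∈ rules, ∀ q ∈ r.side, S1P q.1) :
    S1P (Der rules) := by
  intro k
  obtain ⟨M, hM⟩ : ∃ M, k < M ∧ ∀ r ∈ rules, r.concl.bd ≤ M ∧
      (∀ q ∈ r.side, q.2.bd ≤ M) ∧ ∀ e ∈ r.prems, e.bd ≤ M := by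
    obtain ⟨M, hM⟩ := exists_bound rules
    refine ⟨M + k + 1, by omega, fun r hr => ?_⟩
    obtain ⟨h1, h2, h3⟩ := hM r hr
    exact ⟨by omega, fun q hq => (h2 q hq).trans (by omega), fun e he => (h3 e he).trans (by omega)⟩
  obtain ⟨hk, hM⟩ := hM
  -- M = b, M+1 = i, M+2 = beta b i, M+3 = j, M+4 = beta b j, M+5 = length
  have hstep : S1 fun w => Step rules (fun x => ∃ j < w (M + 1), Nat.beta (w M) j = x)
      (Nat.beta (w M) (w (M + 1))) := by
    have h1 : ∀ r ∈ rules, S1 fun w => w (M + 2) = r.concl.eval w ∧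
        (∀ q ∈ r.side, q.1 (q.2.eval w)) ∧
        ∀ e ∈ r.prems, ∃ j m, (j < w (M + 1) ∧ m = Nat.beta (w M) j) ∧ m = e.eval w := by
      intro r hr
      refine (r.concl.s1 _).and ((S1.list_all _ _ fun q hq => (h r hr q hq).pt q.2).and
        (S1.list_all _ _ fun e he => ?_))
      refine ((((S1.lt (.var (M + 3)) (.var (M + 1))).and
        (S1.beta M (M + 3) (M + 4))).and (e.s1 (M + 4))).ex (M + 4) |>.ex (M + 3)).congr
        fun w => ?_
      have := (hM r hr).2.2 e he
      simp (disch := omega) only [update_self, update_of_ne, Pt.eval_update, Term.val]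
    refine (((S1.beta M (M + 1) (M + 2)).and
      (S1.list_ex _ _ fun r hr => (h1 r hr).exN M)).ex (M + 2)).congr fun w => ?_
    simp (disch := omega) only [update_self, update_of_ne, exists_eq_left, if_neg]
    refine exists_congr fun r => and_congr_right fun hr => ?_
    obtain ⟨b1, b2, b3⟩ := hM r hr
    have ev : ∀ (e : Pt) (w' z : ℕ → ℕ), e.bd ≤ M →
        e.eval (fun k => if k < M then w' k else z k) = e.eval w' :=
      fun e w' z he => Pt.eval_congr fun i hi => if_pos (by omega)
    refine exists_congr fun w' => ?_
    rw [ev _ _ _ b1]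
    refine and_congr_right fun _ => and_congr ?_ ?_
    · refine forall₂_congr fun q hq => ?_
      rw [ev _ _ _ (b2 q hq)]
    · refine forall₂_congr fun e he => ?_
      rw [ev _ _ _ (b3 e he)]
      constructor
      · rintro ⟨j, m, ⟨hj, rfl⟩, h2⟩; exact ⟨j, hj, h2⟩
      · rintro ⟨j, hj, h2⟩; exact ⟨j, _, ⟨hj, rfl⟩, h2⟩
  have hdv := hstep.ball (M + 1) (M + 5) (by omega)
  have hlast := ((S1.lt (.var (M + 1)) (.var (M + 5))).and (S1.beta M (M + 1) k)).ex (M + 1)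
  refine ((hdv.and hlast).ex (M + 5) |>.ex M).congr fun w => ?_
  simp (disch := omega) only [update_self, update_of_ne, Term.val]
  exact der_iff.symm

theorem s1p_ne : S1P fun n => n.unpair.1 ≠ n.unpair.2 := by
  intro k
  refine (((S1.pair (k + 1) (k + 2) k).and ((S1.lt (.var (k + 1)) (.var (k + 2))).or
    (S1.lt (.var (k + 2)) (.var (k + 1))))).ex (k + 2) |>.ex (k + 1)).congr fun w => ?_
  simp (disch := omega) only [update_self, update_of_ne, Term.val]
  constructor
  · rintro ⟨a, b, h, h'⟩
    rw [h, Nat.unpair_pair]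
    exact Nat.ne_iff_lt_or_gt.2 h'
  · intro h
    exact ⟨_, _, (Nat.pair_unpair _).symm, Nat.ne_iff_lt_or_gt.1 h⟩

theorem s1p_re {P : ℕ → Prop}
    (h : Nat.Partrec fun n => Part.assert (P n) fun _ => Part.some 0) : S1P P := by
  intro k
  refine (((S1.eq (.var (k + 1)) .zero).and (S1.graph h k (k + 1))).ex (k + 1)).congr fun w => ?_
  simp (disch := omega) only [update_self, update_of_ne, Term.val, exists_eq_left]
  simp [Part.mem_assert_iff]

end ModalArith

namespace ModalArith
open Function

/-! ### Part 8: syntax and provability are Σ₁-definable -/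

/-- All side conditions hold. -/
def sideOk : List ((ℕ → Prop) × Pt) → (ℕ → ℕ) → Prop
  | [], _ => True
  | q :: l, w => q.1 (q.2.eval w) ∧ sideOk l w

/-- All premises hold. -/
def premOk (P : ℕ → Prop) : List Pt → (ℕ → ℕ) → Prop
  | [], _ => True
  | e :: l, w => P (e.eval w) ∧ premOk P l w

/-- All side conditions are definable. -/
def sideS1 : List ((ℕ → Prop) × Pt) → Prop
  | [] => True
  | q :: l => S1P q.1 ∧ sideS1 l

theorem sideOk_iff {l : List ((ℕ → Prop) × Pt)} {w : ℕ → ℕ} :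
    sideOk l w ↔ ∀ q ∈ l, q.1 (q.2.eval w) := by
  induction l with
  | nil => simp [sideOk]
  | cons q l ih => simp [sideOk, ih]

theorem sideS1_iff {l : List ((ℕ → Prop) × Pt)} : sideS1 l ↔ ∀ q ∈ l, S1P q.1 := by
  induction l with
  | nil => simp [sideS1]
  | cons q l ih => simp [sideS1, ih]

theorem premOk_iff {P : ℕ → Prop} {l : List Pt} {w : ℕ → ℕ} :
    premOk P l w ↔ ∀ e ∈ l, P (e.eval w) := by
  induction l with
  | nil => simp [premOk]
  | cons q l ih => simp [premOk, ih]

/-- The rule with the given index. -/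
def ruleAt (rules : List Rule) (i : ℕ) : Rule := rules.getD i ⟨[], [], .c 0⟩

theorem Der.at (rules : List Rule) (i : ℕ) (l : List ℕ)
    (hs : sideOk (ruleAt rules i).side fun k => l.getD k 0)
    (hp : premOk (Der rules) (ruleAt rules i).prems fun k => l.getD k 0)
    {n : ℕ} (hn : n = (ruleAt rules i).concl.eval fun k => l.getD k 0)
    (hi : Nat.blt i rules.length = true := by rfl) : Der rules n := by
  have hi' : i < rules.length := by simpa using hi
  refine hn ▸ .mk (ruleAt rules i) ?_ _ (sideOk_iff.1 hs) (premOk_iff.1 hp)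
  simp [ruleAt, hi']

theorem s1p_of_rules {rules : List Rule} {P : ℕ → Prop}
    (hs : ∀ r ∈ rules, sideS1 r.side)
    (sound : ∀ r ∈ rules, ∀ w, sideOk r.side w → premOk P r.prems w → P (r.concl.eval w))
    (complete : ∀ n, P n → Der rules n) : S1P P := by
  refine (Der.s1p rules fun r hr => sideS1_iff.1 (hs r hr)).congr fun n => ⟨?_, complete n⟩
  intro h
  induction h with
  | mk r hr w h1 h2 ih => exact sound r hr w (sideOk_iff.2 h1) (premOk_iff.2 ih)

section
open Pt

local notation "x₀" => Pt.v 0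
local notation "x₁" => Pt.v 1
local notation "x₂" => Pt.v 2
local notation "x₃" => Pt.v 3
local notation "x₄" => Pt.v 4
local notation "x₅" => Pt.v 5

/-- Two different numbers. -/
def Ne2 (n : ℕ) : Prop := ∃ a b, n = Nat.pair a b ∧ a ≠ b

theorem s1p_ne2 : S1P Ne2 := by
  refine s1p_ne.congr fun n => ⟨fun h => ⟨_, _, (Nat.pair_unpair n).symm, h⟩, ?_⟩
  rintro ⟨a, b, rfl, h⟩
  simpa using h

/-! Freshness for terms -/

/-- Codes of pairs of a variable and a term not containing it. -/
def NTm (n : ℕ) : Prop := ∃ x t, n = Nat.pair x (Term.code t) ∧ x ∉ t.fv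

/-- Rules for `NTm`. -/
def ntRules : List Rule :=
  [⟨[(Ne2, p x₀ x₁)], [], p x₀ (p (c 0) x₁)⟩,
   ⟨[], [], p x₀ (p (c 1) (c 0))⟩,
   ⟨[], [p x₀ x₁], p x₀ (p (c 2) x₁)⟩,
   ⟨[], [p x₀ x₁, p x₀ x₂], p x₀ (p (c 3) (p x₁ x₂))⟩,
   ⟨[], [p x₀ x₁, p x₀ x₂], p x₀ (p (c 4) (p x₁ x₂))⟩]

theorem s1p_ntm : S1P NTm := by
  refine s1p_of_rules (rules := ntRules) ?_ ?_ ?_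
  · simp [ntRules, sideS1, s1p_ne2]
  · intro r hr w hs hp
    simp only [ntRules, List.mem_cons, List.not_mem_nil, or_false] at hr
    rcases hr with rfl | rfl | rfl | rfl | rfl
    · obtain ⟨⟨a, b, e, h⟩, _⟩ := hs
      simp only [Pt.eval, Nat.pair_eq_pair] at e ⊢
      exact ⟨_, .var b, by rw [e.2]; rfl, by simp [Term.fv, e.1, h]⟩
    · exact ⟨_, .zero, rfl, by simp [Term.fv]⟩
    · obtain ⟨⟨x, t, e, h⟩, _⟩ := hp
      simp only [Pt.eval, Nat.pair_eq_pair] at e ⊢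
      exact ⟨x, .succ t, by rw [e.1, e.2]; rfl, h⟩
    · obtain ⟨⟨x, t, e, h⟩, ⟨x', t', e', h'⟩, _⟩ := hp
      simp only [Pt.eval, Nat.pair_eq_pair] at e e' ⊢
      exact ⟨x, .add t t', by rw [e.1, e.2, e'.2]; rfl, by simp_all [Term.fv]⟩
    · obtain ⟨⟨x, t, e, h⟩, ⟨x', t', e', h'⟩, _⟩ := hp
      simp only [Pt.eval, Nat.pair_eq_pair] at e e' ⊢
      exact ⟨x, .mul t t', by rw [e.1, e.2, e'.2]; rfl, by simp_all [Term.fv]⟩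
  · rintro n ⟨x, t, rfl, h⟩
    induction t with
    | var y =>
      exact Der.at ntRules 0 [x, y] (And.intro ⟨x, y, rfl, by simpa [Term.fv] using h⟩ trivial)
        trivial rfl
    | zero => exact Der.at ntRules 1 [x] trivial trivial rfl
    | succ t ih => exact Der.at ntRules 2 [x, t.code] trivial (And.intro (ih h) trivial) rfl
    | add t u ih1 ih2 =>
      simp only [Term.fv, Finset.mem_union, not_or] at h
      exact Der.at ntRules 3 [x, t.code, u.code] trivial
        (And.intro (ih1 h.1) (And.intro (ih2 h.2) trivial)) rfl
    | mul t u ih1 ih2 =>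
      simp only [Term.fv, Finset.mem_union, not_or] at h
      exact Der.at ntRules 4 [x, t.code, u.code] trivial
        (And.intro (ih1 h.1) (And.intro (ih2 h.2) trivial)) rfl

/-- Codes of terms. -/
def Tm (n : ℕ) : Prop := ∃ t, n = Term.code t

/-- Rules for `Tm`. -/
def tmRules : List Rule := [⟨[(NTm, p x₀ x₁)], [], x₁⟩]

theorem s1p_tm : S1P Tm := by
  refine s1p_of_rules (rules := tmRules) ?_ ?_ ?_
  · simp [tmRules, sideS1, s1p_ntm]
  · intro r hr w hs hp
    simp only [tmRules, List.mem_cons, List.not_mem_nil, or_false] at hr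
    subst hr
    obtain ⟨⟨x, t, e, h⟩, _⟩ := hs
    simp only [Pt.eval, Nat.pair_eq_pair] at e ⊢
    exact ⟨t, e.2⟩
  · rintro n ⟨t, rfl⟩
    obtain ⟨x, hx⟩ := Infinite.exists_notMem_finset t.fv
    exact Der.at tmRules 0 [x, t.code] (And.intro ⟨x, t, rfl, hx⟩ trivial) trivial rfl

/-! Freshness for formulas -/

/-- Codes of pairs of a variable and a formula in which it is not free. -/
def NFm (n : ℕ) : Prop := ∃ x φ, n = Nat.pair x (Formula.code φ) ∧ x ∉ φ.fv

/-- Rules for `NFm`. -/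
def nfRules : List Rule :=
  [⟨[], [], p x₀ (p (c 0) (c 0))⟩,
   ⟨[(NTm, p x₀ x₁), (NTm, p x₀ x₂)], [], p x₀ (p (c 1) (p x₁ x₂))⟩,
   ⟨[(NTm, p x₀ x₁), (NTm, p x₀ x₂)], [], p x₀ (p (c 2) (p x₁ x₂))⟩,
   ⟨[], [p x₀ x₁, p x₀ x₂], p x₀ (p (c 3) (p x₁ x₂))⟩,
   ⟨[], [p x₀ x₁, p x₀ x₂], p x₀ (p (c 4) (p x₁ x₂))⟩,
   ⟨[], [p x₀ x₁, p x₀ x₂], p x₀ (p (c 5) (p x₁ x₂))⟩,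
   ⟨[], [p x₀ x₁], p x₀ (p (c 6) x₁)⟩,
   ⟨[], [p x₀ x₁], p x₀ (p (c 9) x₁)⟩,
   ⟨[], [p x₀ x₁], p x₀ (p (c 7) (p x₂ x₁))⟩,
   ⟨[], [p x₀ x₁], p x₀ (p (c 8) (p x₂ x₁))⟩,
   ⟨[], [p x₂ x₁], p x₀ (p (c 7) (p x₀ x₁))⟩,
   ⟨[], [p x₂ x₁], p x₀ (p (c 8) (p x₀ x₁))⟩]

theorem s1p_nfm : S1P NFm := by
  refine s1p_of_rules (rules := nfRules) ?_ ?_ ?_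
  · simp [nfRules, sideS1, s1p_ntm]
  · intro r hr w hs hp
    simp only [nfRules, List.mem_cons, List.not_mem_nil, or_false] at hr
    rcases hr with rfl | rfl | rfl | rfl | rfl | rfl | rfl | rfl | rfl | rfl | rfl | rfl
    · exact ⟨_, .falsum, rfl, by simp [Formula.fv]⟩
    iterate 2
      obtain ⟨⟨x, t, e, h⟩, ⟨x', t', e', h'⟩, _⟩ := hs
      simp only [Pt.eval, Nat.pair_eq_pair] at e e' ⊢
      first
        | exact ⟨x, .eq t t', by rw [e.1, e.2, e'.2]; rfl, by simp_all [Formula.fv]⟩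
        | exact ⟨x, .le t t', by rw [e.1, e.2, e'.2]; rfl, by simp_all [Formula.fv]⟩
    iterate 3
      obtain ⟨⟨x, t, e, h⟩, ⟨x', t', e', h'⟩, _⟩ := hp
      simp only [Pt.eval, Nat.pair_eq_pair] at e e' ⊢
      first
        | exact ⟨x, .and t t', by rw [e.1, e.2, e'.2]; rfl, by simp_all [Formula.fv]⟩
        | exact ⟨x, .or t t', by rw [e.1, e.2, e'.2]; rfl, by simp_all [Formula.fv]⟩
        | exact ⟨x, .imp t t', by rw [e.1, e.2, e'.2]; rfl, by simp_all [Formula.fv]⟩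
    iterate 6
      obtain ⟨⟨x, t, e, h⟩, _⟩ := hp
      simp only [Pt.eval, Nat.pair_eq_pair] at e ⊢
      first
        | exact ⟨x, .neg t, by rw [e.1, e.2]; rfl, h⟩
        | exact ⟨x, .box t, by rw [e.1, e.2]; rfl, h⟩
        | exact ⟨x, .all (w 2) t, by rw [e.1, e.2]; rfl, by simp_all [Formula.fv]⟩
        | exact ⟨x, .ex (w 2) t, by rw [e.1, e.2]; rfl, by simp_all [Formula.fv]⟩
        | exact ⟨w 0, .all (w 0) t, by rw [e.2]; rfl, by simp_all [Formula.fv]⟩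
        | exact ⟨w 0, .ex (w 0) t, by rw [e.2]; rfl, by simp_all [Formula.fv]⟩
  · rintro n ⟨x, φ, rfl, h⟩
    induction φ generalizing x with
    | falsum => exact Der.at nfRules 0 [x] trivial trivial rfl
    | eq t u =>
      simp only [Formula.fv, Finset.mem_union, not_or] at h
      exact Der.at nfRules 1 [x, t.code, u.code]
        (And.intro ⟨x, t, rfl, h.1⟩ (And.intro ⟨x, u, rfl, h.2⟩ trivial)) trivial rfl
    | le t u =>
      simp only [Formula.fv, Finset.mem_union, not_or] at h
      exact Der.at nfRules 2 [x, t.code, u.code]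
        (And.intro ⟨x, t, rfl, h.1⟩ (And.intro ⟨x, u, rfl, h.2⟩ trivial)) trivial rfl
    | and t u ih1 ih2 =>
      simp only [Formula.fv, Finset.mem_union, not_or] at h
      exact Der.at nfRules 3 [x, t.code, u.code] trivial
        (And.intro (ih1 x h.1) (And.intro (ih2 x h.2) trivial)) rfl
    | or t u ih1 ih2 =>
      simp only [Formula.fv, Finset.mem_union, not_or] at h
      exact Der.at nfRules 4 [x, t.code, u.code] trivial
        (And.intro (ih1 x h.1) (And.intro (ih2 x h.2) trivial)) rfl
    | imp t u ih1 ih2 =>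
      simp only [Formula.fv, Finset.mem_union, not_or] at h
      exact Der.at nfRules 5 [x, t.code, u.code] trivial
        (And.intro (ih1 x h.1) (And.intro (ih2 x h.2) trivial)) rfl
    | neg t ih => exact Der.at nfRules 6 [x, t.code] trivial (And.intro (ih x h) trivial) rfl
    | box t ih => exact Der.at nfRules 7 [x, t.code] trivial (And.intro (ih x h) trivial) rfl
    | all y t ih =>
      by_cases hxy : x = y
      · subst hxy
        obtain ⟨z, hz⟩ := Infinite.exists_notMem_finset t.fv
        exact Der.at nfRules 10 [x, t.code, z] trivial (And.intro (ih z hz) trivial) rfl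
      · simp only [Formula.fv, Finset.mem_erase, not_and] at h
        exact Der.at nfRules 8 [x, t.code, y] trivial (And.intro (ih x (h hxy)) trivial) rfl
    | ex y t ih =>
      by_cases hxy : x = y
      · subst hxy
        obtain ⟨z, hz⟩ := Infinite.exists_notMem_finset t.fv
        exact Der.at nfRules 11 [x, t.code, z] trivial (And.intro (ih z hz) trivial) rfl
      · simp only [Formula.fv, Finset.mem_erase, not_and] at h
        exact Der.at nfRules 9 [x, t.code, y] trivial (And.intro (ih x (h hxy)) trivial) rfl

/-- Codes of formulas. -/
def Fm (n : ℕ) : Prop := ∃ φ, n = Formula.code φ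

/-- Rules for `Fm`. -/
def fmRules : List Rule := [⟨[(NFm, p x₀ x₁)], [], x₁⟩]

theorem s1p_fm : S1P Fm := by
  refine s1p_of_rules (rules := fmRules) ?_ ?_ ?_
  · simp [fmRules, sideS1, s1p_nfm]
  · intro r hr w hs hp
    simp only [fmRules, List.mem_cons, List.not_mem_nil, or_false] at hr
    subst hr
    obtain ⟨⟨x, t, e, h⟩, _⟩ := hs
    simp only [Pt.eval, Nat.pair_eq_pair] at e ⊢
    exact ⟨t, e.2⟩
  · rintro n ⟨t, rfl⟩
    obtain ⟨x, hx⟩ := Infinite.exists_notMem_finset t.fv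
    exact Der.at fmRules 0 [x, t.code] (And.intro ⟨x, t, rfl, hx⟩ trivial) trivial rfl

end
end ModalArith

namespace ModalArith
open Function

/-! ### Part 9: substitution and provability -/

section
open Pt

local notation "x₀" => Pt.v 0
local notation "x₁" => Pt.v 1
local notation "x₂" => Pt.v 2
local notation "x₃" => Pt.v 3
local notation "x₄" => Pt.v 4
local notation "x₅" => Pt.v 5

/-- Graph of substitution in terms. -/
def STm (n : ℕ) : Prop := ∃ x s t u, u = Term.subst x s t ∧
  n = Nat.pair x (Nat.pair (Term.code s) (Nat.pair (Term.code t) (Term.code u)))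

/-- Rules for `STm`. -/
def stRules : List Rule :=
  [⟨[(Tm, x₁)], [], p x₀ (p x₁ (p (p (c 0) x₀) x₁))⟩,
   ⟨[(Tm, x₁), (Ne2, p x₂ x₀)], [], p x₀ (p x₁ (p (p (c 0) x₂) (p (c 0) x₂)))⟩,
   ⟨[(Tm, x₁)], [], p x₀ (p x₁ (p (p (c 1) (c 0)) (p (c 1) (c 0))))⟩,
   ⟨[], [p x₀ (p x₁ (p x₂ x₃))], p x₀ (p x₁ (p (p (c 2) x₂) (p (c 2) x₃)))⟩,
   ⟨[], [p x₀ (p x₁ (p x₂ x₃)), p x₀ (p x₁ (p x₄ x₅))],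
      p x₀ (p x₁ (p (p (c 3) (p x₂ x₄)) (p (c 3) (p x₃ x₅))))⟩,
   ⟨[], [p x₀ (p x₁ (p x₂ x₃)), p x₀ (p x₁ (p x₄ x₅))],
      p x₀ (p x₁ (p (p (c 4) (p x₂ x₄)) (p (c 4) (p x₃ x₅))))⟩]

theorem s1p_stm : S1P STm := by
  refine s1p_of_rules (rules := stRules) ?_ ?_ ?_
  · simp [stRules, sideS1, s1p_tm, s1p_ne2]
  · intro r hr w hs hp
    simp only [stRules, List.mem_cons, List.not_mem_nil, or_false] at hr
    rcases hr with rfl | rfl | rfl | rfl | rfl | rfl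
    · obtain ⟨⟨s, e⟩, _⟩ := hs
      simp only [Pt.eval] at e ⊢
      exact ⟨w 0, s, .var (w 0), s, by simp [Term.subst, Term.substAll], by rw [e]; rfl⟩
    · obtain ⟨⟨s, e⟩, ⟨y, x, e', h⟩, _⟩ := hs
      simp only [Pt.eval, Nat.pair_eq_pair] at e e' ⊢
      exact ⟨w 0, s, .var (w 2), .var (w 2), by simp_all [Term.subst, Term.substAll],
        by rw [e]; rfl⟩
    · obtain ⟨⟨s, e⟩, _⟩ := hs
      simp only [Pt.eval] at e ⊢
      exact ⟨w 0, s, .zero, .zero, rfl, by rw [e]; rfl⟩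
    · obtain ⟨⟨x, s, t, u, h, e⟩, _⟩ := hp
      simp only [Pt.eval, Nat.pair_eq_pair] at e ⊢
      obtain ⟨e0, e1, e2, e3⟩ := e
      exact ⟨x, s, .succ t, .succ u, by rw [h]; rfl, by rw [e0, e1, e2, e3]; rfl⟩
    iterate 2
      obtain ⟨⟨x, s, t, u, h, e⟩, ⟨x', s', t', u', h', e'⟩, _⟩ := hp
      simp only [Pt.eval, Nat.pair_eq_pair] at e e' ⊢
      obtain ⟨e0, e1, e2, e3⟩ := e
      obtain ⟨e0', e1', e4, e5⟩ := e'
      have hs : s' = s := Term.code_inj (e1'.symm.trans e1)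
      have hx : x' = x := e0'.symm.trans e0
      subst hs hx
      first
        | exact ⟨x', s', .add t t', .add u u', by rw [h, h']; rfl,
            by rw [e0, e1, e2, e3, e4, e5]; rfl⟩
        | exact ⟨x', s', .mul t t', .mul u u', by rw [h, h']; rfl,
            by rw [e0, e1, e2, e3, e4, e5]; rfl⟩
  · rintro n ⟨x, s, t, u, rfl, rfl⟩
    induction t with
    | var y =>
      by_cases h : y = x
      · subst h
        exact Der.at stRules 0 [y, s.code] (And.intro ⟨s, rfl⟩ trivial) trivial
          (by simp [Term.subst, Term.substAll, Term.code, ruleAt, stRules, Pt.eval])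
      · exact Der.at stRules 1 [x, s.code, y]
          (And.intro ⟨s, rfl⟩ (And.intro ⟨y, x, rfl, h⟩ trivial)) trivial
          (by simp [Term.subst, Term.substAll, Term.code, ruleAt, stRules, Pt.eval, h])
    | zero => exact Der.at stRules 2 [x, s.code] (And.intro ⟨s, rfl⟩ trivial) trivial rfl
    | succ t ih =>
      exact Der.at stRules 3 [x, s.code, t.code, (Term.subst x s t).code] trivial
        (And.intro ih trivial) rfl
    | add t u ih1 ih2 =>
      exact Der.at stRules 4 [x, s.code, t.code, (Term.subst x s t).code, u.code, (Term.subst x s u).code]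
        trivial (And.intro ih1 (And.intro ih2 trivial)) rfl
    | mul t u ih1 ih2 =>
      exact Der.at stRules 5 [x, s.code, t.code, (Term.subst x s t).code, u.code, (Term.subst x s u).code]
        trivial (And.intro ih1 (And.intro ih2 trivial)) rfl

theorem subst_all_ne {x y : ℕ} (h : y ≠ x) (s : Term) (φ : Formula) :
    (Formula.all y φ).subst x s = .all y (φ.subst x s) := by
  have : update (update Term.var x s) y (Term.var y) = update Term.var x s := by
    funext z
    by_cases hz : z = y
    · subst hz; simp [h]
    · simp [hz]
  simp [Formula.subst, Formula.substAll, this]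

theorem subst_ex_ne {x y : ℕ} (h : y ≠ x) (s : Term) (φ : Formula) :
    (Formula.ex y φ).subst x s = .ex y (φ.subst x s) := by
  have : update (update Term.var x s) y (Term.var y) = update Term.var x s := by
    funext z
    by_cases hz : z = y
    · subst hz; simp [h]
    · simp [hz]
  simp [Formula.subst, Formula.substAll, this]

theorem subst_of_notMem {x : ℕ} {φ : Formula} (h : x ∉ φ.fv) (s : Term) :
    φ.subst x s = φ := by
  refine Eq.trans ?_ φ.substAll_var
  refine Formula.substAll_congr fun z hz => update_of_ne ?_ _ _
  rintro rfl; exact h hz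

/-- Graph of correct substitution in formulas. -/
def SFm (n : ℕ) : Prop := ∃ x s φ ψ, ψ = Formula.subst x s φ ∧ φ.freeFor s x ∧
  n = Nat.pair x (Nat.pair (Term.code s) (Nat.pair (Formula.code φ) (Formula.code ψ)))

/-- Rules for `SFm`. -/
def sfRules : List Rule :=
  [⟨[(Tm, x₁)], [], p x₀ (p x₁ (p (p (c 0) (c 0)) (p (c 0) (c 0))))⟩,
   ⟨[(STm, p x₀ (p x₁ (p x₂ x₃))), (STm, p x₀ (p x₁ (p x₄ x₅)))], [],
      p x₀ (p x₁ (p (p (c 1) (p x₂ x₄)) (p (c 1) (p x₃ x₅))))⟩,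
   ⟨[(STm, p x₀ (p x₁ (p x₂ x₃))), (STm, p x₀ (p x₁ (p x₄ x₅)))], [],
      p x₀ (p x₁ (p (p (c 2) (p x₂ x₄)) (p (c 2) (p x₃ x₅))))⟩,
   ⟨[], [p x₀ (p x₁ (p x₂ x₃)), p x₀ (p x₁ (p x₄ x₅))],
      p x₀ (p x₁ (p (p (c 3) (p x₂ x₄)) (p (c 3) (p x₃ x₅))))⟩,
   ⟨[], [p x₀ (p x₁ (p x₂ x₃)), p x₀ (p x₁ (p x₄ x₅))],
      p x₀ (p x₁ (p (p (c 4) (p x₂ x₄)) (p (c 4) (p x₃ x₅))))⟩,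
   ⟨[], [p x₀ (p x₁ (p x₂ x₃)), p x₀ (p x₁ (p x₄ x₅))],
      p x₀ (p x₁ (p (p (c 5) (p x₂ x₄)) (p (c 5) (p x₃ x₅))))⟩,
   ⟨[], [p x₀ (p x₁ (p x₂ x₃))], p x₀ (p x₁ (p (p (c 6) x₂) (p (c 6) x₃)))⟩,
   ⟨[], [p x₀ (p x₁ (p x₂ x₃))], p x₀ (p x₁ (p (p (c 9) x₂) (p (c 9) x₃)))⟩,
   ⟨[(Ne2, p x₄ x₀), (NTm, p x₄ x₁)], [p x₀ (p x₁ (p x₂ x₃))],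
      p x₀ (p x₁ (p (p (c 7) (p x₄ x₂)) (p (c 7) (p x₄ x₃))))⟩,
   ⟨[(Ne2, p x₄ x₀), (NTm, p x₄ x₁)], [p x₀ (p x₁ (p x₂ x₃))],
      p x₀ (p x₁ (p (p (c 8) (p x₄ x₂)) (p (c 8) (p x₄ x₃))))⟩,
   ⟨[(Tm, x₁), (Fm, x₂)], [],
      p x₀ (p x₁ (p (p (c 7) (p x₀ x₂)) (p (c 7) (p x₀ x₂))))⟩,
   ⟨[(Tm, x₁), (Fm, x₂)], [],
      p x₀ (p x₁ (p (p (c 8) (p x₀ x₂)) (p (c 8) (p x₀ x₂))))⟩,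
   ⟨[(Tm, x₁), (NFm, p x₀ x₂)], [],
      p x₀ (p x₁ (p (p (c 7) (p x₃ x₂)) (p (c 7) (p x₃ x₂))))⟩,
   ⟨[(Tm, x₁), (NFm, p x₀ x₂)], [],
      p x₀ (p x₁ (p (p (c 8) (p x₃ x₂)) (p (c 8) (p x₃ x₂))))⟩]

theorem s1p_sfm : S1P SFm := by
  refine s1p_of_rules (rules := sfRules) ?_ ?_ ?_
  · simp [sfRules, sideS1, s1p_tm, s1p_ne2, s1p_stm, s1p_ntm, s1p_fm, s1p_nfm]
  · intro r hr w hs hp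
    simp only [sfRules, List.mem_cons, List.not_mem_nil, or_false] at hr
    rcases hr with rfl | rfl | rfl | rfl | rfl | rfl | rfl | rfl | rfl | rfl | rfl | rfl |
      rfl | rfl
    · obtain ⟨⟨s, e⟩, _⟩ := hs
      simp only [Pt.eval] at e ⊢
      exact ⟨w 0, s, .falsum, .falsum, rfl, trivial, by rw [e]; rfl⟩
    iterate 2
      obtain ⟨⟨x, s, t, u, h, e⟩, ⟨x', s', t', u', h', e'⟩, _⟩ := hs
      simp only [Pt.eval, Nat.pair_eq_pair] at e e' ⊢
      obtain ⟨e0, e1, e2, e3⟩ := e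
      obtain ⟨e0', e1', e4, e5⟩ := e'
      have hs : s' = s := Term.code_inj (e1'.symm.trans e1)
      have hx : x' = x := e0'.symm.trans e0
      subst hs hx
      first
        | exact ⟨x', s', .eq t t', .eq u u', by rw [h, h']; rfl, trivial,
            by rw [e0, e1, e2, e3, e4, e5]; rfl⟩
        | exact ⟨x', s', .le t t', .le u u', by rw [h, h']; rfl, trivial,
            by rw [e0, e1, e2, e3, e4, e5]; rfl⟩
    iterate 3
      obtain ⟨⟨x, s, t, u, h, f, e⟩, ⟨x', s', t', u', h', f', e'⟩, _⟩ := hp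
      simp only [Pt.eval, Nat.pair_eq_pair] at e e' ⊢
      obtain ⟨e0, e1, e2, e3⟩ := e
      obtain ⟨e0', e1', e4, e5⟩ := e'
      have hs : s' = s := Term.code_inj (e1'.symm.trans e1)
      have hx : x' = x := e0'.symm.trans e0
      subst hs hx
      first
        | exact ⟨x', s', .and t t', .and u u', by rw [h, h']; rfl, ⟨f, f'⟩,
            by rw [e0, e1, e2, e3, e4, e5]; rfl⟩
        | exact ⟨x', s', .or t t', .or u u', by rw [h, h']; rfl, ⟨f, f'⟩,
            by rw [e0, e1, e2, e3, e4, e5]; rfl⟩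
        | exact ⟨x', s', .imp t t', .imp u u', by rw [h, h']; rfl, ⟨f, f'⟩,
            by rw [e0, e1, e2, e3, e4, e5]; rfl⟩
    iterate 2
      obtain ⟨⟨x, s, t, u, h, f, e⟩, _⟩ := hp
      simp only [Pt.eval, Nat.pair_eq_pair] at e ⊢
      obtain ⟨e0, e1, e2, e3⟩ := e
      first
        | exact ⟨x, s, .neg t, .neg u, by rw [h]; rfl, f, by rw [e0, e1, e2, e3]; rfl⟩
        | exact ⟨x, s, .box t, .box u, by rw [h]; rfl, f, by rw [e0, e1, e2, e3]; rfl⟩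
    iterate 2
      obtain ⟨⟨x, s, t, u, h, f, e⟩, _⟩ := hp
      obtain ⟨⟨y, x', e', hne⟩, ⟨y', s', e'', hy⟩, _⟩ := hs
      simp only [Pt.eval, Nat.pair_eq_pair] at e e' e'' ⊢
      obtain ⟨e0, e1, e2, e3⟩ := e
      have hs : s' = s := Term.code_inj (e''.2.symm.trans e1)
      have hx : x' = x := e'.2.symm.trans e0
      have hyy : y' = y := e''.1.symm.trans e'.1
      subst hs hx hyy
      first
        | exact ⟨x', s', .all y' t, .all y' u, by rw [h, subst_all_ne hne],
            Or.inr (Or.inr ⟨hy, f⟩), by rw [e0, e1, e2, e3, e'.1]; rfl⟩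
        | exact ⟨x', s', .ex y' t, .ex y' u, by rw [h, subst_ex_ne hne],
            Or.inr (Or.inr ⟨hy, f⟩), by rw [e0, e1, e2, e3, e'.1]; rfl⟩
    iterate 2
      obtain ⟨⟨s, e⟩, ⟨t, e'⟩, _⟩ := hs
      simp only [Pt.eval] at e e' ⊢
      first
        | exact ⟨w 0, s, .all (w 0) t, .all (w 0) t,
            by rw [subst_of_notMem]; simp [Formula.fv], Or.inl rfl, by rw [e, e']; rfl⟩
        | exact ⟨w 0, s, .ex (w 0) t, .ex (w 0) t,
            by rw [subst_of_notMem]; simp [Formula.fv], Or.inl rfl, by rw [e, e']; rfl⟩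
    iterate 2
      obtain ⟨⟨s, e⟩, ⟨x, t, e', h⟩, _⟩ := hs
      simp only [Pt.eval, Nat.pair_eq_pair] at e e' ⊢
      first
        | exact ⟨x, s, .all (w 3) t, .all (w 3) t,
            by rw [subst_of_notMem]; simp [Formula.fv, h], Or.inr (Or.inl h),
            by rw [e, e'.1, e'.2]; rfl⟩
        | exact ⟨x, s, .ex (w 3) t, .ex (w 3) t,
            by rw [subst_of_notMem]; simp [Formula.fv, h], Or.inr (Or.inl h),
            by rw [e, e'.1, e'.2]; rfl⟩
  · rintro n ⟨x, s, φ, ψ, rfl, f, rfl⟩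
    induction φ with
    | falsum => exact Der.at sfRules 0 [x, s.code] (And.intro ⟨s, rfl⟩ trivial) trivial rfl
    | eq t u =>
      exact Der.at sfRules 1 [x, s.code, t.code, (Term.subst x s t).code, u.code, (Term.subst x s u).code]
        (And.intro ⟨x, s, t, _, rfl, rfl⟩ (And.intro ⟨x, s, u, _, rfl, rfl⟩ trivial)) trivial rfl
    | le t u =>
      exact Der.at sfRules 2 [x, s.code, t.code, (Term.subst x s t).code, u.code, (Term.subst x s u).code]
        (And.intro ⟨x, s, t, _, rfl, rfl⟩ (And.intro ⟨x, s, u, _, rfl, rfl⟩ trivial)) trivial rfl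
    | and t u ih1 ih2 =>
      exact Der.at sfRules 3 [x, s.code, t.code, (t.subst x s).code, u.code, (u.subst x s).code]
        trivial (And.intro (ih1 f.1) (And.intro (ih2 f.2) trivial)) rfl
    | or t u ih1 ih2 =>
      exact Der.at sfRules 4 [x, s.code, t.code, (t.subst x s).code, u.code, (u.subst x s).code]
        trivial (And.intro (ih1 f.1) (And.intro (ih2 f.2) trivial)) rfl
    | imp t u ih1 ih2 =>
      exact Der.at sfRules 5 [x, s.code, t.code, (t.subst x s).code, u.code, (u.subst x s).code]
        trivial (And.intro (ih1 f.1) (And.intro (ih2 f.2) trivial)) rfl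
    | neg t ih =>
      exact Der.at sfRules 6 [x, s.code, t.code, (t.subst x s).code] trivial
        (And.intro (ih f) trivial) rfl
    | box t ih =>
      exact Der.at sfRules 7 [x, s.code, t.code, (t.subst x s).code] trivial
        (And.intro (ih f) trivial) rfl
    | all y t ih =>
      by_cases hxy : y = x
      · subst hxy
        rw [subst_of_notMem (by simp [Formula.fv])]
        exact Der.at sfRules 10 [y, s.code, t.code]
          (And.intro ⟨s, rfl⟩ (And.intro ⟨t, rfl⟩ trivial)) trivial rfl
      · rcases f with f | f | ⟨f, g⟩
        · exact (hxy f.symm).elim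
        · rw [subst_of_notMem (by simp [Formula.fv, f])]
          exact Der.at sfRules 12 [x, s.code, t.code, y]
            (And.intro ⟨s, rfl⟩ (And.intro ⟨x, t, rfl, f⟩ trivial)) trivial rfl
        · rw [subst_all_ne hxy]
          exact Der.at sfRules 8 [x, s.code, t.code, (t.subst x s).code, y]
            (And.intro ⟨y, x, rfl, hxy⟩ (And.intro ⟨y, s, rfl, f⟩ trivial))
            (And.intro (ih g) trivial) rfl
    | ex y t ih =>
      by_cases hxy : y = x
      · subst hxy
        rw [subst_of_notMem (by simp [Formula.fv])]
        exact Der.at sfRules 11 [y, s.code, t.code]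
          (And.intro ⟨s, rfl⟩ (And.intro ⟨t, rfl⟩ trivial)) trivial rfl
      · rcases f with f | f | ⟨f, g⟩
        · exact (hxy f.symm).elim
        · rw [subst_of_notMem (by simp [Formula.fv, f])]
          exact Der.at sfRules 13 [x, s.code, t.code, y]
            (And.intro ⟨s, rfl⟩ (And.intro ⟨x, t, rfl, f⟩ trivial)) trivial rfl
        · rw [subst_ex_ne hxy]
          exact Der.at sfRules 9 [x, s.code, t.code, (t.subst x s).code, y]
            (And.intro ⟨y, x, rfl, hxy⟩ (And.intro ⟨y, s, rfl, f⟩ trivial))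
            (And.intro (ih g) trivial) rfl

end
end ModalArith

namespace ModalArith
open Function

/-! ### Part 10: provability is Σ₁-definable -/

section
open Pt

attribute [local irreducible] Nat.pair

local notation "x₀" => Pt.v 0
local notation "x₁" => Pt.v 1
local notation "x₂" => Pt.v 2
local notation "x₃" => Pt.v 3

/-- Pattern for implications. -/
abbrev pImp (a b : Pt) : Pt := p (c 5) (p a b)
/-- Pattern for conjunctions. -/
abbrev pAnd (a b : Pt) : Pt := p (c 3) (p a b)
/-- Pattern for disjunctions. -/
abbrev pOr (a b : Pt) : Pt := p (c 4) (p a b)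
/-- Pattern for negations. -/
abbrev pNeg (a : Pt) : Pt := p (c 6) a
/-- Pattern for falsum. -/
abbrev pBot : Pt := p (c 0) (c 0)
/-- Pattern for universal quantification. -/
abbrev pAll (x a : Pt) : Pt := p (c 7) (p x a)
/-- Pattern for existential quantification. -/
abbrev pEx (x a : Pt) : Pt := p (c 8) (p x a)
/-- Pattern for equations. -/
abbrev pEq (a b : Pt) : Pt := p (c 1) (p a b)
/-- Pattern for inequalities. -/
abbrev pLe (a b : Pt) : Pt := p (c 2) (p a b)

/-- Codes of logical axioms. -/
def LAx (n : ℕ) : Prop := ∃ φ, LogicalAxiom φ ∧ n = Formula.code φ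

/-- Rules for propositional axioms with one or two parameters and equality axioms. -/
def laRules : List Rule :=
  [ -- one formula
   ⟨[(Fm, x₀)], [], pImp (pNeg (pNeg x₀)) x₀⟩,
   ⟨[(Fm, x₀)], [], pImp pBot x₀⟩,
   ⟨[(Fm, x₀)], [], pImp (pImp x₀ pBot) (pNeg x₀)⟩,
   ⟨[(Fm, x₀)], [], pImp (pNeg x₀) (pImp x₀ pBot)⟩,
   -- two formulas
   ⟨[(Fm, x₀), (Fm, x₁)], [], pImp x₀ (pImp x₁ x₀)⟩,
   ⟨[(Fm, x₀), (Fm, x₁)], [], pImp (pImp x₀ x₁) (pImp (pImp x₀ (pNeg x₁)) (pNeg x₀))⟩,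
   ⟨[(Fm, x₀), (Fm, x₁)], [], pImp (pNeg x₀) (pImp x₀ x₁)⟩,
   ⟨[(Fm, x₀), (Fm, x₁)], [], pImp x₀ (pImp x₁ (pAnd x₀ x₁))⟩,
   ⟨[(Fm, x₀), (Fm, x₁)], [], pImp (pAnd x₀ x₁) x₀⟩,
   ⟨[(Fm, x₀), (Fm, x₁)], [], pImp (pAnd x₀ x₁) x₁⟩,
   ⟨[(Fm, x₀), (Fm, x₁)], [], pImp x₀ (pOr x₀ x₁)⟩,
   ⟨[(Fm, x₀), (Fm, x₁)], [], pImp x₁ (pOr x₀ x₁)⟩,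
   -- three formulas
   ⟨[(Fm, x₀), (Fm, x₁), (Fm, x₂)], [],
      pImp (pImp x₀ (pImp x₁ x₂)) (pImp (pImp x₀ x₁) (pImp x₀ x₂))⟩,
   ⟨[(Fm, x₀), (Fm, x₁), (Fm, x₂)], [],
      pImp (pImp x₀ x₂) (pImp (pImp x₁ x₂) (pImp (pOr x₀ x₁) x₂))⟩,
   -- quantifiers
   ⟨[(SFm, p x₀ (p x₁ (p x₂ x₃)))], [], pImp (pAll x₀ x₂) x₃⟩,
   ⟨[(SFm, p x₀ (p x₁ (p x₂ x₃)))], [], pImp x₃ (pEx x₀ x₂)⟩,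
   ⟨[(NFm, p x₀ x₁), (Fm, x₂)], [], pImp (pAll x₀ (pImp x₁ x₂)) (pImp x₁ (pAll x₀ x₂))⟩,
   ⟨[(NFm, p x₀ x₁), (Fm, x₂)], [], pImp (pAll x₀ (pImp x₂ x₁)) (pImp (pEx x₀ x₂) x₁)⟩,
   -- equality
   ⟨[(Tm, x₀)], [], pEq x₀ x₀⟩,
   ⟨[(Tm, x₀), (Tm, x₁)], [], pImp (pEq x₀ x₁) (pEq x₁ x₀)⟩,
   ⟨[(Tm, x₀), (Tm, x₁)], [], pImp (pEq x₀ x₁) (pEq (p (c 2) x₀) (p (c 2) x₁))⟩,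
   ⟨[(Tm, x₀), (Tm, x₁), (Tm, x₂)], [], pImp (pEq x₀ x₁) (pImp (pEq x₁ x₂) (pEq x₀ x₂))⟩,
   ⟨[(Tm, x₀), (Tm, x₁), (Tm, x₂), (Tm, x₃)], [], pImp (pEq x₀ x₁) (pImp (pEq x₂ x₃)
      (pEq (p (c 3) (p x₀ x₂)) (p (c 3) (p x₁ x₃))))⟩,
   ⟨[(Tm, x₀), (Tm, x₁), (Tm, x₂), (Tm, x₃)], [], pImp (pEq x₀ x₁) (pImp (pEq x₂ x₃)
      (pEq (p (c 4) (p x₀ x₂)) (p (c 4) (p x₁ x₃))))⟩,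
   ⟨[(Tm, x₀), (Tm, x₁), (Tm, x₂), (Tm, x₃)], [], pImp (pEq x₀ x₁) (pImp (pEq x₂ x₃)
      (pImp (pLe x₀ x₂) (pLe x₁ x₃)))⟩]

theorem s1p_lax : S1P LAx := by
  refine s1p_of_rules (rules := laRules) ?_ ?_ ?_
  · simp [laRules, sideS1, s1p_tm, s1p_sfm, s1p_fm, s1p_nfm]
  · intro r hr w hs hp
    simp only [laRules, List.mem_cons, List.not_mem_nil, or_false] at hr
    rcases hr with rfl | rfl | rfl | rfl | rfl | rfl | rfl | rfl | rfl | rfl | rfl | rfl |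
      rfl | rfl | rfl | rfl | rfl | rfl | rfl | rfl | rfl | rfl | rfl | rfl | rfl
    iterate 4
      obtain ⟨⟨φ, e⟩, _⟩ := hs
      simp only [Pt.eval] at e ⊢
      rw [e]
      first
        | exact ⟨_, .dne φ, rfl⟩
        | exact ⟨_, .falsumE φ, rfl⟩
        | exact ⟨_, .negIntro φ, rfl⟩
        | exact ⟨_, .negElimFalsum φ, rfl⟩
    iterate 8
      obtain ⟨⟨φ, e⟩, ⟨ψ, e'⟩, _⟩ := hs
      simp only [Pt.eval] at e e' ⊢
      rw [e, e']
      first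
        | exact ⟨_, .imp1 φ ψ, rfl⟩
        | exact ⟨_, .negI φ ψ, rfl⟩
        | exact ⟨_, .negE φ ψ, rfl⟩
        | exact ⟨_, .andI φ ψ, rfl⟩
        | exact ⟨_, .andE1 φ ψ, rfl⟩
        | exact ⟨_, .andE2 φ ψ, rfl⟩
        | exact ⟨_, .orI1 φ ψ, rfl⟩
        | exact ⟨_, .orI2 φ ψ, rfl⟩
    iterate 2
      obtain ⟨⟨φ, e⟩, ⟨ψ, e'⟩, ⟨χ, e''⟩, _⟩ := hs
      simp only [Pt.eval] at e e' e'' ⊢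
      rw [e, e', e'']
      first
        | exact ⟨_, .imp2 φ ψ χ, rfl⟩
        | exact ⟨_, .orE φ ψ χ, rfl⟩
    iterate 2
      obtain ⟨⟨x, s, φ, ψ, h, f, e⟩, _⟩ := hs
      simp only [Pt.eval, Nat.pair_eq_pair] at e ⊢
      rw [e.1, e.2.2.1, e.2.2.2, h]
      first
        | exact ⟨_, .allE x s φ f, rfl⟩
        | exact ⟨_, .exI x s φ f, rfl⟩
    iterate 2
      obtain ⟨⟨x, φ, e, h⟩, ⟨ψ, e'⟩, _⟩ := hs
      simp only [Pt.eval, Nat.pair_eq_pair] at e e' ⊢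
      rw [e.1, e.2, e']
      first
        | exact ⟨_, .allImp x φ ψ h, rfl⟩
        | exact ⟨_, .exE x ψ φ h, rfl⟩
    · obtain ⟨⟨φ, e⟩, _⟩ := hs
      simp only [Pt.eval] at e ⊢
      rw [e]
      exact ⟨_, .eqRefl φ, rfl⟩
    iterate 2
      obtain ⟨⟨φ, e⟩, ⟨ψ, e'⟩, _⟩ := hs
      simp only [Pt.eval] at e e' ⊢
      rw [e, e']
      first
        | exact ⟨_, .eqSymm φ ψ, rfl⟩
        | exact ⟨_, .eqSucc φ ψ, rfl⟩
    · obtain ⟨⟨φ, e⟩, ⟨ψ, e'⟩, ⟨χ, e''⟩, _⟩ := hs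
      simp only [Pt.eval] at e e' e'' ⊢
      rw [e, e', e'']
      exact ⟨_, .eqTrans φ ψ χ, rfl⟩
    iterate 3
      obtain ⟨⟨φ, e⟩, ⟨ψ, e'⟩, ⟨χ, e''⟩, ⟨θ, e'''⟩, _⟩ := hs
      simp only [Pt.eval] at e e' e'' e''' ⊢
      rw [e, e', e'', e''']
      first
        | exact ⟨_, .eqAdd φ ψ χ θ, rfl⟩
        | exact ⟨_, .eqMul φ ψ χ θ, rfl⟩
        | exact ⟨_, .eqLe φ ψ χ θ, rfl⟩
  · rintro n ⟨φ, h, rfl⟩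
    have F : ∀ φ : Formula, Fm φ.code := fun φ => ⟨φ, rfl⟩
    have H : ∀ t : Term, Tm t.code := fun t => ⟨t, rfl⟩
    cases h with
    | dne φ => exact Der.at laRules 0 [φ.code] ⟨F _, trivial⟩ trivial rfl
    | falsumE φ => exact Der.at laRules 1 [φ.code] ⟨F _, trivial⟩ trivial rfl
    | negIntro φ => exact Der.at laRules 2 [φ.code] ⟨F _, trivial⟩ trivial rfl
    | negElimFalsum φ => exact Der.at laRules 3 [φ.code] ⟨F _, trivial⟩ trivial rfl
    | imp1 φ ψ => exact Der.at laRules 4 [φ.code, ψ.code] ⟨F _, F _, trivial⟩ trivial rfl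
    | negI φ ψ => exact Der.at laRules 5 [φ.code, ψ.code] ⟨F _, F _, trivial⟩ trivial rfl
    | negE φ ψ => exact Der.at laRules 6 [φ.code, ψ.code] ⟨F _, F _, trivial⟩ trivial rfl
    | andI φ ψ => exact Der.at laRules 7 [φ.code, ψ.code] ⟨F _, F _, trivial⟩ trivial rfl
    | andE1 φ ψ => exact Der.at laRules 8 [φ.code, ψ.code] ⟨F _, F _, trivial⟩ trivial rfl
    | andE2 φ ψ => exact Der.at laRules 9 [φ.code, ψ.code] ⟨F _, F _, trivial⟩ trivial rfl
    | orI1 φ ψ => exact Der.at laRules 10 [φ.code, ψ.code] ⟨F _, F _, trivial⟩ trivial rfl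
    | orI2 φ ψ => exact Der.at laRules 11 [φ.code, ψ.code] ⟨F _, F _, trivial⟩ trivial rfl
    | imp2 φ ψ χ =>
      exact Der.at laRules 12 [φ.code, ψ.code, χ.code] ⟨F _, F _, F _, trivial⟩ trivial rfl
    | orE φ ψ χ =>
      exact Der.at laRules 13 [φ.code, ψ.code, χ.code] ⟨F _, F _, F _, trivial⟩ trivial rfl
    | allE x t φ h =>
      exact Der.at laRules 14 [x, t.code, φ.code, (φ.subst x t).code]
        ⟨⟨x, t, φ, _, rfl, h, rfl⟩, trivial⟩ trivial rfl
    | exI x t φ h =>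
      exact Der.at laRules 15 [x, t.code, φ.code, (φ.subst x t).code]
        ⟨⟨x, t, φ, _, rfl, h, rfl⟩, trivial⟩ trivial rfl
    | allImp x φ ψ h =>
      exact Der.at laRules 16 [x, φ.code, ψ.code] ⟨⟨x, φ, rfl, h⟩, F _, trivial⟩ trivial rfl
    | exE x φ ψ h =>
      exact Der.at laRules 17 [x, ψ.code, φ.code] ⟨⟨x, ψ, rfl, h⟩, F _, trivial⟩ trivial rfl
    | eqRefl t => exact Der.at laRules 18 [t.code] ⟨H _, trivial⟩ trivial rfl
    | eqSymm t u => exact Der.at laRules 19 [t.code, u.code] ⟨H _, H _, trivial⟩ trivial rfl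
    | eqSucc t u => exact Der.at laRules 20 [t.code, u.code] ⟨H _, H _, trivial⟩ trivial rfl
    | eqTrans t u w =>
      exact Der.at laRules 21 [t.code, u.code, w.code] ⟨H _, H _, H _, trivial⟩ trivial rfl
    | eqAdd t u w z =>
      exact Der.at laRules 22 [t.code, u.code, w.code, z.code] ⟨H _, H _, H _, H _, trivial⟩
        trivial rfl
    | eqMul t u w z =>
      exact Der.at laRules 23 [t.code, u.code, w.code, z.code] ⟨H _, H _, H _, H _, trivial⟩
        trivial rfl
    | eqLe t u w z =>
      exact Der.at laRules 24 [t.code, u.code, w.code, z.code] ⟨H _, H _, H _, H _, trivial⟩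
        trivial rfl

/-- Codes of axioms of the theory. -/
def Ax (T : Set Formula) (n : ℕ) : Prop := ∃ φ ∈ T, φ.code = n

/-- Codes of theorems. -/
def Pv (T : Set Formula) (n : ℕ) : Prop := ∃ φ, Provable T φ ∧ n = Formula.code φ

/-- Rules for `Pv`. -/
def pvRules (T : Set Formula) : List Rule :=
  [⟨[(Ax T, x₀)], [], x₀⟩,
   ⟨[(LAx, x₀)], [], x₀⟩,
   ⟨[], [pImp x₀ x₁, x₀], x₁⟩,
   ⟨[], [x₀], pAll x₁ x₀⟩,
   ⟨[], [x₀], p (c 9) x₀⟩]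

theorem code_imp_inv {φ : Formula} {a b : ℕ} (h : Nat.pair 5 (Nat.pair a b) = φ.code) :
    ∃ ψ χ, φ = .imp ψ χ ∧ a = ψ.code ∧ b = χ.code := by
  cases φ <;> simp [Formula.code, Nat.pair_eq_pair] at h
  exact ⟨_, _, rfl, h.1, h.2⟩

theorem s1p_pv {T : Set Formula} (hre : RE T) : S1P (Pv T) := by
  have hax : S1P (Ax T) := s1p_re hre
  refine s1p_of_rules (rules := pvRules T) ?_ ?_ ?_
  · simp [pvRules, sideS1, hax, s1p_lax]
  · intro r hr w hs hp
    simp only [pvRules, List.mem_cons, List.not_mem_nil, or_false] at hr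
    rcases hr with rfl | rfl | rfl | rfl | rfl
    · obtain ⟨⟨φ, h, e⟩, _⟩ := hs
      exact ⟨φ, .ax h, e.symm⟩
    · obtain ⟨⟨φ, h, e⟩, _⟩ := hs
      exact ⟨φ, .logic h, e⟩
    · obtain ⟨⟨φ, h, e⟩, ⟨ψ, h', e'⟩, _⟩ := hp
      simp only [Pt.eval] at e e' ⊢
      obtain ⟨ψ', χ, rfl, e1, e2⟩ := code_imp_inv e
      obtain rfl : ψ' = ψ := Formula.code_inj (e1.symm.trans e')
      exact ⟨χ, h.mp h', e2⟩
    · obtain ⟨⟨φ, h, e⟩, _⟩ := hp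
      simp only [Pt.eval] at e ⊢
      exact ⟨_, h.gen (w 1), by rw [e]; rfl⟩
    · obtain ⟨⟨φ, h, e⟩, _⟩ := hp
      simp only [Pt.eval] at e ⊢
      exact ⟨_, h.nec, by rw [e]; rfl⟩
  · rintro n ⟨φ, h, rfl⟩
    induction h with
    | @ax φ h => exact Der.at (pvRules T) 0 [φ.code] ⟨⟨φ, h, rfl⟩, trivial⟩ trivial rfl
    | @logic φ h => exact Der.at (pvRules T) 1 [φ.code] ⟨⟨φ, h, rfl⟩, trivial⟩ trivial rfl
    | @mp φ ψ _ _ ih1 ih2 =>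
      exact Der.at (pvRules T) 2 [φ.code, ψ.code] trivial ⟨ih1, ih2, trivial⟩ rfl
    | @gen φ x _ ih => exact Der.at (pvRules T) 3 [φ.code, x] trivial ⟨ih, trivial⟩ rfl
    | @nec φ _ ih => exact Der.at (pvRules T) 4 [φ.code] trivial ⟨ih, trivial⟩ rfl

/-- Graph of the code of numerals. -/
def Num (n : ℕ) : Prop := ∃ k, n = Nat.pair k (Term.numeral k).code

/-- Rules for `Num`. -/
def numRules : List Rule :=
  [⟨[], [], p (c 0) (p (c 1) (c 0))⟩, ⟨[], [p x₀ x₁], p (Pt.s x₀) (p (c 2) x₁)⟩]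

theorem s1p_num : S1P Num := by
  refine s1p_of_rules (rules := numRules) ?_ ?_ ?_
  · simp [numRules, sideS1]
  · intro r hr w hs hp
    simp only [numRules, List.mem_cons, List.not_mem_nil, or_false] at hr
    rcases hr with rfl | rfl
    · exact ⟨0, rfl⟩
    · obtain ⟨⟨k, e⟩, _⟩ := hp
      simp only [Pt.eval, Nat.pair_eq_pair] at e ⊢
      exact ⟨k + 1, by rw [e.1, e.2]; rfl⟩
  · rintro n ⟨k, rfl⟩
    induction k with
    | zero => exact Der.at numRules 0 [] trivial trivial rfl
    | succ k ih =>
      exact Der.at numRules 1 [k, (Term.numeral k).code] trivial ⟨ih, trivial⟩ rfl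

/-- The instance of a formula at a numeral, written with a quantifier. -/
def inst (n : ℕ) (A : Formula) : Formula :=
  .ex 0 ((Formula.eq (.var 0) (Term.numeral n)).and A)

/-- Rules for provable instances. -/
def instRules (T : Set Formula) (A : Formula) : List Rule :=
  [⟨[(Num, p x₀ x₁),
      (Pv T, pEx (c 0) (pAnd (pEq (p (c 0) (c 0)) x₁) (c A.code)))], [], x₀⟩]

/-- Rules for provable boxed instances. -/
def boxInstRules (T : Set Formula) (A : Formula) : List Rule :=
  [⟨[(Num, p x₀ x₁),
      (Pv T, p (c 9) (pEx (c 0) (pAnd (pEq (p (c 0) (c 0)) x₁) (c A.code))))], [], x₀⟩]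

theorem s1p_inst {T : Set Formula} (hre : RE T) (A : Formula) :
    S1P fun n => Provable T (inst n A) := by
  refine s1p_of_rules (rules := instRules T A) ?_ ?_ ?_
  · simp [instRules, sideS1, s1p_num, s1p_pv hre]
  · intro r hr w hs hp
    simp only [instRules, List.mem_cons, List.not_mem_nil, or_false] at hr
    subst hr
    obtain ⟨⟨k, e⟩, ⟨φ, h, e'⟩, _⟩ := hs
    simp only [Pt.eval, Nat.pair_eq_pair] at e e' ⊢
    rw [e.2] at e'
    have : inst k A = φ := Formula.code_inj e'
    rw [e.1, this]; exact h
  · intro n h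
    exact Der.at (instRules T A) 0 [n, (Term.numeral n).code]
      ⟨⟨n, rfl⟩, ⟨_, h, rfl⟩, trivial⟩ trivial rfl

theorem s1p_boxInst {T : Set Formula} (hre : RE T) (A : Formula) :
    S1P fun n => Provable T (inst n A).box := by
  refine s1p_of_rules (rules := boxInstRules T A) ?_ ?_ ?_
  · simp [boxInstRules, sideS1, s1p_num, s1p_pv hre]
  · intro r hr w hs hp
    simp only [boxInstRules, List.mem_cons, List.not_mem_nil, or_false] at hr
    subst hr
    obtain ⟨⟨k, e⟩, ⟨φ, h, e'⟩, _⟩ := hs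
    simp only [Pt.eval, Nat.pair_eq_pair] at e e' ⊢
    rw [e.2] at e'
    have : (inst k A).box = φ := Formula.code_inj e'
    rw [e.1, this]; exact h
  · intro n h
    exact Der.at (boxInstRules T A) 0 [n, (Term.numeral n).code]
      ⟨⟨n, rfl⟩, ⟨_, h, rfl⟩, trivial⟩ trivial rfl

end
end ModalArith

namespace ModalArith
open Function

/-! ### Part 11: Σ₁-definable sets are recursively enumerable -/

theorem Term.val_primrec (t : Term) {e : ℕ → ℕ → ℕ} (he : Primrec₂ e) :
    Primrec fun a => t.val (e a) := by
  induction t with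
  | var x => exact he.comp Primrec.id (Primrec.const x)
  | zero => exact Primrec.const 0
  | succ t ih => exact Primrec.succ.comp ih
  | add t u ih1 ih2 => exact Primrec.nat_add.comp ih1 ih2
  | mul t u ih1 ih2 => exact Primrec.nat_mul.comp ih1 ih2

theorem update_primrec {e : ℕ → ℕ → ℕ} (he : Primrec₂ e) (x : ℕ) :
    Primrec₂ fun a y : ℕ => update (e a.unpair.1) x a.unpair.2 y := by
  have h1 : Primrec fun q : ℕ × ℕ => q.1.unpair.1 :=
    Primrec.fst.comp (Primrec.unpair.comp Primrec.fst)
  have h2 : Primrec fun q : ℕ × ℕ => q.1.unpair.2 :=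
    Primrec.snd.comp (Primrec.unpair.comp Primrec.fst)
  refine (Primrec.ite (c := fun q : ℕ × ℕ => q.2 = x)
    (Primrec.eq.comp Primrec.snd (Primrec.const x)) h2
    (he.comp h1 Primrec.snd)).of_eq fun q => ?_
  by_cases h : q.2 = x
  · simp [h]
  · simp only [if_neg h, update_of_ne h]

theorem IsDelta0.val_primrec {φ : Formula} (h : IsDelta0 φ) :
    ∀ {e : ℕ → ℕ → ℕ}, Primrec₂ e → PrimrecPred fun a => φ.val (e a) := by
  induction h with
  | falsum => exact fun _ => PrimrecPred.of_eq (PrimrecPred.not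
      (Primrec.eq.comp (Primrec.const 0) (Primrec.const 0))) fun a => by simp [Formula.val]
  | eq t u => exact fun he => Primrec.eq.comp (t.val_primrec he) (u.val_primrec he)
  | le t u => exact fun he => Primrec.nat_le.comp (t.val_primrec he) (u.val_primrec he)
  | and _ _ ih1 ih2 => exact fun he => (ih1 he).and (ih2 he)
  | or _ _ ih1 ih2 => exact fun he => (ih1 he).or (ih2 he)
  | imp _ _ ih1 ih2 =>
    exact fun he => ((ih1 he).not.or (ih2 he)).of_eq fun a => imp_iff_not_or.symm
  | neg _ ih => exact fun he => (ih he).not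
  | @ball x t φ hx _ ih =>
    intro e he
    have h := ih (update_primrec he x)
    have hR : PrimrecRel fun n a : ℕ => φ.val (fun y =>
        update (e (Nat.pair a n).unpair.1) x (Nat.pair a n).unpair.2 y) :=
      h.comp (Primrec₂.natPair.comp Primrec.snd Primrec.fst)
    refine ((hR.forall_lt).comp (t.val_primrec he) Primrec.id).of_eq fun a => ?_
    rw [Formula.val_ball hx]
    simp
  | @bex x t φ hx _ ih =>
    intro e he
    have h := ih (update_primrec he x)
    have hR : PrimrecRel fun n a : ℕ => φ.val (fun y =>
        update (e (Nat.pair a n).unpair.1) x (Nat.pair a n).unpair.2 y) :=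
      h.comp (Primrec₂.natPair.comp Primrec.snd Primrec.fst)
    refine ((hR.exists_lt).comp (t.val_primrec he) Primrec.id).of_eq fun a => ?_
    rw [Formula.val_bex hx]
    simp

theorem S1P.re {P : ℕ → Prop} (h : S1P P) (c : ℕ) :
    Nat.Partrec fun n => Part.assert (P n) fun _ => Part.some c := by
  obtain ⟨φ, hφ, hv⟩ := h 0
  obtain ⟨u, hu⟩ := φ.exists_low
  obtain ⟨δ, hδ⟩ := exists_nf hφ hu
  have he : Primrec₂ fun a y : ℕ => update (fun _ => a.unpair.1) u a.unpair.2 y :=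
    update_primrec (e := fun a _ => a) Primrec.fst u
  obtain ⟨_, hd⟩ := hδ.d0.val_primrec he
  have hr : Partrec fun n : ℕ => Nat.rfind fun a =>
      Part.some (decide (δ.val fun y =>
        update (fun _ => (Nat.pair n a).unpair.1) u (Nat.pair n a).unpair.2 y)) := by
    refine Partrec.rfind ?_
    exact (hd.comp (Primrec₂.natPair.comp Primrec.fst Primrec.snd)).to_comp.partrec
  refine Partrec.nat_iff.1 ((hr.map ((Computable.const c).to₂)).of_eq fun n => ?_)
  have key : P n ↔ ∃ a, δ.val (update (fun _ => n) u a) := by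
    refine (hv fun _ => n).symm.trans ?_
    refine (natStr_sat φ _).symm.trans ?_
    refine (hδ.sat natStr (u + 5) (natStr_isPA _) (by omega) (by omega) _).trans ?_
    exact exists_congr fun a => natStr_sat δ _
  ext z
  simp only [Part.mem_map_iff, Part.mem_assert_iff, Part.mem_some_iff]
  constructor
  · rintro ⟨a, ha, rfl⟩
    have := Nat.rfind_spec ha
    simp at this
    exact ⟨key.2 ⟨_, this⟩, rfl⟩
  · rintro ⟨hP, rfl⟩
    obtain ⟨a, ha⟩ := key.1 hP
    have : (Nat.rfind fun a =>
      Part.some (decide (δ.val fun y =>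
        update (fun _ => (Nat.pair n a).unpair.1) u (Nat.pair n a).unpair.2 y))).Dom := by
      refine Nat.rfind_dom'.2 ⟨a, ?_, fun _ => trivial⟩
      simpa using ha
    exact ⟨_, Part.get_mem this, rfl⟩

end ModalArith

namespace ModalArith
open Function

/-! ### Part 12: the witness comparison argument -/

/-- `∃ u (α ∧ ∀ w < u ¬ β)`. -/
def wcA (u : ℕ) (α β : Formula) : Formula :=
  .ex u (α.and (.ball (u + 1) (.var u) β.neg))

/-- `∃ w (β ∧ ∀ u ≤ w ¬ α)`. -/
def wcB (u : ℕ) (α β : Formula) : Formula :=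
  .ex (u + 1) (β.and (.ball u (.succ (.var (u + 1))) α.neg))

/-- Assumptions on the compared formulas. -/
structure WC (u : ℕ) (α β : Formula) : Prop where
  pos : 0 < u
  da : IsDelta0 α
  db : IsDelta0 β
  la : α.Low (u + 1)
  lb : β.Low (u + 2)
  fa : ∀ x ∈ α.fv, x = u ∨ x = 0
  fb : ∀ x ∈ β.fv, x = u + 1 ∨ x = 0

/-- Valuation with value `y` at `u` and `x` elsewhere. -/
def vl {M : Type} (u : ℕ) (x y : M) : ℕ → M := update (fun _ => x) u y

namespace WC

variable {u : ℕ} {α β : Formula} {S : Str} {N : ℕ}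

theorem hx1 (u : ℕ) : u + 1 ∉ (Term.var u).fv := by simp [Term.fv]

theorem hx2 (u : ℕ) : u ∉ (Term.succ (.var (u + 1))).fv := by simp [Term.fv]

theorem bodyA (h : WC u α β) : IsDelta0 (α.and (.ball (u + 1) (.var u) β.neg)) :=
  h.da.and (.ball (hx1 u) h.db.neg)

theorem bodyB (h : WC u α β) : IsDelta0 (β.and (.ball u (.succ (.var (u + 1))) α.neg)) :=
  h.db.and (.ball (hx2 u) h.da.neg)

theorem lowBodyA (h : WC u α β) : (α.and (.ball (u + 1) (.var u) β.neg)).Low (u + 2) :=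
  ⟨Formula.Low.mono (by omega) h.la,
    Formula.low_ball (by omega) (var_low (by omega)) h.lb⟩

theorem lowBodyB (h : WC u α β) :
    (β.and (.ball u (.succ (.var (u + 1))) α.neg)).Low (u + 2) :=
  ⟨h.lb, Formula.low_ball (by omega) (var_low (x := u + 1) (by omega))
    (Formula.Low.mono (by omega) h.la)⟩

theorem lowA (h : WC u α β) : (wcA u α β).Low (u + 2) := ⟨by omega, h.lowBodyA⟩

theorem lowB (h : WC u α β) : (wcB u α β).Low (u + 2) := ⟨by omega, h.lowBodyB⟩

theorem low_inst {A : Formula} {K : ℕ} (hA : A.Low K) (hK : 0 < K) (n : ℕ) :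
    (inst n A).Low K := by
  refine ⟨hK, ⟨var_low hK, ?_⟩, hA⟩
  have : (Term.numeral n).fv = ∅ := by
    induction n with
    | zero => rfl
    | succ n ih => exact ih
  simp [Term.Low, this]

theorem inst_sentence {A : Formula} (hA : ∀ x ∈ A.fv, x = 0) (n : ℕ) : Sentence (inst n A) := by
  have : (Term.numeral n).fv = ∅ := by
    induction n with
    | zero => rfl
    | succ n ih => exact ih
  refine Finset.eq_empty_of_forall_notMem fun x hx => ?_
  simp only [inst, Formula.fv, Term.fv, this, Finset.mem_erase, Finset.mem_union,
    Finset.mem_singleton, Finset.notMem_empty, or_false] at hx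
  rcases hx with ⟨h0, h1 | h1⟩
  · exact h0 h1
  · exact h0 (hA x h1)

theorem fvA (h : WC u α β) : ∀ x ∈ (wcA u α β).fv, x = 0 := by
  intro x hx
  simp only [wcA, Formula.fv, Formula.fv_ball (hx1 u), Term.fv, Finset.mem_erase,
    Finset.mem_union, Finset.mem_singleton] at hx
  obtain ⟨h0, h1 | h1 | ⟨h1, h2⟩⟩ := hx
  · exact (h.fa x h1).resolve_left h0
  · exact absurd h1 h0
  · exact (h.fb x h2).resolve_left h1

theorem fvB (h : WC u α β) : ∀ x ∈ (wcB u α β).fv, x = 0 := by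
  intro x hx
  simp only [wcB, Formula.fv, Formula.fv_ball (hx2 u), Term.fv, Finset.mem_erase,
    Finset.mem_union, Finset.mem_singleton] at hx
  obtain ⟨h0, h1 | h1 | ⟨h1, h2⟩⟩ := hx
  · exact (h.fb x h1).resolve_left h0
  · exact absurd h1 h0
  · exact (h.fa x h2).resolve_left h1

theorem sat_inst (hS : IsPA N S) (A : Formula) (n : ℕ) (v : ℕ → S.M) :
    S.Sat (inst n A) v ↔ S.Sat A (update v 0 (S.nu n)) := by
  simp [inst, Str.Sat, Str.tval, Str.tval_numeral]

theorem sat_a (h : WC u α β) (hS : IsPA N S) (v : ℕ → S.M) :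
    S.Sat α v ↔ S.Sat α (vl u (v 0) (v u)) := by
  refine hS.sat_congr fun i hi => ?_
  rcases h.fa i hi with rfl | rfl
  · simp [vl]
  · simp [vl, h.pos.ne]

theorem sat_b (h : WC u α β) (hS : IsPA N S) (v : ℕ → S.M) :
    S.Sat β v ↔ S.Sat β (vl (u + 1) (v 0) (v (u + 1))) := by
  refine hS.sat_congr fun i hi => ?_
  rcases h.fb i hi with rfl | rfl
  · simp [vl]
  · simp [vl]

theorem sat_A (h : WC u α β) (hS : IsPA N S) (v : ℕ → S.M) :
    S.Sat (wcA u α β) v ↔ ∃ y, S.Sat α (vl u (v 0) y) ∧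
      ∀ z, S.lt z y → ¬ S.Sat β (vl (u + 1) (v 0) z) := by
  have hu : (0 : ℕ) ≠ u := h.pos.ne
  refine exists_congr fun y => and_congr ?_ ?_
  · rw [h.sat_a hS]; simp [hu]
  · rw [Str.sat_ball (hx1 u)]
    refine forall_congr' fun z => ?_
    simp only [Str.Sat, Str.tval, update_self]
    rw [h.sat_b hS]
    simp [hu]

theorem sat_B (h : WC u α β) (hS : IsPA N S) (v : ℕ → S.M) :
    S.Sat (wcB u α β) v ↔ ∃ z, S.Sat β (vl (u + 1) (v 0) z) ∧
      ∀ y, S.lt y (S.succ z) → ¬ S.Sat α (vl u (v 0) y) := by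
  have hu : (0 : ℕ) ≠ u := h.pos.ne
  refine exists_congr fun z => and_congr ?_ ?_
  · rw [h.sat_b hS]; simp
  · rw [Str.sat_ball (hx2 u)]
    refine forall_congr' fun y => ?_
    simp only [Str.Sat, Str.tval, update_self]
    rw [h.sat_a hS]
    simp [hu]

theorem vl_nu (S : Str) (u n k : ℕ) : vl u (S.nu n) (S.nu k) = fun i => S.nu (vl u n k i) :=
  S.update_nu (fun _ => n) u k

/-- One of the two comparisons holds, and the first one is boxed. -/
theorem or_provable (h : WC u α β) {T : Set Formula} (hT : Extends T PAK)
    (hex : ∀ S, IsModel T (u + 5) S → ∀ x, ∃ y, S.Sat α (vl u x y)) (n : ℕ) :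
    Provable T ((inst n (wcA u α β)).box.or (inst n (wcB u α β))) := by
  have hN : 3 ≤ u + 5 := by omega
  have hmono : ∀ {φ : Formula}, φ.Low (u + 2) → φ.Low (u + 5) :=
    fun h => Formula.Low.mono (by omega) h
  have lA := low_inst h.lowA (by omega) n
  have lB := low_inst h.lowB (by omega) n
  refine completeness hT hN ⟨hmono lA, hmono lB⟩ fun S hS v => ?_
  have hP : IsPA (u + 5) S := hS.toIsPA
  have hbox : S.Sat (inst n (wcA u α β)) v → S.box (inst n (wcA u α β)) v := by
    refine hS.box_ex hT hN (by omega) (hmono lA.2) ?_ v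
    refine hS.box_and hT hN (hmono lA.2.1) (hmono lA.2.2)
      (fun v hv => (hS.box_delta0 hT hN (K := u + 2) (by omega) (.eq _ _) lA.2.1 v).1 hv) ?_
    refine hS.box_ex hT hN (by omega) (hmono h.lowBodyA) ?_
    exact fun v hv => (hS.box_delta0 hT hN (K := u + 2) (by omega) h.bodyA h.lowBodyA v).1 hv
  obtain ⟨y0, hy0⟩ := hex S hS (S.nu n)
  obtain ⟨y, hy, hmin⟩ := hP.least hN h.la (by omega) (by omega) hy0
  by_cases hz : ∀ z, S.lt z y → ¬ S.Sat β (vl (u + 1) (S.nu n) z)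
  · refine Or.inl (hbox ?_)
    rw [sat_inst hP, h.sat_A hP]
    simp only [update_self]
    exact ⟨y, hy, hz⟩
  · push Not at hz
    obtain ⟨z, hz, hb⟩ := hz
    refine Or.inr ?_
    rw [sat_inst hP, h.sat_B hP]
    simp only [update_self]
    exact ⟨z, hb, fun y' hy' => hmin y' (hP.lt_of_lt_of_le hN hy' hz)⟩

theorem not_B (h : WC u α β) {T : Set Formula} (hT : Extends T PAK) {n k : ℕ}
    (ha : α.val (vl u n k)) (hb : ∀ j, ¬ β.val (vl (u + 1) n j)) :
    Provable T (inst n (wcB u α β)).neg := by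
  have hN : 3 ≤ u + 5 := by omega
  have lB := low_inst h.lowB (by omega) n
  refine completeness hT hN (φ := .neg _) (Formula.Low.mono (N := u + 2) (by omega) lB)
    fun S hS v hs => ?_
  have hP : IsPA (u + 5) S := hS.toIsPA
  rw [sat_inst hP, h.sat_B hP] at hs
  simp only [update_self] at hs
  obtain ⟨z, hz, hy⟩ := hs
  rcases hP.lt_or_le hN (S.nu k) (S.succ z) with h1 | h1
  · refine hy _ h1 ?_
    rw [vl_nu, hP.delta0_nu hN h.da]
    exact ha
  · obtain ⟨j, -, rfl⟩ := hP.lt_nu hN (m := z) h1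
    rw [vl_nu, hP.delta0_nu hN h.db] at hz
    exact hb j hz

theorem not_A (h : WC u α β) {T : Set Formula} (hT : Extends T PAK) {n k : ℕ}
    (hb : β.val (vl (u + 1) n k)) (ha : ∀ j, ¬ α.val (vl u n j)) :
    Provable T (inst n (wcA u α β)).neg := by
  have hN : 3 ≤ u + 5 := by omega
  have lA := low_inst h.lowA (by omega) n
  refine completeness hT hN (φ := .neg _) (Formula.Low.mono (N := u + 2) (by omega) lA)
    fun S hS v hs => ?_
  have hP : IsPA (u + 5) S := hS.toIsPA
  rw [sat_inst hP, h.sat_A hP] at hs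
  simp only [update_self] at hs
  obtain ⟨y, hy, hz⟩ := hs
  rcases hP.lt_or_le hN (S.nu k) y with h1 | h1
  · refine hz _ h1 ?_
    rw [vl_nu, hP.delta0_nu hN h.db]
    exact hb
  · obtain ⟨j, -, rfl⟩ := hP.lt_nu hN (b := k + 1) (m := y)
      (hP.lt_of_le_of_lt hN h1 (hP.lt_self_succ _))
    rw [vl_nu, hP.delta0_nu hN h.da] at hy
    exact ha j hy

end WC

/-- The diagonal function. -/
theorem diag_partrec :
    Nat.Partrec fun e => Nat.Partrec.Code.eval (Denumerable.ofNat Nat.Partrec.Code e) e := by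
  refine Partrec.nat_iff.1 ?_
  exact Nat.Partrec.Code.eval_part.comp (Computable.ofNat _) Computable.id

theorem diagonal {X Y U V : ℕ → Prop} (hX : S1P X) (hY : S1P Y) (hXY : ∀ n, X n ∨ Y n)
    (hU : ∀ e, U e ↔ 0 ∈ Nat.Partrec.Code.eval (Denumerable.ofNat Nat.Partrec.Code e) e)
    (hV : ∀ e, V e ↔ 1 ∈ Nat.Partrec.Code.eval (Denumerable.ofNat Nat.Partrec.Code e) e)
    (hXV : ∀ n, X n → ¬ V n) (hYU : ∀ n, Y n → ¬ U n) : False := by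
  obtain ⟨k, hk, hk'⟩ := Nat.Partrec.merge' (hX.re 1) (hY.re 0)
  obtain ⟨c, rfl⟩ := Nat.Partrec.Code.exists_code.1 hk
  obtain ⟨e, he⟩ : ∃ e, Denumerable.ofNat Nat.Partrec.Code e = c :=
    ⟨Encodable.encode c, Denumerable.ofNat_encode c⟩
  have hdom : (c.eval e).Dom := by
    rw [(hk' e).2]
    exact (hXY e).imp (fun h => ⟨h, trivial⟩) (fun h => ⟨h, trivial⟩)
  obtain ⟨z, hz⟩ := Part.dom_iff_mem.1 hdom
  have := (hk' e).1 z hz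
  simp only [Part.mem_assert_iff, Part.mem_some_iff] at this
  rcases this with ⟨h, rfl⟩ | ⟨h, rfl⟩
  · exact hXV e h ((hV e).2 (he ▸ hz))
  · exact hYU e h ((hU e).2 (he ▸ hz))

theorem nf_val {u : ℕ} {φ δ : Formula} (h : NF u φ δ) (v : ℕ → ℕ) :
    φ.val v ↔ ∃ a, δ.val (update v u a) := by
  refine (natStr_sat φ _).symm.trans ?_
  refine (h.sat natStr (u + 5) (natStr_isPA _) (by omega) (by omega) _).trans ?_
  exact exists_congr fun a => natStr_sat δ _

theorem val_sentence {φ : Formula} (h : Sentence φ) (v : ℕ → ℕ) : φ.val v ↔ StdTrue φ := by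
  refine (natStr_sat φ _).symm.trans (Iff.trans ?_ (natStr_sat φ _))
  refine (natStr_isPA 5).sat_congr fun i hi => ?_
  rw [h] at hi
  exact absurd hi (Finset.notMem_empty i)

theorem statement11' (T : Set Formula) (hre : RE T) (hT : Extends T PAK)
    (hbot : ¬ Provable T (Formula.box Formula.falsum))
    (hdp : HasDP2 T IsB IsSigma1) :
    Sigma1Sound T := by
  intro σ hσ hsen hprov
  by_contra hfalse
  obtain ⟨ρU, hU1, hU2, hU3⟩ := exists_diag_formula _ diag_partrec 0
  obtain ⟨ρV, hV1, hV2, hV3⟩ := exists_diag_formula _ diag_partrec 1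
  obtain ⟨a, ha⟩ := σ.exists_low
  obtain ⟨b, hb⟩ := ρU.exists_low
  obtain ⟨c, hc⟩ := ρV.exists_low
  obtain ⟨u, hu0, hua, hub, huc⟩ : ∃ u, 0 < u ∧ a ≤ u ∧ b ≤ u ∧ c ≤ u :=
    ⟨a + b + c + 1, by omega, by omega, by omega, by omega⟩
  obtain ⟨δσ, hδσ⟩ := exists_nf hσ (Formula.Low.mono hua ha)
  obtain ⟨δU, hδU⟩ := exists_nf hU1 (Formula.Low.mono hub hb)
  obtain ⟨δV, hδV⟩ := exists_nf hV1 (u := u + 1) (Formula.Low.mono (by omega) hc)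
  have hw : WC u (δσ.or δU) δV := by
    refine ⟨hu0, hδσ.d0.or hδU.d0, hδV.d0, ⟨hδσ.low, hδU.low⟩, hδV.low, ?_, ?_⟩
    · intro x hx
      rcases Finset.mem_union.1 hx with hx | hx
      · rcases hδσ.fv x hx with h | h
        · exact Or.inl h
        · rw [hsen] at h; exact absurd h (Finset.notMem_empty x)
      · exact (hδU.fv x hx).imp_right fun h => Finset.mem_singleton.1 (hU2 h)
    · intro x hx
      exact (hδV.fv x hx).imp_right fun h => Finset.mem_singleton.1 (hV2 h)
  have hα : ∀ n, (∃ k, (δσ.or δU).val (vl u n k)) ↔ 0 ∈ Nat.Partrec.Code.eval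
      (Denumerable.ofNat Nat.Partrec.Code n) n := by
    intro n
    rw [← hU3 fun _ => n, nf_val hδU]
    refine exists_congr fun k => or_iff_right fun h => hfalse ?_
    exact (val_sentence hsen fun _ => n).1 ((nf_val hδσ _).2 ⟨k, h⟩)
  have hβ : ∀ n, (∃ k, δV.val (vl (u + 1) n k)) ↔ 1 ∈ Nat.Partrec.Code.eval
      (Denumerable.ofNat Nat.Partrec.Code n) n := by
    intro n
    rw [← hV3 fun _ => n, nf_val hδV]
    rfl
  have hdisj : ∀ n, ¬ ((∃ k, (δσ.or δU).val (vl u n k)) ∧ ∃ k, δV.val (vl (u + 1) n k)) := by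
    intro n
    rw [hα, hβ]
    rintro ⟨h, h'⟩
    exact absurd (Part.mem_unique h h') (by decide)
  have hex : ∀ S, IsModel T (u + 5) S → ∀ x, ∃ y, S.Sat (δσ.or δU) (vl u x y) := by
    intro S hS x
    have h1 := hS.sat_thm σ (Formula.Low.mono (by omega) ha) hprov fun _ => x
    obtain ⟨y, hy⟩ := (hδσ.sat S (u + 5) hS.toIsPA (by omega) (by omega) _).1 h1
    exact ⟨y, Or.inl hy⟩
  have hcon : ¬ Provable T .falsum := fun h => hbot h.nec
  refine diagonal (X := fun n => Provable T (inst n (wcA u (δσ.or δU) δV)).box)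
    (Y := fun n => Provable T (inst n (wcB u (δσ.or δU) δV)))
    (s1p_boxInst hre _) (s1p_inst hre _) ?_ (fun e => hα e) (fun e => hβ e) ?_ ?_
  · intro n
    refine hdp _ _ ⟨_, rfl⟩ ?_ (WC.inst_sentence hw.fvA n) (WC.inst_sentence hw.fvB n)
      (hw.or_provable hT hex n)
    exact .ex (.and (.delta0 (.eq _ _)) (.ex (.delta0 hw.bodyB)))
  · rintro n hX ⟨k, hk⟩
    have h1 : Provable T (inst n (wcA u (δσ.or δU) δV)).neg :=
      hw.not_A hT hk fun j hj => hdisj n ⟨⟨j, hj⟩, ⟨k, hk⟩⟩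
    exact hbot ((Provable.boxMono hT ((Provable.logic (.negElimFalsum _)).mp h1)).mp hX)
  · rintro n hY ⟨k, hk⟩
    have h1 : Provable T (inst n (wcB u (δσ.or δU) δV)).neg :=
      hw.not_B hT hk fun j hj => hdisj n ⟨⟨k, hk⟩, ⟨j, hj⟩⟩
    exact hcon (((Provable.logic (.negElimFalsum _)).mp h1).mp hY)

end ModalArith

namespace ModalArith

/-- If T is an r.e. extension of PA(K) with T ⊬ □⊥ and T has (B, Σ₁)-DP,
then T is Σ₁-sound. -/
theorem statement11 (T : Set Formula) (hre : RE T) (hT : Extends T PAK)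
    (hbot : ¬ Provable T (Formula.box Formula.falsum))
    (hdp : HasDP2 T IsB IsSigma1) :
    Sigma1Sound T := by
  exact statement11' T hre hT hbot hdp

end ModalArith
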